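/- Let Ω be a properly convex quasi-homogeneous affine domain in ℝ³ that is not a cone. Then Ω is affinely equivalent to one of the following: (i) the 3-dimensional paraboloid {(x,y,z) ∈ ℝ³ | z > x² + y²}; (ii) the product of a parabola and a half-line, {(x,y,z) ∈ ℝ³ | y > x² and z > 0}. -/

import Mathlib

open Matrix Set Filter Topology Pointwise

noncomputable section

/-- The affine action on ℝⁿ of an (n+1)×(n+1) invertible matrix in affine form
(ℝⁿ is identified with the hyperplane x_{n+1} = 1). -/
def affAct (n : ℕ) (g : GL (Fin (n + 1)) ℝ) (x : Fin n → ℝ) : Fin n → ℝ :=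
  fun i => (∑ j : Fin n, g.val i.castSucc j.castSucc * x j) + g.val i.castSucc (Fin.last n)

/-- A matrix in GL(n+1,ℝ) has affine form if its last row is (0, …, 0, 1). -/
def IsAffineForm (n : ℕ) (g : GL (Fin (n + 1)) ℝ) : Prop :=
  (∀ j : Fin n, g.val (Fin.last n) j.castSucc = 0) ∧ g.val (Fin.last n) (Fin.last n) = 1

/-- Aut(Ω): the group (here: set) of affine transformations of ℝⁿ preserving Ω,
realized as affine-form matrices in GL(n+1,ℝ). -/
def AutSet (n : ℕ) (Ω : Set (Fin n → ℝ)) : Set (GL (Fin (n + 1)) ℝ) :=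
  {g | IsAffineForm n g ∧ affAct n g '' Ω = Ω}

/-- Aut⁰(Ω): the identity component of Aut(Ω). -/
def AutIdComp (n : ℕ) (Ω : Set (Fin n → ℝ)) : Set (GL (Fin (n + 1)) ℝ) :=
  connectedComponentIn (AutSet n Ω) 1

/-- The limit set Λ_G of a subset G of Aut(Ω). -/
def limitSet (n : ℕ) (Ω : Set (Fin n → ℝ)) (G : Set (GL (Fin (n + 1)) ℝ)) :
    Set (Fin n → ℝ) :=
  {ξ | ξ ∈ frontier Ω ∧ ∃ x ∈ Ω, ∃ u : ℕ → GL (Fin (n + 1)) ℝ,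
    (∀ k, u k ∈ G) ∧ Filter.Tendsto (fun k => affAct n (u k) x) Filter.atTop (nhds ξ)}

/-- Ω is a convex affine domain: a nonempty open convex subset of ℝⁿ. -/
def IsConvexDomain (n : ℕ) (Ω : Set (Fin n → ℝ)) : Prop :=
  Ω.Nonempty ∧ IsOpen Ω ∧ Convex ℝ Ω

/-- Ω contains no complete affine line. -/
def HasNoLine (n : ℕ) (Ω : Set (Fin n → ℝ)) : Prop :=
  ¬ ∃ x ∈ Ω, ∃ v : Fin n → ℝ, v ≠ 0 ∧ ∀ t : ℝ, x + t • v ∈ Ω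

/-- Ω is a properly convex affine domain. -/
def IsProperlyConvexDomain (n : ℕ) (Ω : Set (Fin n → ℝ)) : Prop :=
  IsConvexDomain n Ω ∧ HasNoLine n Ω

/-- Ω is quasi-homogeneous: some compact K ⊆ Ω has ⋃_{g ∈ Aut(Ω)} g(K) = Ω. -/
def IsQuasiHomogeneous (n : ℕ) (Ω : Set (Fin n → ℝ)) : Prop :=
  ∃ K : Set (Fin n → ℝ), IsCompact K ∧ K ⊆ Ω ∧
    (⋃ g ∈ AutSet n Ω, affAct n g '' K) = Ω

/-- Aut(Ω) is irreducible: it preserves no nonempty proper affine subspace of ℝⁿ. -/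
def IsIrreducibleAut (n : ℕ) (Ω : Set (Fin n → ℝ)) : Prop :=
  ¬ ∃ S : AffineSubspace ℝ (Fin n → ℝ), (S : Set (Fin n → ℝ)).Nonempty ∧
      (S : Set (Fin n → ℝ)) ≠ Set.univ ∧
      ∀ g ∈ AutSet n Ω, affAct n g '' (S : Set (Fin n → ℝ)) = (S : Set (Fin n → ℝ))

/-- The asymptotic cone AC(Ω). -/
def asympCone (n : ℕ) (Ω : Set (Fin n → ℝ)) : Set (Fin n → ℝ) :=
  {u | ∀ x ∈ Ω, ∀ t : ℝ, 0 ≤ t → x + t • u ∈ Ω}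

/-- Ω is a cone with some vertex v. -/
def IsCone (n : ℕ) (Ω : Set (Fin n → ℝ)) : Prop :=
  ∃ v : Fin n → ℝ, ∀ x ∈ Ω, ∀ t : ℝ, 0 < t → v + t • (x - v) ∈ Ω

/-- Two subsets of ℝⁿ are affinely equivalent. -/
def AffinelyEquivalent (n : ℕ) (Ω Ω' : Set (Fin n → ℝ)) : Prop :=
  ∃ e : (Fin n → ℝ) ≃ᵃ[ℝ] (Fin n → ℝ), e '' Ω = Ω'

/-- Γ acts freely on Ω. -/
def ActsFreely (n : ℕ) (Ω : Set (Fin n → ℝ)) (Γ : Set (GL (Fin (n + 1)) ℝ)) : Prop :=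
  ∀ γ ∈ Γ, γ ≠ 1 → ∀ x ∈ Ω, affAct n γ x ≠ x

/-- Γ acts properly discontinuously on Ω. -/
def ActsProperlyDiscontinuously (n : ℕ) (Ω : Set (Fin n → ℝ))
    (Γ : Set (GL (Fin (n + 1)) ℝ)) : Prop :=
  ∀ K L : Set (Fin n → ℝ), K ⊆ Ω → L ⊆ Ω → IsCompact K → IsCompact L →
    {γ ∈ Γ | (affAct n γ '' K ∩ L).Nonempty}.Finite

/-- Γ acts cocompactly on Ω. -/
def ActsCocompactly (n : ℕ) (Ω : Set (Fin n → ℝ)) (Γ : Set (GL (Fin (n + 1)) ℝ)) : Prop :=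
  ∃ K : Set (Fin n → ℝ), IsCompact K ∧ K ⊆ Ω ∧ (⋃ γ ∈ Γ, affAct n γ '' K) = Ω

/-- The linear part of an affine-form matrix has determinant one. -/
def LinearPartDetOne (n : ℕ) (g : GL (Fin (n + 1)) ℝ) : Prop :=
  (Matrix.of fun i j : Fin n => g.val i.castSucc j.castSucc).det = 1

section Recession

variable {E : Type*} [NormedAddCommGroup E] [NormedSpace ℝ E]

/-- The recession cone of a set. -/
def recCone (Ω : Set E) : Set E := {u | ∀ x ∈ Ω, ∀ t : ℝ, 0 ≤ t → x + t • u ∈ Ω}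

/-- The properly convex domains: nonempty, open, convex, with salient recession cone. -/
structure ProperDomain (Ω : Set E) : Prop where
  nonempty : Ω.Nonempty
  isOpen : IsOpen Ω
  convex : Convex ℝ Ω
  salient : ∀ u ∈ recCone Ω, -u ∈ recCone Ω → u = 0

/-- `g` maps `Ω` onto itself. -/
def Preserves (g : E ≃ᵃ[ℝ] E) (Ω : Set E) : Prop := ∀ x, g x ∈ Ω ↔ x ∈ Ω

/-- The automorphisms of `Ω` that satisfy `P` move a compact subset over all of `Ω`. -/
def CocompactBy (P : (E ≃ᵃ[ℝ] E) → Prop) (Ω : Set E) : Prop :=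
  ∃ K, IsCompact K ∧ K ⊆ Ω ∧ ∀ x ∈ Ω, ∃ g, P g ∧ Preserves g Ω ∧ ∃ y ∈ K, g y = x

lemma add_smul_sub_mem_of_closure {Ω : Set E} (ho : IsOpen Ω) (hc : Convex ℝ Ω) {x y : E}
    (hx : x ∈ Ω) (hy : y ∈ closure Ω) {t : ℝ} (h0 : 0 ≤ t) (h1 : t < 1) :
    x + t • (y - x) ∈ Ω := by
  have hx' : x ∈ interior Ω := by rwa [ho.interior_eq]
  have h := hc.combo_interior_closure_mem_interior hx' hy (a := 1 - t) (b := t)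
    (by linarith) h0 (by ring)
  rw [ho.interior_eq] at h
  convert h using 1
  module

lemma add_smul_sub_mem {Ω : Set E} (hc : Convex ℝ Ω) {x y : E}
    (hx : x ∈ Ω) (hy : y ∈ Ω) {t : ℝ} (h0 : 0 ≤ t) (h1 : t ≤ 1) :
    x + t • (y - x) ∈ Ω := by
  have h := hc hx hy (a := 1 - t) (b := t) (by linarith) h0 (by ring)
  convert h using 1
  module

lemma add_smul_mem_of_closure {Ω : Set E} (ho : IsOpen Ω) (hc : Convex ℝ Ω) {x u : E}
    {t s : ℝ} (hx : x ∈ Ω) (hy : x + s • u ∈ closure Ω) (h0 : 0 ≤ t) (h1 : t < s) :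
    x + t • u ∈ Ω := by
  have hs : 0 < s := by linarith
  have := add_smul_sub_mem_of_closure ho hc hx hy (t := t / s) (by positivity)
    (by rw [div_lt_one hs]; exact h1)
  convert this using 2
  rw [add_sub_cancel_left, smul_smul]
  congr 1
  field_simp

lemma recCone_of_closure {Ω : Set E} (ho : IsOpen Ω) (hc : Convex ℝ Ω) {u : E}
    (h : ∀ x ∈ Ω, ∀ t : ℝ, 0 < t → x + t • u ∈ closure Ω) : u ∈ recCone Ω := by
  intro x hx t ht
  exact add_smul_mem_of_closure ho hc hx (h x hx (t + 1) (by linarith)) ht (by linarith)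

lemma recCone_of_tendsto {Ω : Set E} (ho : IsOpen Ω) (hc : Convex ℝ Ω) {p : ℕ → E} {s : ℕ → ℝ}
    {u : E} (hp : ∀ n, p n ∈ Ω) (hs : Tendsto s atTop atTop)
    (hu : Tendsto (fun n => (s n)⁻¹ • p n) atTop (𝓝 u)) : u ∈ recCone Ω := by
  apply recCone_of_closure ho hc
  intro x hx t ht
  have h1 : Tendsto (fun n => x + (t • ((s n)⁻¹ • p n) - (t * (s n)⁻¹) • x)) atTop
      (𝓝 (x + (t • u - (t * 0) • x))) :=
    tendsto_const_nhds.add ((hu.const_smul t).sub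
      ((hs.inv_tendsto_atTop.const_mul t).smul_const x))
  rw [mul_zero, zero_smul, sub_zero] at h1
  refine mem_closure_of_tendsto h1 ?_
  filter_upwards [hs.eventually_ge_atTop (max t 1)] with n hn
  have hn1 : 1 ≤ s n := (le_max_right _ _).trans hn
  have hnt : t ≤ s n := (le_max_left _ _).trans hn
  have h2 := add_smul_sub_mem hc hx (hp n) (t := t * (s n)⁻¹) (by positivity)
    (by rw [← div_eq_mul_inv, div_le_one (by linarith)]; exact hnt)
  convert h2 using 2
  module

lemma zero_mem_recCone (Ω : Set E) : (0 : E) ∈ recCone Ω := by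
  intro x hx t _
  simpa using hx

lemma smul_mem_recCone {Ω : Set E} {u : E} (hu : u ∈ recCone Ω) {a : ℝ} (ha : 0 ≤ a) :
    a • u ∈ recCone Ω := by
  intro x hx t ht
  rw [smul_smul]
  exact hu x hx _ (by positivity)

lemma add_mem_recCone {Ω : Set E} {u v : E} (hu : u ∈ recCone Ω) (hv : v ∈ recCone Ω) :
    u + v ∈ recCone Ω := by
  intro x hx t ht
  rw [smul_add, ← add_assoc]
  exact hv _ (hu x hx t ht) t ht

lemma isClosed_recCone {Ω : Set E} (ho : IsOpen Ω) (hc : Convex ℝ Ω) :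
    IsClosed (recCone Ω) := by
  refine isClosed_of_closure_subset fun u hu => ?_
  apply recCone_of_closure ho hc
  intro x hx t ht
  obtain ⟨w, hw, hwu⟩ := mem_closure_iff_seq_limit.1 hu
  exact mem_closure_of_tendsto (tendsto_const_nhds.add (hwu.const_smul t))
    (Eventually.of_forall fun n => hw n x hx t ht.le)

lemma recCone_of_line {Ω : Set E} (ho : IsOpen Ω) (hc : Convex ℝ Ω) {x u : E}
    (h : ∀ t : ℝ, 0 ≤ t → x + t • u ∈ Ω) : u ∈ recCone Ω := by
  refine recCone_of_tendsto ho hc (p := fun n : ℕ => x + ((n : ℝ) + 1) • u)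
    (s := fun n : ℕ => (n : ℝ) + 1)
    (fun n => h _ (by positivity)) ?_ ?_
  · exact tendsto_atTop_add_const_right _ _ tendsto_natCast_atTop_atTop
  · have h1 : Tendsto (fun n : ℕ => ((n : ℝ) + 1)⁻¹ • x + u) atTop (𝓝 ((0 : ℝ) • x + u)) := by
      refine Tendsto.add_const u (Tendsto.smul_const ?_ x)
      exact (tendsto_atTop_add_const_right _ _ tendsto_natCast_atTop_atTop).inv_tendsto_atTop
    rw [zero_smul, zero_add] at h1
    refine h1.congr fun n => ?_
    have : ((n : ℝ) + 1) ≠ 0 := by positivity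
    rw [smul_add, smul_smul, inv_mul_cancel₀ this, one_smul]

lemma Preserves.recCone_iff {g : E ≃ᵃ[ℝ] E} {Ω : Set E} (hg : Preserves g Ω) (u : E) :
    g.linear u ∈ recCone Ω ↔ u ∈ recCone Ω := by
  have key : ∀ x (t : ℝ), g (x + t • u) = g x + t • g.linear u := by
    intro x t
    have := g.map_vadd x (t • u)
    simp only [vadd_eq_add, map_smul] at this
    rw [add_comm x, this, add_comm]
  constructor
  · intro h x hx t ht
    rw [← hg, key]
    exact h _ ((hg x).2 hx) t ht
  · intro h x hx t ht
    obtain ⟨y, rfl⟩ := g.surjective x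
    rw [← key, hg]
    exact h y ((hg y).1 hx) t ht

lemma Preserves.mul {g h : E ≃ᵃ[ℝ] E} {Ω : Set E} (hg : Preserves g Ω) (hh : Preserves h Ω) :
    Preserves (g * h) Ω := fun x => (hg (h x)).trans (hh x)

lemma Preserves.inv {g : E ≃ᵃ[ℝ] E} {Ω : Set E} (hg : Preserves g Ω) : Preserves g⁻¹ Ω := by
  intro x
  rw [← hg (g⁻¹ x)]
  change g (g.symm x) ∈ Ω ↔ _
  rw [g.apply_symm_apply]

variable [FiniteDimensional ℝ E]

lemma exists_subseq_normalized {v : ℕ → E} (hv : Tendsto (fun n => ‖v n‖) atTop atTop) :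
    ∃ u : E, ‖u‖ = 1 ∧ ∃ φ : ℕ → ℕ, StrictMono φ ∧
      Tendsto (fun n => ‖v (φ n)‖⁻¹ • v (φ n)) atTop (𝓝 u) := by
  have := FiniteDimensional.proper ℝ E
  obtain ⟨N, hN⟩ := eventually_atTop.1 (hv.eventually_gt_atTop 0)
  have hmem : ∀ n, ‖v (n + N)‖⁻¹ • v (n + N) ∈ Metric.sphere (0 : E) 1 := by
    intro n
    have h := hN (n + N) (by omega)
    rw [mem_sphere_zero_iff_norm, norm_smul, norm_inv, norm_norm, inv_mul_cancel₀ h.ne']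
  obtain ⟨u, hu, φ, hφ, hlim⟩ := (isCompact_sphere (0 : E) 1).tendsto_subseq hmem
  refine ⟨u, by simpa using hu, fun n => φ n + N, fun a b hab => ?_, hlim⟩
  have := hφ hab
  simp only; omega

lemma exists_recCone_of_tendsto {Ω : Set E} (ho : IsOpen Ω) (hc : Convex ℝ Ω) {y v : ℕ → E}
    {K : Set E} (hK : IsCompact K) (hy : ∀ n, y n ∈ K)
    (hv : Tendsto (fun n => ‖v n‖) atTop atTop) :
    ∃ u : E, ‖u‖ = 1 ∧ ((∀ n, y n + v n ∈ Ω) → u ∈ recCone Ω) ∧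
      ((∀ n, y n - v n ∈ Ω) → -u ∈ recCone Ω) := by
  obtain ⟨u, hu, φ, hφ, hlim⟩ := exists_subseq_normalized hv
  have hs := hv.comp hφ.tendsto_atTop
  obtain ⟨C, hC⟩ := hK.isBounded.exists_norm_le
  have h0 : Tendsto (fun n => ‖v (φ n)‖⁻¹ • y (φ n)) atTop (𝓝 0) :=
    NormedField.tendsto_zero_smul_of_tendsto_zero_of_bounded hs.inv_tendsto_atTop
      (isBoundedUnder_of ⟨C, fun n => hC _ (hy _)⟩)
  refine ⟨u, hu, fun h => ?_, fun h => ?_⟩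
  · refine recCone_of_tendsto ho hc (fun n => h (φ n)) hs ?_
    simpa [smul_add] using h0.add hlim
  · refine recCone_of_tendsto ho hc (fun n => h (φ n)) hs ?_
    simpa [smul_sub] using h0.sub hlim

lemma exists_recCone_of_unbounded {Ω : Set E} (ho : IsOpen Ω) (hc : Convex ℝ Ω)
    (hb : ¬ Bornology.IsBounded Ω) : ∃ u : E, u ≠ 0 ∧ u ∈ recCone Ω := by
  have : ∀ n : ℕ, ∃ v ∈ Ω, (n : ℝ) ≤ ‖v‖ := by
    intro n
    by_contra! h
    exact hb (isBounded_iff_forall_norm_le.2 ⟨n, fun x hx => (h x hx).le⟩)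
  choose v hv hvn using this
  obtain ⟨u, hu, h1, -⟩ := exists_recCone_of_tendsto ho hc (y := fun _ => (0 : E)) (v := v)
    isCompact_singleton (fun _ => mem_singleton _)
    (tendsto_atTop_mono hvn tendsto_natCast_atTop_atTop)
  refine ⟨u, fun h => by simp [h] at hu, h1 fun n => by simpa using hv n⟩

lemma ProperDomain.exists_bound {Ω : Set E} (hΩ : ProperDomain Ω) {K : Set E}
    (hK : IsCompact K) :
    ∃ ρ : ℝ, ∀ y ∈ K, ∀ v, y + v ∈ Ω → y - v ∈ Ω → ‖v‖ ≤ ρ := by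
  by_contra! h
  have : ∀ n : ℕ, ∃ y ∈ K, ∃ v, y + v ∈ Ω ∧ y - v ∈ Ω ∧ (n : ℝ) < ‖v‖ := fun n => h n
  choose y hy v h1 h2 h3 using this
  obtain ⟨u, hu, ha, hb⟩ := exists_recCone_of_tendsto hΩ.isOpen hΩ.convex hK hy
    (tendsto_atTop_mono (fun n => (h3 n).le) tendsto_natCast_atTop_atTop)
  have := hΩ.salient u (ha h1) (hb h2)
  simp [this] at hu

end Recession

section Cocompact

lemma exists_ball_subset_of_compact {E : Type*} [NormedAddCommGroup E] {Ω K : Set E}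
    (ho : IsOpen Ω) (hK : IsCompact K)
    (hKΩ : K ⊆ Ω) : ∃ r > 0, ∀ y ∈ K, ∀ v, ‖v‖ < r → y + v ∈ Ω := by
  obtain ⟨r, hr, h⟩ := hK.exists_thickening_subset_open ho hKΩ
  refine ⟨r, hr, fun y hy v hv => h ?_⟩
  rw [Metric.mem_thickening_iff]
  exact ⟨y, hy, by simpa using hv⟩

variable {E : Type*} [NormedAddCommGroup E] [NormedSpace ℝ E]

lemma affine_apply_add (g : E ≃ᵃ[ℝ] E) (x v : E) : g (x + v) = g x + g.linear v := by
  have := g.map_vadd x v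
  simp only [vadd_eq_add] at this
  rw [add_comm x, this, add_comm]

lemma affine_apply_sub (g : E ≃ᵃ[ℝ] E) (x v : E) : g (x - v) = g x - g.linear v := by
  rw [sub_eq_add_neg, affine_apply_add, map_neg, sub_eq_add_neg]

lemma CocompactBy.false_of_bounded_mod_lines {P : (E ≃ᵃ[ℝ] E) → Prop} {D S : Set E}
    (ho : IsOpen D) (hc : Convex ℝ D) (hne : D.Nonempty) (hnu : D ≠ univ)
    (hP : CocompactBy P D) (hS : Bornology.IsBounded S)
    (hlin : ∀ x ∈ D, ∃ σ ∈ S, ∀ y ∈ D, ∀ t : ℝ, y + t • (x - σ) ∈ D) : False := by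
  obtain ⟨x₀, hx₀⟩ := (ne_univ_iff_exists_notMem _).1 hnu
  obtain ⟨f, hf⟩ := geometric_hahn_banach_open_point hc ho hx₀
  obtain ⟨xs, hxs⟩ := hne
  have hbdd : BddAbove (f '' D) := ⟨f x₀, by rintro _ ⟨a, ha, rfl⟩; exact (hf a ha).le⟩
  set c := sSup (f '' D) with hcdef
  have hle : ∀ a ∈ D, f a ≤ c := fun a ha => le_csSup hbdd ⟨a, ha, rfl⟩
  obtain ⟨K, hK, hKD, hcov⟩ := hP
  obtain ⟨r, hr, hball⟩ := exists_ball_subset_of_compact ho hK hKD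
  obtain ⟨RK, hRK⟩ := hK.isBounded.exists_norm_le
  obtain ⟨RS, hRS⟩ := hS.exists_norm_le
  have hpos : f xs < c := by
    obtain ⟨δ, hδ, hb⟩ := exists_ball_subset_of_compact ho (isCompact_singleton (x := xs))
      (by simpa using hxs)
    have hlim : Tendsto (fun t : ℝ => t • (x₀ - xs)) (𝓝[>] 0) (𝓝 ((0 : ℝ) • (x₀ - xs))) :=
      (tendsto_nhdsWithin_of_tendsto_nhds tendsto_id).smul_const _
    rw [zero_smul] at hlim
    obtain ⟨t, ht, ht0⟩ := ((hlim.norm.eventually_lt_const (by simpa using hδ)).and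
      self_mem_nhdsWithin).exists
    have h1 := hle _ (hb xs rfl _ ht)
    rw [map_add, map_smul, map_sub, smul_eq_mul] at h1
    have h2 := hf xs hxs
    have : 0 < t * (f x₀ - f xs) := mul_pos ht0 (by linarith)
    linarith
  set R := |RK| + |RS| + 1 with hR
  have hRpos : 0 < R := by positivity
  set M := 1 + 2 * R / r with hM
  have hMpos : 0 < M := by positivity
  obtain ⟨_, ⟨x, hx, rfl⟩, hxc⟩ := exists_lt_of_lt_csSup (s := f '' D) ⟨_, xs, hxs, rfl⟩
    (show c - (c - f xs) / M < c by
      have : 0 < (c - f xs) / M := div_pos (by linarith) hMpos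
      linarith)
  obtain ⟨h, -, hh, y, hy, rfl⟩ := hcov x hx
  set ε := c - f (h y) with hε
  have hε1 : ε * M < c - f xs := by
    rw [← lt_div_iff₀ hMpos]; linarith
  have hε0 : 0 ≤ ε := by have := hle _ hx; linarith
  have hm : ∀ v, ‖v‖ < r → f (h.linear v) ≤ ε := by
    intro v hv
    have := hle _ ((hh _).2 (hball y hy v hv))
    rw [affine_apply_add, map_add] at this
    linarith
  obtain ⟨z, hz⟩ := h.surjective xs
  have hzD : z ∈ D := by rw [← hh, hz]; exact hxs
  obtain ⟨σ, hσ, hl⟩ := hlin z hzD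
  have hzero : f (h.linear (z - σ)) = 0 := by
    by_contra hne
    have := hle _ ((hh _).2 (hl y (hKD hy) ((ε + 1) / f (h.linear (z - σ)))))
    rw [affine_apply_add, map_add, map_smul, map_smul, smul_eq_mul, div_mul_cancel₀ _ hne] at this
    linarith
  have hw : ‖(r / (2 * R)) • (y - σ)‖ < r := by
    rw [norm_smul, Real.norm_of_nonneg (by positivity)]
    have h1 : ‖y - σ‖ ≤ R := by
      have := norm_sub_le y σ
      have h2 := hRK y hy
      have h3 := hRS σ hσ
      have := le_abs_self RK
      have := le_abs_self RS
      linarith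
    calc r / (2 * R) * ‖y - σ‖ ≤ r / (2 * R) * R := by gcongr
      _ = r / 2 := by field_simp
      _ < r := by linarith
  have h5 := hm _ hw
  rw [map_smul, map_smul, smul_eq_mul] at h5
  have h6 : f (h.linear (y - σ)) ≤ 2 * R / r * ε := by
    have : f (h.linear (y - σ)) = 2 * R / r * (r / (2 * R) * f (h.linear (y - σ))) := by
      field_simp
    rw [this]
    gcongr
  have h7 : f xs = f (h y) - f (h.linear (y - σ)) + f (h.linear (z - σ)) := by
    rw [← map_sub, ← map_add, ← affine_apply_sub, ← affine_apply_add]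
    rw [← hz]
    congr 2
    abel
  rw [hzero] at h7
  have : c - f xs ≤ ε * M := by
    rw [hM]; nlinarith
  linarith

lemma cone_of_asymptotics {Ω : Set E} (ho : IsOpen Ω) (hc : Convex ℝ Ω) {y u : E}
    {B L : E →L[ℝ] E} (hBL : B * L = 1)
    (h1 : ∀ z ∈ Ω, u + L (z - y) ∈ recCone Ω)
    (h2 : ∀ w ∈ recCone Ω, y + B (w - u) ∈ closure Ω) :
    ∃ v : E, ∀ x ∈ Ω, ∀ t : ℝ, 0 < t → v + t • (x - v) ∈ Ω := by
  refine ⟨y - B u, fun x hx t ht => ?_⟩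
  set v := y - B u with hv
  have hcl : ∀ z ∈ Ω, v + t • (z - v) ∈ closure Ω := by
    intro z hz
    have h3 := h2 _ (smul_mem_recCone (h1 z hz) ht.le)
    have hBz : B (L (z - y)) = z - y := by
      have := congrArg (fun T : E →L[ℝ] E => T (z - y)) hBL
      simpa using this
    convert h3 using 1
    rw [map_sub, map_smul, map_add, hBz, hv]
    module
  have hopen : IsOpen {q | v + t⁻¹ • (q - v) ∈ Ω} :=
    ho.preimage (by fun_prop : Continuous fun q => v + t⁻¹ • (q - v))
  have hsub : {q | v + t⁻¹ • (q - v) ∈ Ω} ⊆ closure Ω := by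
    intro q hq
    convert hcl _ hq using 1
    rw [add_sub_cancel_left, smul_smul, mul_inv_cancel₀ ht.ne', one_smul]
    abel
  have h4 := interior_maximal hsub hopen
  have hi : interior Ω = Ω := ho.interior_eq
  rw [hc.interior_closure_eq_interior_of_nonempty_interior (by rw [hi]; exact ⟨x, hx⟩), hi] at h4
  apply h4
  simp only [mem_ofPred_eq, add_sub_cancel_left]
  rw [smul_smul, inv_mul_cancel₀ ht.ne', one_smul]
  simpa using hx

lemma tendsto_clm_apply {T : ℕ → E →L[ℝ] E} {w : ℕ → E} {T₀ : E →L[ℝ] E} {w₀ : E}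
    (hT : Tendsto T atTop (𝓝 T₀)) (hw : Tendsto w atTop (𝓝 w₀)) :
    Tendsto (fun n => T n (w n)) atTop (𝓝 (T₀ w₀)) :=
  (isBoundedBilinearMap_apply.continuous.tendsto (T₀, w₀)).comp (hT.prodMk_nhds hw)

lemma opNorm_le_of_forall_lt {T : E →L[ℝ] E} {r C : ℝ} (hr : 0 < r)
    (h : ∀ w : E, ‖w‖ < r → ‖T w‖ ≤ C) : ‖T‖ ≤ C / (r / 2) := by
  have hC : 0 ≤ C := (norm_nonneg _).trans (h 0 (by simpa using hr))
  refine T.opNorm_le_bound (by positivity) fun w => ?_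
  rcases eq_or_ne w 0 with rfl | hw
  · simp
  · have hw' : 0 < ‖w‖ := norm_pos_iff.2 hw
    have h1 := h ((r / 2 / ‖w‖) • w) (by
      rw [norm_smul, Real.norm_of_nonneg (by positivity), div_mul_cancel₀ _ hw'.ne']
      linarith)
    rw [map_smul, norm_smul, Real.norm_of_nonneg (by positivity), div_mul_eq_mul_div,
      div_le_iff₀ hw'] at h1
    rw [div_mul_eq_mul_div, le_div_iff₀ (by positivity)]
    linarith

variable [FiniteDimensional ℝ E]

lemma exists_recCone_of_cocompactBy {P : (E ≃ᵃ[ℝ] E) → Prop} {D : Set E}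
    (ho : IsOpen D) (hc : Convex ℝ D) (hne : D.Nonempty) (hnu : D ≠ univ)
    (hP : CocompactBy P D) : ∃ u : E, u ≠ 0 ∧ u ∈ recCone D := by
  by_cases hb : Bornology.IsBounded D
  · exact (hP.false_of_bounded_mod_lines ho hc hne hnu hb fun x hx =>
      ⟨x, hx, fun y hy t => by simpa using hy⟩).elim
  · exact exists_recCone_of_unbounded ho hc hb

set_option maxHeartbeats 1000000 in
lemma ProperDomain.cone_of_interior_recCone {P : (E ≃ᵃ[ℝ] E) → Prop} {Ω : Set E}
    (hΩ : ProperDomain Ω) (hP : CocompactBy P Ω) {u : E} (hu : u ∈ interior (recCone Ω)) :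
    ∃ v : E, ∀ x ∈ Ω, ∀ t : ℝ, 0 < t → v + t • (x - v) ∈ Ω := by
  obtain ⟨x₀, hx₀⟩ := hΩ.nonempty
  have ho := hΩ.isOpen
  have hc := hΩ.convex
  obtain ⟨K, hK, hKΩ, hcov⟩ := hP
  have hurec : u ∈ recCone Ω := interior_subset hu
  have hx : ∀ n : ℕ, x₀ + ((n : ℝ) + 1) • u ∈ Ω := fun n => hurec _ hx₀ _ (by positivity)
  choose g _ hg y hyK hgy using fun n => hcov _ (hx n)
  obtain ⟨r, hr, hball⟩ := exists_ball_subset_of_compact isOpen_interior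
    (isCompact_singleton (x := u)) (singleton_subset_iff.2 hu)
  obtain ⟨r', hr', hball'⟩ := exists_ball_subset_of_compact ho hK hKΩ
  obtain ⟨ρ, hρ⟩ := hΩ.exists_bound hK
  set N : ℕ → ℝ := fun n => (n : ℝ) + 1 with hN
  have hNpos : ∀ n, 0 < N n := fun n => by positivity
  have hNlim : Tendsto N atTop atTop :=
    tendsto_atTop_add_const_right _ _ tendsto_natCast_atTop_atTop
  set A : ℕ → E →L[ℝ] E := fun n => LinearMap.toContinuousLinearMap (g n).linear.toLinearMap
  set A' : ℕ → E →L[ℝ] E :=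
    fun n => LinearMap.toContinuousLinearMap (g n).linear.symm.toLinearMap
  have hA'A : ∀ n w, A' n (A n w) = w := fun n w => (g n).linear.symm_apply_apply w
  have hAA' : ∀ n w, A n (A' n w) = w := fun n w => (g n).linear.apply_symm_apply w
  have hgadd : ∀ n w, g n (y n + w) = x₀ + N n • u + A n w := fun n w => by
    rw [affine_apply_add, hgy]; rfl
  have hback : ∀ n w, x₀ + N n • w ∈ Ω → y n + (N n • A' n) (w - u) ∈ Ω := by
    intro n w hw
    rw [← hg n, hgadd]
    convert hw using 1
    simp only [FunLike.coe_smul, Pi.smul_apply, map_smul, hAA']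
    module
  have hB : ∀ n, ‖N n • A' n‖ ≤ ρ / (r / 2) := by
    intro n
    refine opNorm_le_of_forall_lt hr fun w hw => ?_
    have h1 := hback n (u + w) (interior_subset (hball u rfl w hw) _ hx₀ _ (hNpos n).le)
    have h2 := hback n (u + -w)
      (interior_subset (hball u rfl (-w) (by rwa [norm_neg])) _ hx₀ _ (hNpos n).le)
    refine hρ (y n) (hyK n) _ (by simpa using h1) ?_
    simpa [← sub_eq_add_neg] using h2
  have hfwd : ∀ n w, y n + w ∈ Ω → x₀ + N n • (u + ((N n)⁻¹ • A n) w) ∈ Ω := by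
    intro n w hw
    rw [← hg n, hgadd] at hw
    convert hw using 1
    simp only [FunLike.coe_smul, Pi.smul_apply, smul_add, smul_smul,
      mul_inv_cancel₀ (hNpos n).ne', one_smul, add_assoc]
  have hrec : ∀ (φ : ℕ → ℕ), Tendsto φ atTop atTop → ∀ (w : ℕ → E) (l : E),
      (∀ n, x₀ + N (φ n) • w n ∈ Ω) → Tendsto w atTop (𝓝 l) → l ∈ recCone Ω := by
    intro φ hφ w l hw hl
    have hs := hNlim.comp hφ
    refine recCone_of_tendsto ho hc hw hs ?_
    have h1 : Tendsto (fun n => (N (φ n))⁻¹ • x₀ + w n) atTop (𝓝 ((0 : ℝ) • x₀ + l)) :=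
      (hs.inv_tendsto_atTop.smul_const x₀).add hl
    rw [zero_smul, zero_add] at h1
    refine h1.congr fun n => ?_
    simp only [Function.comp, smul_add, smul_smul, inv_mul_cancel₀ (hNpos (φ n)).ne', one_smul]
  have hL : ∃ C : ℝ, ∀ᶠ n in atTop, ‖(N n)⁻¹ • A n‖ ≤ C := by
    by_contra! h
    have h1 : ∀ k : ℕ, ∃ n ≥ k, (k : ℝ) / (r' / 2) < ‖(N n)⁻¹ • A n‖ := by
      intro k
      obtain ⟨n, hn, h2⟩ := (frequently_atTop.1 (h ((k : ℝ) / (r' / 2)))) k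
      exact ⟨n, hn, h2⟩
    choose φ hφ hbig using h1
    have h2 : ∀ k : ℕ, ∃ w, ‖w‖ < r' ∧ (k : ℝ) < ‖((N (φ k))⁻¹ • A (φ k)) w‖ := by
      intro k
      by_contra! h3
      exact absurd (opNorm_le_of_forall_lt hr' h3) (not_le.2 (hbig k))
    choose w hw hwbig using h2
    obtain ⟨e, he, ψ, hψ, hlim⟩ := exists_subseq_normalized
      (v := fun k => ((N (φ k))⁻¹ • A (φ k)) (w k))
      (tendsto_atTop_mono (fun k => (hwbig k).le) tendsto_natCast_atTop_atTop)
    have hφt : Tendsto (fun k => φ (ψ k)) atTop atTop :=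
      (tendsto_atTop_mono hφ tendsto_id).comp hψ.tendsto_atTop
    have key : ∀ s : ℝ, u + s • e ∈ recCone Ω := by
      intro s
      obtain ⟨k₀, hk₀⟩ := exists_nat_gt |s|
      have hsh : Tendsto (fun k => k + (k₀ + 1)) atTop atTop := tendsto_add_atTop_nat (k₀ + 1)
      refine hrec (fun k => φ (ψ (k + (k₀ + 1)))) (hφt.comp hsh) _ _ ?_
        (tendsto_const_nhds.add ((hlim.comp hsh).const_smul s))
      intro k
      set j := ψ (k + (k₀ + 1)) with hj
      have hjk : (k₀ : ℝ) ≤ j := by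
        have := hψ.le_apply (x := k + (k₀ + 1))
        exact_mod_cast (by omega : k₀ ≤ j)
      have hbj := hwbig j
      set W := ((N (φ j))⁻¹ • A (φ j)) (w j) with hW
      have hWpos : 0 < ‖W‖ := lt_of_le_of_lt (Nat.cast_nonneg j) hbj
      have hmem := hball' (y (φ j)) (hyK _) ((s * ‖W‖⁻¹) • w j) (by
        rw [norm_smul, norm_mul, norm_inv, norm_norm, Real.norm_eq_abs]
        have : |s| * ‖W‖⁻¹ ≤ 1 := by
          rw [← div_eq_mul_inv, div_le_one hWpos]; linarith
        calc _ ≤ 1 * ‖w j‖ := by gcongr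
          _ < r' := by rw [one_mul]; exact hw j)
      have h4 := hfwd _ _ hmem
      rw [map_smul, ← hW, mul_smul] at h4
      exact h4
    have hside : ∀ σ : ℝ, σ • e ∈ recCone Ω := by
      intro σ
      refine (isClosed_recCone ho hc).mem_of_tendsto
        (f := fun n : ℕ => (N n)⁻¹ • (u + (N n * σ) • e)) (b := atTop) ?_
        (Eventually.of_forall fun n => smul_mem_recCone (key _) (inv_nonneg.2 (hNpos n).le))
      have h1 : Tendsto (fun n => (N n)⁻¹ • u + σ • e) atTop (𝓝 ((0 : ℝ) • u + σ • e)) :=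
        (hNlim.inv_tendsto_atTop.smul_const u).add tendsto_const_nhds
      rw [zero_smul, zero_add] at h1
      refine h1.congr fun n => ?_
      rw [smul_add, smul_smul, ← mul_assoc, inv_mul_cancel₀ (hNpos n).ne', one_mul]
    have h0 := hΩ.salient e (by simpa using hside 1) (by simpa using hside (-1))
    simp [h0] at he
  obtain ⟨C, hC⟩ := hL
  obtain ⟨n₀, hn₀⟩ := eventually_atTop.1 hC
  have := FiniteDimensional.proper ℝ (E →L[ℝ] E)
  obtain ⟨⟨yl, B, L⟩, -, φ, hφ, hlim⟩ :=
    (hK.prod ((isCompact_closedBall (0 : E →L[ℝ] E) (ρ / (r / 2))).prod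
      (isCompact_closedBall (0 : E →L[ℝ] E) C))).tendsto_subseq
      (x := fun n => (y (n + n₀), N (n + n₀) • A' (n + n₀), (N (n + n₀))⁻¹ • A (n + n₀)))
      (fun n => ⟨hyK _, by simpa using hB _, by simpa using hn₀ (n + n₀) (by omega)⟩)
  have hly := (continuous_fst.tendsto _).comp hlim
  have hlB := ((continuous_fst.comp continuous_snd).tendsto _).comp hlim
  have hlL := ((continuous_snd.comp continuous_snd).tendsto _).comp hlim
  simp only [Function.comp_def] at hly hlB hlL
  have hφt : Tendsto (fun n => φ n + n₀) atTop atTop :=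
    (tendsto_add_atTop_nat n₀).comp hφ.tendsto_atTop
  refine cone_of_asymptotics ho hc (y := yl) (u := u) (B := B) (L := L) ?_ ?_ ?_
  · refine tendsto_nhds_unique (hlB.mul hlL) (tendsto_const_nhds.congr fun n => ?_)
    ext w
    simp [hA'A, smul_smul, inv_mul_cancel₀ (hNpos _).ne']
  · intro z hz
    refine hrec _ hφt (fun n => u + ((N (φ n + n₀))⁻¹ • A (φ n + n₀)) (z - y (φ n + n₀))) _
      (fun n => hfwd _ _ (by simpa using hz)) ?_
    exact tendsto_const_nhds.add (tendsto_clm_apply hlL (tendsto_const_nhds.sub hly))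
  · intro w hw
    refine mem_closure_of_tendsto (hly.add (tendsto_clm_apply hlB tendsto_const_nhds))
      (Eventually.of_forall fun n => hback _ _ (hw x₀ hx₀ _ (hNpos _).le))

end Cocompact

section Rays

variable {E : Type*} [NormedAddCommGroup E] [NormedSpace ℝ E]

/-- The linear part of `g` rescales `u` by a positive factor. -/
def ScalesRay (u : E) (g : E ≃ᵃ[ℝ] E) : Prop := ∃ μ : ℝ, 0 < μ ∧ g.linear u = μ • u

lemma CocompactBy.mono {P Q : (E ≃ᵃ[ℝ] E) → Prop} {Ω : Set E} (h : CocompactBy P Ω)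
    (hPQ : ∀ g, Preserves g Ω → P g → Q g) : CocompactBy Q Ω := by
  obtain ⟨K, hK, hKΩ, hcov⟩ := h
  refine ⟨K, hK, hKΩ, fun x hx => ?_⟩
  obtain ⟨g, hg, hgΩ, y⟩ := hcov x hx
  exact ⟨g, hPQ g hgΩ hg, hgΩ, y⟩

lemma scalesRay_of_recCone_eq_ray {Ω : Set E} {u : E} (hu : u ≠ 0)
    (hrec : ∀ v ∈ recCone Ω, ∃ a : ℝ, 0 ≤ a ∧ v = a • u) (hu' : u ∈ recCone Ω)
    {g : E ≃ᵃ[ℝ] E} (hg : Preserves g Ω) : ScalesRay u g := by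
  obtain ⟨a, ha, h⟩ := hrec _ ((hg.recCone_iff u).2 hu')
  refine ⟨a, lt_of_le_of_ne ha fun h0 => hu ?_, h⟩
  rw [← h0, zero_smul] at h
  exact (map_eq_zero_iff g.linear g.linear.injective).1 h

lemma scales_or_swaps {Ω : Set E} {u₁ u₂ : E} (hli : LinearIndependent ℝ ![u₁, u₂])
    (hrec : ∀ v ∈ recCone Ω, ∃ a b : ℝ, 0 ≤ a ∧ 0 ≤ b ∧ v = a • u₁ + b • u₂)
    (h₁ : u₁ ∈ recCone Ω) (h₂ : u₂ ∈ recCone Ω) {g : E ≃ᵃ[ℝ] E} (hg : Preserves g Ω) :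
    (ScalesRay u₁ g ∧ ScalesRay u₂ g) ∨
      ∃ μ ν : ℝ, 0 < μ ∧ 0 < ν ∧ g.linear u₁ = μ • u₂ ∧ g.linear u₂ = ν • u₁ := by
  have hz := LinearIndependent.pair_iff.1 hli
  obtain ⟨a, b, ha, hb, e₁⟩ := hrec _ ((hg.recCone_iff u₁).2 h₁)
  obtain ⟨c, d, hc, hd, e₂⟩ := hrec _ ((hg.recCone_iff u₂).2 h₂)
  have hpre : ∀ v ∈ recCone Ω, ∃ a' b' : ℝ, 0 ≤ a' ∧ 0 ≤ b' ∧
      v = (a' * a + b' * c) • u₁ + (a' * b + b' * d) • u₂ := by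
    intro v hv
    obtain ⟨w, rfl⟩ := g.linear.surjective v
    obtain ⟨a', b', ha', hb', e⟩ := hrec _ ((hg.recCone_iff w).1 hv)
    refine ⟨a', b', ha', hb', ?_⟩
    rw [e, map_add, map_smul, map_smul, e₁, e₂]
    module
  obtain ⟨a', b', ha', hb', e₃⟩ := hpre _ h₁
  obtain ⟨c', d', hc', hd', e₄⟩ := hpre _ h₂
  have r₁ := hz (a' * a + b' * c - 1) (a' * b + b' * d) (by
    have := sub_eq_zero.2 e₃.symm
    rw [← this]; module)
  have r₂ := hz (c' * a + d' * c) (c' * b + d' * d - 1) (by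
    have := sub_eq_zero.2 e₄.symm
    rw [← this]; module)
  have p1 : a' * b = 0 := by nlinarith [mul_nonneg ha' hb, mul_nonneg hb' hd]
  have p2 : b' * d = 0 := by nlinarith [mul_nonneg ha' hb, mul_nonneg hb' hd]
  have p3 : c' * a = 0 := by nlinarith [mul_nonneg hc' ha, mul_nonneg hd' hc]
  have p4 : d' * c = 0 := by nlinarith [mul_nonneg hc' ha, mul_nonneg hd' hc]
  have q1 : a' * a + b' * c = 1 := by linarith [r₁.1]
  have q2 : c' * b + d' * d = 1 := by linarith [r₂.2]
  rcases eq_or_ne b 0 with rfl | hb0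
  · have hd0 : d' ≠ 0 ∧ d ≠ 0 := by constructor <;> (rintro rfl; simp at q2)
    have hb'0 : b' = 0 := (mul_eq_zero.1 p2).resolve_right hd0.2
    have hc0 : c = 0 := (mul_eq_zero.1 p4).resolve_left hd0.1
    subst hc0
    have ha0 : a ≠ 0 := by rintro rfl; simp at q1
    exact Or.inl ⟨⟨a, lt_of_le_of_ne ha ha0.symm, by simpa using e₁⟩,
      ⟨d, lt_of_le_of_ne hd hd0.2.symm, by simpa using e₂⟩⟩
  · have ha'0 : a' = 0 := (mul_eq_zero.1 p1).resolve_right hb0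
    subst ha'0
    have hc0 : b' ≠ 0 ∧ c ≠ 0 := by constructor <;> (rintro rfl; simp at q1)
    have hd0 : d = 0 := (mul_eq_zero.1 p2).resolve_left hc0.1
    have hd'0 : d' = 0 := (mul_eq_zero.1 p4).resolve_right hc0.2
    subst hd0
    have hc'0 : c' ≠ 0 := by rintro rfl; simp [hd'0] at q2
    have ha0 : a = 0 := (mul_eq_zero.1 p3).resolve_left hc'0
    subst ha0
    exact Or.inr ⟨b, c, lt_of_le_of_ne hb hb0.symm, lt_of_le_of_ne hc hc0.2.symm,
      by simpa using e₁, by simpa using e₂⟩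

lemma CocompactBy.scalesRays {P : (E ≃ᵃ[ℝ] E) → Prop} {Ω : Set E} {u₁ u₂ : E}
    (hP : CocompactBy P Ω)
    (hcont : ∀ g : E ≃ᵃ[ℝ] E, Continuous g)
    (h : ∀ g : E ≃ᵃ[ℝ] E, Preserves g Ω → (ScalesRay u₁ g ∧ ScalesRay u₂ g) ∨
      ∃ μ ν : ℝ, 0 < μ ∧ 0 < ν ∧ g.linear u₁ = μ • u₂ ∧ g.linear u₂ = ν • u₁) :
    CocompactBy (fun g => ScalesRay u₁ g ∧ ScalesRay u₂ g) Ω := by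
  by_cases hsw : ∃ g : E ≃ᵃ[ℝ] E, Preserves g Ω ∧
      ∃ μ ν : ℝ, 0 < μ ∧ 0 < ν ∧ g.linear u₁ = μ • u₂ ∧ g.linear u₂ = ν • u₁
  · obtain ⟨g₀, hg₀, μ₀, ν₀, hμ₀, hν₀, e₁, e₂⟩ := hsw
    obtain ⟨K, hK, hKΩ, hcov⟩ := hP
    refine ⟨K ∪ g₀.symm '' K, hK.union (hK.image (hcont _)), ?_, fun x hx => ?_⟩
    · rintro _ (hy | ⟨y, hy, rfl⟩)
      · exact hKΩ hy
      · rw [← hg₀, g₀.apply_symm_apply]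
        exact hKΩ hy
    · obtain ⟨g, -, hg, y, hy, rfl⟩ := hcov x hx
      rcases h g hg with h' | ⟨μ, ν, hμ, hν, e₃, e₄⟩
      · exact ⟨g, h', hg, y, Or.inl hy, rfl⟩
      · refine ⟨g * g₀, ⟨⟨μ₀ * ν, by positivity, ?_⟩, ⟨ν₀ * μ, by positivity, ?_⟩⟩, hg.mul hg₀,
          g₀.symm y, Or.inr ⟨y, hy, rfl⟩, ?_⟩
        · change g.linear (g₀.linear u₁) = _
          rw [e₁, map_smul, e₄, smul_smul]
        · change g.linear (g₀.linear u₂) = _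
          rw [e₂, map_smul, e₃, smul_smul]
        · change g (g₀ (g₀.symm y)) = g y
          rw [g₀.apply_symm_apply]
  · exact hP.mono fun g hg _ => (h g hg).resolve_right fun h' => hsw ⟨g, hg, h'⟩

lemma ProperDomain.exists_extremal {Ω : Set E} (hΩ : ProperDomain Ω) {v w : E}
    (hv : v ∈ recCone Ω) (hw : w ∈ recCone Ω) (hw0 : w ≠ 0) :
    ∃ s : ℝ, 0 ≤ s ∧ v - s • w ∈ recCone Ω ∧ ∀ t > s, v - t • w ∉ recCone Ω := by
  set S := {s : ℝ | 0 ≤ s ∧ v - s • w ∈ recCone Ω} with hS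
  have hcl := isClosed_recCone hΩ.isOpen hΩ.convex
  have hSc : IsClosed S :=
    isClosed_Ici.inter (hcl.preimage (by fun_prop : Continuous fun s : ℝ => v - s • w))
  have hSne : S.Nonempty := ⟨0, le_rfl, by simpa using hv⟩
  have hSb : BddAbove S := by
    by_contra hb
    refine hw0 (hΩ.salient w hw ?_)
    have : ∀ n : ℕ, ∃ s ∈ S, (n : ℝ) + 1 < s := by
      intro n
      by_contra! h'
      exact hb ⟨n + 1, h'⟩
    choose s hs hn using this
    have hst : Tendsto s atTop atTop :=
      tendsto_atTop_mono (fun n => by linarith [hn n]) tendsto_natCast_atTop_atTop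
    have hlim : Tendsto (fun n => (s n)⁻¹ • v - w) atTop (𝓝 ((0 : ℝ) • v - w)) :=
      (hst.inv_tendsto_atTop.smul_const v).sub_const w
    rw [zero_smul, zero_sub] at hlim
    refine hcl.mem_of_tendsto hlim (Eventually.of_forall fun n => ?_)
    have hpos : 0 < s n := by linarith [hn n, Nat.cast_nonneg (α := ℝ) n]
    have := smul_mem_recCone (hs n).2 (inv_nonneg.2 hpos.le)
    rwa [smul_sub, smul_smul, inv_mul_cancel₀ hpos.ne', one_smul] at this
  refine ⟨sSup S, (hSc.csSup_mem hSne hSb).1, (hSc.csSup_mem hSne hSb).2, fun t ht h => ?_⟩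
  exact absurd (le_csSup hSb ⟨(hSc.csSup_mem hSne hSb).1.trans ht.le, h⟩) (not_le.2 ht)

lemma ProperDomain.two_rays {Ω : Set E} (hΩ : ProperDomain Ω) {v₀ v₁ : E}
    (hli : ∀ a b : ℝ, a • v₀ + b • v₁ = 0 → a = 0 ∧ b = 0)
    (h₀ : v₀ ∈ recCone Ω) (h₁ : v₁ ∈ recCone Ω)
    (hspan : ∀ v ∈ recCone Ω, ∃ a b : ℝ, v = a • v₀ + b • v₁) :
    ∃ u₁ u₂ : E, LinearIndependent ℝ ![u₁, u₂] ∧ u₁ ∈ recCone Ω ∧ u₂ ∈ recCone Ω ∧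
      ∀ v ∈ recCone Ω, ∃ a b : ℝ, 0 ≤ a ∧ 0 ≤ b ∧ v = a • u₁ + b • u₂ := by
  have hv₀ : v₀ ≠ 0 := by
    rintro rfl
    have := (hli 1 0 (by simp)).1
    simp at this
  obtain ⟨s, -, hs, hs'⟩ := hΩ.exists_extremal h₁ h₀ hv₀
  set u₁ := v₁ - s • v₀ with hu₁
  have hu₁0 : u₁ ≠ 0 := by
    intro h
    have := (hli (-s) 1 (by rw [← h, hu₁]; module)).2
    simp at this
  obtain ⟨r, hr0, hr, hr'⟩ := hΩ.exists_extremal h₀ hs hu₁0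
  set u₂ := v₀ - r • u₁ with hu₂
  have hli' : ∀ a b : ℝ, a • u₁ + b • u₂ = 0 → a = 0 ∧ b = 0 := by
    intro a b h
    have h2 := hli (b - (a - b * r) * s) (a - b * r) (by rw [← h, hu₂, hu₁]; module)
    have hb : b = 0 := by have := h2.1; rw [h2.2] at this; linarith
    subst hb
    exact ⟨by linarith [h2.2], rfl⟩
  have hu₂0 : u₂ ≠ 0 := fun h => by
    have := (hli' 0 1 (by simp [h])).2
    simp at this
  refine ⟨u₁, u₂, LinearIndependent.pair_iff.2 hli', hs, hr, fun v hv => ?_⟩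
  obtain ⟨α, β, e⟩ := hspan v hv
  obtain ⟨a, b, e'⟩ : ∃ a b : ℝ, v = a • u₁ + b • u₂ := by
    refine ⟨β + (α + β * s) * r, α + β * s, ?_⟩
    rw [e, hu₂, hu₁]; module
  refine ⟨a, b, ?_, ?_, e'⟩
  · by_contra! ha
    rcases le_or_gt b 0 with hb | hb
    · refine hu₁0 (hΩ.salient _ hs ?_)
      have := smul_mem_recCone (add_mem_recCone hv (smul_mem_recCone hr (neg_nonneg.2 hb)))
        (inv_nonneg.2 (neg_pos.2 ha).le)
      convert this using 1
      rw [e', add_assoc, ← add_smul, add_neg_cancel, zero_smul, add_zero, smul_smul, inv_neg,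
        neg_mul, inv_mul_cancel₀ ha.ne, neg_one_smul]
    · refine hr' (r - b⁻¹ * a) (by have : 0 < b⁻¹ * -a := mul_pos (inv_pos.2 hb) (by linarith)
                                   linarith) ?_
      have := smul_mem_recCone hv (inv_nonneg.2 hb.le)
      convert this using 1
      rw [e', smul_add, smul_smul b⁻¹ b, inv_mul_cancel₀ hb.ne', hu₂]
      module
  · by_contra! hb
    rcases le_or_gt a 0 with ha | ha
    · refine hu₂0 (hΩ.salient _ hr ?_)
      have := smul_mem_recCone (add_mem_recCone hv (smul_mem_recCone hs (neg_nonneg.2 ha)))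
        (inv_nonneg.2 (neg_pos.2 hb).le)
      convert this using 1
      rw [e', add_right_comm, ← add_smul, add_neg_cancel, zero_smul, zero_add, smul_smul, inv_neg,
        neg_mul, inv_mul_cancel₀ hb.ne, neg_one_smul]
    · have hκ : 0 < a - b * r := by nlinarith
      refine hs' (s - (a - b * r)⁻¹ * b) (by
        have : 0 < (a - b * r)⁻¹ * -b := mul_pos (inv_pos.2 hκ) (by linarith)
        linarith) ?_
      have := smul_mem_recCone hv (inv_nonneg.2 hκ.le)
      have e₂ : v = (a - b * r) • u₁ + b • v₀ := by rw [e', hu₂]; module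
      convert this using 1
      rw [e₂, smul_add, smul_smul, inv_mul_cancel₀ hκ.ne', hu₁]
      module

end Rays

section Epigraph

variable {F : Type*} [NormedAddCommGroup F] [NormedSpace ℝ F]

/-- The open region above the graph of `f` over `D`. -/
def strictEpi {F : Type*} (D : Set F) (f : F → ℝ) : Set (F × ℝ) := {p | p.1 ∈ D ∧ f p.1 < p.2}

/-- `g` preserves `D`, and `f ∘ g` is `c • f` up to an affine function. -/
structure ScalingSymm (D : Set F) (f : F → ℝ) (g : F ≃ᵃ[ℝ] F) (c : ℝ) : Prop where
  preserves : Preserves g D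
  pos : 0 < c
  exists_affine : ∃ ℓ : F →ᵃ[ℝ] ℝ, ∀ x ∈ D, f (g x) = c * f x + ℓ x

/-- Symmetries of `f` with arbitrarily small factor, satisfying `P`, move a compact set to any
point of `D`. -/
def ContractsBy (P : (F ≃ᵃ[ℝ] F) → Prop) (D : Set F) (f : F → ℝ) : Prop :=
  ∃ C, IsCompact C ∧ C ⊆ D ∧ ∀ q ∈ D, ∀ ε > 0, ∃ g c, P g ∧ c < ε ∧ ScalingSymm D f g c ∧
    ∃ q' ∈ C, g q' = q

variable {D : Set F} {f : F → ℝ}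

lemma mem_strictEpi {F : Type*} {D : Set F} {f : F → ℝ} {x : F} {z : ℝ} :
    (x, z) ∈ strictEpi D f ↔ x ∈ D ∧ f x < z := Iff.rfl

lemma ProperDomain.exists_strictEpi {Ω : Set (F × ℝ)} (hΩ : ProperDomain Ω)
    (hv : ((0, 1) : F × ℝ) ∈ recCone Ω) : ∃ D f, Ω = strictEpi D f := by
  have hup : ∀ (q : F) (z z' : ℝ), (q, z) ∈ Ω → z ≤ z' → (q, z') ∈ Ω := by
    intro q z z' h hz
    have := hv _ h (z' - z) (by linarith)
    simpa using this
  have hbdd : ∀ q, BddBelow {z : ℝ | (q, z) ∈ Ω} := by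
    intro q
    by_contra hb
    have hall : ∀ z : ℝ, (q, z) ∈ Ω := by
      intro z
      have : ∃ z' : ℝ, (q, z') ∈ Ω ∧ z' < z := by
        by_contra! h
        exact hb ⟨z, fun z' hz' => h z' hz'⟩
      obtain ⟨z', h1, h2⟩ := this
      exact hup q z' z h1 h2.le
    have h1 : -((0, 1) : F × ℝ) ∈ recCone Ω := by
      refine recCone_of_line hΩ.isOpen hΩ.convex (x := (q, 0)) fun t _ => ?_
      simpa using hall (-t)
    have := hΩ.salient _ hv h1
    simp at this
  refine ⟨Prod.fst '' Ω, fun q => sInf {z | (q, z) ∈ Ω}, ?_⟩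
  ext ⟨q, z⟩
  rw [mem_strictEpi]
  constructor
  · intro h
    refine ⟨⟨_, h, rfl⟩, ?_⟩
    have hc : Continuous fun t : ℝ => (q, t) := by fun_prop
    obtain ⟨δ, hδ, hb⟩ := Metric.isOpen_iff.1 (hΩ.isOpen.preimage hc) z h
    have h2 : (q, z - δ / 2) ∈ Ω := hb (by
      rw [Metric.mem_ball, Real.dist_eq, sub_sub_cancel_left, abs_neg, abs_of_pos (by linarith)]
      linarith)
    have := csInf_le (hbdd q) h2
    linarith
  · rintro ⟨⟨⟨q', z'⟩, h, rfl⟩, hz⟩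
    obtain ⟨y, hy, hyz⟩ := exists_lt_of_csInf_lt (s := {z | (q', z) ∈ Ω}) ⟨z', h⟩ hz
    exact hup _ _ _ hy hyz.le

lemma isOpen_of_strictEpi (h : ProperDomain (strictEpi D f)) : IsOpen D := by
  have : D = Prod.fst '' strictEpi D f := by
    ext x
    constructor
    · intro hx
      exact ⟨(x, f x + 1), ⟨hx, by simp⟩, rfl⟩
    · rintro ⟨p, hp, rfl⟩
      exact hp.1
  rw [this]
  exact isOpenMap_fst _ h.isOpen

lemma convexOn_of_strictEpi (h : ProperDomain (strictEpi D f)) : ConvexOn ℝ D f := by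
  have key : ∀ x ∈ D, ∀ y ∈ D, ∀ a b : ℝ, 0 ≤ a → 0 ≤ b → a + b = 1 → ∀ ε > 0,
      a • x + b • y ∈ D ∧ f (a • x + b • y) < a * f x + b * f y + ε := by
    intro x hx y hy a b ha hb hab ε hε
    have := h.convex (x := (x, f x + ε)) ⟨hx, by simpa using hε⟩
      (y := (y, f y + ε)) ⟨hy, by simpa using hε⟩ ha hb hab
    simp only [Prod.smul_mk, Prod.mk_add_mk, mem_strictEpi, smul_eq_mul] at this
    refine ⟨this.1, this.2.trans_eq ?_⟩
    linear_combination ε * hab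
  refine ⟨fun x hx y hy a b ha hb hab => (key x hx y hy a b ha hb hab 1 one_pos).1,
    fun x hx y hy a b ha hb hab => ?_⟩
  refine le_of_forall_pos_le_add fun ε hε => ?_
  exact (key x hx y hy a b ha hb hab ε hε).2.le

lemma nonempty_of_strictEpi (h : ProperDomain (strictEpi D f)) : D.Nonempty := by
  obtain ⟨p, hp⟩ := h.nonempty
  exact ⟨p.1, hp.1⟩

lemma continuousOn_of_strictEpi [FiniteDimensional ℝ F] (h : ProperDomain (strictEpi D f)) :
    ContinuousOn f D :=
  (convexOn_of_strictEpi h).continuousOn (isOpen_of_strictEpi h)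

lemma ScalingSymm.mul {g h : F ≃ᵃ[ℝ] F} {c d : ℝ} (hg : ScalingSymm D f g c)
    (hh : ScalingSymm D f h d) : ScalingSymm D f (g * h) (c * d) := by
  obtain ⟨ℓ, hℓ⟩ := hg.exists_affine
  obtain ⟨m, hm⟩ := hh.exists_affine
  refine ⟨hg.preserves.mul hh.preserves, mul_pos hg.pos hh.pos,
    c • m + ℓ.comp (h : F →ᵃ[ℝ] F), fun x hx => ?_⟩
  change f (g (h x)) = _
  rw [hℓ _ ((hh.preserves x).2 hx), hm x hx]
  simp only [AffineMap.coe_add, AffineMap.coe_smul, Pi.add_apply, Pi.smul_apply, smul_eq_mul,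
    AffineMap.coe_comp, Function.comp, AffineEquiv.coe_toAffineMap]
  ring

lemma ScalingSymm.inv {g : F ≃ᵃ[ℝ] F} {c : ℝ} (hg : ScalingSymm D f g c) :
    ScalingSymm D f g⁻¹ c⁻¹ := by
  obtain ⟨ℓ, hℓ⟩ := hg.exists_affine
  refine ⟨hg.preserves.inv, inv_pos.2 hg.pos,
    (-c⁻¹) • ℓ.comp (g.symm : F →ᵃ[ℝ] F), fun x hx => ?_⟩
  have h1 := hℓ (g.symm x) ((hg.preserves.inv x).2 hx)
  rw [g.apply_symm_apply] at h1
  change f (g.symm x) = _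
  simp only [AffineMap.coe_smul, Pi.smul_apply, smul_eq_mul,
    AffineMap.coe_comp, Function.comp, AffineEquiv.coe_toAffineMap]
  rw [h1]
  have := hg.pos.ne'
  field_simp
  ring

lemma affine_apply_eq (g : F ≃ᵃ[ℝ] F) (x : F) : g x = g 0 + g.linear x := by
  rw [← affine_apply_add, zero_add]

lemma exists_quotient_symm {g : (F × ℝ) ≃ᵃ[ℝ] (F × ℝ)} (hg : Preserves g (strictEpi D f))
    {c : ℝ} (hc : 0 < c) (hlin : g.linear (0, 1) = c • ((0, 1) : F × ℝ)) :
    ∃ g' : F ≃ᵃ[ℝ] F, ScalingSymm D f g' c ∧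
      (∀ v : F × ℝ, (g.linear v).1 = g'.linear v.1) ∧
      ∀ v w : F × ℝ, g v = w → g' v.1 = w.1 ∧ ∀ z : ℝ, g (v.1, v.2 + z) = (w.1, w.2 + c * z) := by
  have hvert : ∀ z : ℝ, g.linear (0, z) = (0, c * z) := by
    intro z
    have : ((0, z) : F × ℝ) = z • (0, 1) := by simp
    rw [this, map_smul, hlin]
    simp [mul_comm]
  have hsplit : ∀ v : F × ℝ, g.linear v = g.linear (v.1, 0) + (0, c * v.2) := by
    intro v
    rw [← hvert, ← map_add]
    simp
  set A : F →ₗ[ℝ] F := (LinearMap.fst ℝ F ℝ) ∘ₗ g.linear.toLinearMap ∘ₗ (LinearMap.inl ℝ F ℝ)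
    with hA
  have hAx : ∀ x, A x = (g.linear (x, 0)).1 := fun x => rfl
  have hAv : ∀ v : F × ℝ, (g.linear v).1 = A v.1 := by
    intro v
    rw [hsplit, hAx]; simp
  have hbij : Function.Bijective A := by
    constructor
    · rw [← LinearMap.ker_eq_bot, LinearMap.ker_eq_bot']
      intro x hx
      have h1 : g.linear (x, -((g.linear (x, 0)).2 / c)) = 0 := by
        rw [hsplit]
        ext
        · simpa [hAx] using hx
        · simp; field_simp; ring
      have := (map_eq_zero_iff g.linear g.linear.injective).1 h1
      simpa using congrArg Prod.fst this
    · intro q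
      obtain ⟨v, hv⟩ := g.linear.surjective (q, 0)
      exact ⟨v.1, by rw [← hAv, hv]⟩
  set e := LinearEquiv.ofBijective A hbij
  set g' : F ≃ᵃ[ℝ] F := e.toAffineEquiv.trans (AffineEquiv.constVAdd ℝ F (g 0).1) with hg'
  have hg'x : ∀ x, g' x = (g 0).1 + A x := fun x => rfl
  have hgv : ∀ v : F × ℝ, g v = (g' v.1, (g (v.1, 0)).2 + c * v.2) := by
    intro v
    rw [affine_apply_eq g v, affine_apply_eq g (v.1, 0), hsplit]
    ext
    · simp [hg'x, hAx]
    · simp; ring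
  have hmem : ∀ x z, (g' x ∈ D ∧ f (g' x) < (g (x, 0)).2 + c * z) ↔ (x ∈ D ∧ f x < z) := by
    intro x z
    have := hg (x, z)
    rw [hgv (x, z)] at this
    exact this
  have hpres : Preserves g' D := by
    intro x
    constructor
    · intro h
      have := (hmem x ((f (g' x) - (g (x, 0)).2) / c + 1)).1 ⟨h, by field_simp; linarith⟩
      exact this.1
    · intro h
      exact ((hmem x (f x + 1)).2 ⟨h, by linarith⟩).1
  refine ⟨g', ⟨hpres, hc, ((LinearMap.snd ℝ F ℝ).toAffineMap.comp
    (g : (F × ℝ) →ᵃ[ℝ] (F × ℝ))).comp (LinearMap.inl ℝ F ℝ).toAffineMap, fun x hx => ?_⟩, hAv,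
    ?_⟩
  · change f (g' x) = c * f x + (g (x, 0)).2
    apply le_antisymm
    · refine le_of_forall_pos_le_add fun ε hε => ?_
      have := ((hmem x (f x + ε / c)).2 ⟨hx, by have : 0 < ε / c := by positivity
                                                linarith⟩).2
      have h2 : c * (ε / c) = ε := by field_simp
      linarith
    · by_contra! hlt
      have := ((hmem x (((f (g' x) + (c * f x + (g (x, 0)).2)) / 2 - (g (x, 0)).2) / c)).1
        ⟨(hpres x).2 hx, by field_simp; linarith⟩).2
      rw [lt_div_iff₀ hc] at this
      linarith
  · rintro v w rfl
    refine ⟨by rw [hgv], fun z => ?_⟩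
    rw [hgv, hgv v]
    ext
    · rfl
    · simp; ring

lemma ContractsBy.of_cocompactBy [FiniteDimensional ℝ F] (h : ProperDomain (strictEpi D f))
    {P : ((F × ℝ) ≃ᵃ[ℝ] (F × ℝ)) → Prop} {Q : (F ≃ᵃ[ℝ] F) → Prop}
    (hP : CocompactBy P (strictEpi D f))
    (hvert : ∀ g, Preserves g (strictEpi D f) → P g → ScalesRay (0, 1) g)
    (hQ : ∀ g (g' : F ≃ᵃ[ℝ] F), P g → (∀ v : F × ℝ, (g.linear v).1 = g'.linear v.1) → Q g') :
    ContractsBy Q D f := by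
  obtain ⟨K, hK, hKΩ, hcov⟩ := hP
  have hcont := continuousOn_of_strictEpi h
  have hKc : ContinuousOn (fun p : F × ℝ => p.2 - f p.1) K :=
    continuousOn_snd.sub (hcont.comp continuousOn_fst fun p hp => (hKΩ hp).1)
  obtain ⟨c₀, hc₀, hmin⟩ : ∃ c₀ > 0, ∀ p ∈ K, c₀ ≤ p.2 - f p.1 := by
    rcases K.eq_empty_or_nonempty with rfl | hne
    · exact ⟨1, one_pos, by simp⟩
    · obtain ⟨p, hp, hmin⟩ := hK.exists_isMinOn hne hKc
      exact ⟨p.2 - f p.1, sub_pos.2 (hKΩ hp).2, fun p' hp' => hmin hp'⟩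
  refine ⟨Prod.fst '' K, hK.image continuous_fst, ?_, fun q hq ε hε => ?_⟩
  · rintro _ ⟨p, hp, rfl⟩
    exact (hKΩ hp).1
  · obtain ⟨g, hPg, hg, p, hp, hgp⟩ := hcov (q, f q + ε * c₀ / 2)
      ⟨hq, by simp only; linarith [mul_pos hε hc₀]⟩
    obtain ⟨c, hc, hlin⟩ := hvert g hg hPg
    obtain ⟨g', hg', hl, hval⟩ := exists_quotient_symm hg hc hlin
    obtain ⟨h1, h2⟩ := hval _ _ hgp
    refine ⟨g', c, hQ g g' hPg hl, ?_, hg', p.1, ⟨p, hp, rfl⟩, h1⟩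
    have h3 := h2 (-(ε * c₀ / 2 / c))
    have h4 : (q, f q + ε * c₀ / 2 + c * -(ε * c₀ / 2 / c)) ∉ strictEpi D f := by
      rw [mem_strictEpi]
      have : c * -(ε * c₀ / 2 / c) = -(ε * c₀ / 2) := by field_simp
      rw [this]
      simp
    rw [← h3, hg, mem_strictEpi] at h4
    have h5 : ¬ f p.1 < p.2 + -(ε * c₀ / 2 / c) := fun h' => h4 ⟨(hKΩ hp).1, h'⟩
    have h6 := hmin p hp
    have h7 : c₀ ≤ ε * c₀ / 2 / c := by linarith
    rw [le_div_iff₀ hc] at h7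
    by_contra! h8
    nlinarith

end Epigraph

section DegenerateLimit

variable {F : Type*} [NormedAddCommGroup F] [NormedSpace ℝ F] [FiniteDimensional ℝ F]
  {D : Set F} {f : F → ℝ}

/-- The linear part of an affine equivalence as a continuous linear map. -/
def linCLM (g : F ≃ᵃ[ℝ] F) : F →L[ℝ] F := LinearMap.toContinuousLinearMap g.linear.toLinearMap

lemma linCLM_apply (g : F ≃ᵃ[ℝ] F) (v : F) : linCLM g v = g.linear v := rfl

lemma exists_bound_of_second_difference (h : ProperDomain (strictEpi D f)) {C : Set F}
    (hC : IsCompact C) (hCD : C ⊆ D) (M : ℝ) :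
    ∃ ρ : ℝ, ∀ q ∈ C, ∀ v, q + v ∈ D → q - v ∈ D → f (q + v) + f (q - v) - 2 * f q ≤ M →
      ‖v‖ ≤ ρ := by
  have hcont := (continuousOn_of_strictEpi h).mono hCD
  have hK : IsCompact ((fun q => (q, f q + (|M| + 1))) '' C) :=
    hC.image_of_continuousOn (continuousOn_id.prodMk (hcont.add continuousOn_const))
  obtain ⟨ρ, hρ⟩ := h.exists_bound hK
  refine ⟨ρ, fun q hq v h1 h2 h3 => ?_⟩
  have hM := le_abs_self M
  have hM' := abs_nonneg M
  have := hρ _ ⟨q, hq, rfl⟩ (v, (f (q + v) - f (q - v)) / 2)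
    ⟨h1, by simp only [Prod.mk_add_mk]; linarith⟩ ⟨h2, by simp only [Prod.mk_sub_mk]; linarith⟩
  exact (norm_fst_le _).trans this

omit [FiniteDimensional ℝ F] in
lemma ScalingSymm.second_difference {g : F ≃ᵃ[ℝ] F} {c : ℝ} (hg : ScalingSymm D f g c) {q v : F}
    (hq : q ∈ D) (h1 : q + v ∈ D) (h2 : q - v ∈ D) :
    f (g q + g.linear v) + f (g q - g.linear v) - 2 * f (g q) =
      c * (f (q + v) + f (q - v) - 2 * f q) := by
  obtain ⟨ℓ, hℓ⟩ := hg.exists_affine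
  rw [← affine_apply_add, ← affine_apply_sub, hℓ _ hq, hℓ _ h1, hℓ _ h2]
  have e1 : ℓ (q + v) = ℓ q + ℓ.linear v := by
    have := ℓ.map_vadd q v
    simp only [vadd_eq_add] at this
    rw [add_comm q, this, add_comm]
  have e2 : ℓ (q - v) = ℓ q - ℓ.linear v := by
    have := ℓ.map_vadd q (-v)
    simp only [vadd_eq_add, map_neg] at this
    rw [sub_eq_add_neg, add_comm q, this]; ring
  rw [e1, e2]; ring

/-- A limit of symmetries of `f` whose factors tend to zero. -/
structure DegenerateLimit (P : (F ≃ᵃ[ℝ] F) → Prop) (D : Set F) (f : F → ℝ) (q : F) where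
  g : ℕ → F ≃ᵃ[ℝ] F
  c : ℕ → ℝ
  q' : ℕ → F
  p : F
  L : F →L[ℝ] F
  m : F →ₗ[ℝ] ℝ
  prop : ∀ n, P (g n)
  symm : ∀ n, ScalingSymm D f (g n) (c n)
  p_mem : p ∈ D
  q'_lim : Tendsto q' atTop (𝓝 p)
  map : ∀ n, g n (q' n) = q
  L_lim : Tendsto (fun n => linCLM (g n)) atTop (𝓝 L)
  mem_iff : ∀ x, q + L (x - p) ∈ D ↔ x ∈ D
  f_eq : ∀ x ∈ D, f (q + L (x - p)) = f q + m (x - p)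

omit [FiniteDimensional ℝ F] in
lemma exists_tendsto_linear {ℓ : ℕ → F →ᵃ[ℝ] ℝ} {p : F} (hD : IsOpen D) (hp : p ∈ D)
    {φ : F → ℝ} (h : ∀ x ∈ D, Tendsto (fun n => ℓ n x) atTop (𝓝 (φ x))) :
    ∃ m : F →ₗ[ℝ] ℝ, ∀ x ∈ D, φ x = φ p + m (x - p) := by
  have hℓ : ∀ n v, ℓ n (p + v) = ℓ n p + (ℓ n).linear v := by
    intro n v
    have := (ℓ n).map_vadd p v
    simp only [vadd_eq_add] at this
    rw [add_comm p, this, add_comm]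
  have hex : ∀ v, ∃ a, Tendsto (fun n => (ℓ n).linear v) atTop (𝓝 a) := by
    intro v
    obtain ⟨r, hr, hball⟩ := exists_ball_subset_of_compact hD (isCompact_singleton (x := p))
      (singleton_subset_iff.2 hp)
    have hv1 : (0 : ℝ) < ‖v‖ + 1 := by positivity
    set s := r / (‖v‖ + 1) with hs
    have hspos : 0 < s := by positivity
    have hmem : p + s • v ∈ D := hball p rfl _ (by
      rw [norm_smul, Real.norm_of_nonneg hspos.le, hs, div_mul_eq_mul_div, div_lt_iff₀ hv1]
      nlinarith)
    refine ⟨s⁻¹ * (φ (p + s • v) - φ p), (((h _ hmem).sub (h p hp)).const_mul s⁻¹).congr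
      fun n => ?_⟩
    rw [hℓ, map_smul, smul_eq_mul, add_sub_cancel_left, ← mul_assoc, inv_mul_cancel₀ hspos.ne',
      one_mul]
  choose a ha using hex
  refine ⟨linearMapOfTendsto a (fun n => (ℓ n).linear) (tendsto_pi_nhds.2 ha), fun x hx => ?_⟩
  refine tendsto_nhds_unique (h x hx) (((h p hp).add (ha (x - p))).congr fun n => ?_)
  rw [← hℓ, add_sub_cancel]

lemma ContractsBy.linear_bound (h : ProperDomain (strictEpi D f)) {C : Set F}
    (hC : IsCompact C) (hCD : C ⊆ D) {q : F} (hq : q ∈ D) :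
    ∃ R : ℝ, ∀ g c, c ≤ 1 → ScalingSymm D f g c → ∀ q' ∈ C, g q' = q → ‖linCLM g‖ ≤ R := by
  have hD := isOpen_of_strictEpi h
  have hcont := continuousOn_of_strictEpi h
  obtain ⟨δ, hδ, hth⟩ := hC.exists_cthickening_subset_open hD hCD
  obtain ⟨B, hB⟩ := ((hC.cthickening (r := δ)).image_of_continuousOn
    (hcont.mono hth)).isBounded.exists_norm_le
  have hB' : ∀ q' ∈ C, ∀ v, ‖v‖ < δ → q' + v ∈ D ∧ |f (q' + v)| ≤ B := by
    intro q' hq' v hv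
    have : q' + v ∈ Metric.cthickening δ C :=
      Metric.mem_cthickening_of_dist_le _ q' _ _ hq' (by simpa using hv.le)
    exact ⟨hth this, hB _ ⟨_, this, rfl⟩⟩
  obtain ⟨ρ, hρ⟩ := exists_bound_of_second_difference h (isCompact_singleton (x := q))
    (singleton_subset_iff.2 hq) (4 * |B|)
  refine ⟨ρ / (δ / 2), fun g c hc1 hg q' hq' e => opNorm_le_of_forall_lt hδ fun v hv => ?_⟩
  have h1 := hB' q' hq' v hv
  have h2 := hB' q' hq' (-v) (by rwa [norm_neg])
  have h3 := hB' q' hq' 0 (by simpa using hδ)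
  rw [← sub_eq_add_neg] at h2
  rw [add_zero] at h3
  refine hρ q rfl _ ?_ ?_ ?_
  · rw [linCLM_apply, ← e, ← affine_apply_add]; exact (hg.preserves _).2 h1.1
  · rw [linCLM_apply, ← e, ← affine_apply_sub]; exact (hg.preserves _).2 h2.1
  · rw [linCLM_apply, ← e, hg.second_difference h3.1 h1.1 h2.1]
    have hs : f (q' + v) + f (q' - v) - 2 * f q' ≤ 4 * |B| := by
      have := le_abs_self B
      linarith [le_abs_self (f (q' + v)), le_abs_self (f (q' - v)), neg_abs_le (f q')]
    rcases le_or_gt 0 (f (q' + v) + f (q' - v) - 2 * f q') with h0 | h0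
    · nlinarith [hg.pos]
    · have := mul_neg_of_pos_of_neg hg.pos h0
      linarith [abs_nonneg B]

lemma ContractsBy.nonempty_degenerateLimit {P : (F ≃ᵃ[ℝ] F) → Prop}
    (h : ProperDomain (strictEpi D f)) (hP : ContractsBy P D f) {q : F} (hq : q ∈ D) :
    Nonempty (DegenerateLimit P D f q) := by
  have hD := isOpen_of_strictEpi h
  have hDc := (convexOn_of_strictEpi h).1
  have hcont := continuousOn_of_strictEpi h
  obtain ⟨C, hC, hCD, hcov⟩ := hP
  choose g c hPg hc hg q' hq' hgq using fun n : ℕ => hcov q hq (1 / ((n : ℝ) + 1)) (by positivity)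
  obtain ⟨R, hR⟩ := ContractsBy.linear_bound h hC hCD hq
  have hlin : ∀ n, ‖linCLM (g n)‖ ≤ R := fun n => hR _ _ ((hc n).le.trans (by
    rw [div_le_one (by positivity)]; linarith [Nat.cast_nonneg (α := ℝ) n])) (hg n) _ (hq' n)
    (hgq n)
  have hc0 : Tendsto c atTop (𝓝 0) :=
    squeeze_zero (fun n => (hg n).pos.le) (fun n => (hc n).le)
      tendsto_one_div_add_atTop_nhds_zero_nat
  have := FiniteDimensional.proper ℝ (F →L[ℝ] F)
  obtain ⟨⟨p, L⟩, ⟨hp, -⟩, φ, hφ, hlim⟩ :=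
    (hC.prod (isCompact_closedBall (0 : F →L[ℝ] F) R)).tendsto_subseq
      (x := fun n => (q' n, linCLM (g n))) (fun n => ⟨hq' n, by simpa using hlin n⟩)
  have hlp := (continuous_fst.tendsto _).comp hlim
  have hlL := (continuous_snd.tendsto _).comp hlim
  simp only [Function.comp_def] at hlp hlL
  have hgx : ∀ n x, g n x = q + linCLM (g n) (x - q' n) := by
    intro n x
    rw [linCLM_apply, ← hgq n, ← affine_apply_add, add_sub_cancel]
  have hglim : ∀ x, Tendsto (fun n => g (φ n) x) atTop (𝓝 (q + L (x - p))) := by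
    intro x
    simp only [hgx]
    exact tendsto_const_nhds.add (tendsto_clm_apply hlL (tendsto_const_nhds.sub hlp))
  have hcl : ∀ x ∈ D, q + L (x - p) ∈ closure D := fun x hx =>
    mem_closure_of_tendsto (hglim x) (Eventually.of_forall fun n => ((hg _).preserves x).2 hx)
  have hmem : ∀ x, q + L (x - p) ∈ D ↔ x ∈ D := by
    intro x
    constructor
    · intro hx
      obtain ⟨n, hn⟩ := ((hglim x).eventually (hD.mem_nhds hx)).exists
      exact ((hg _).preserves x).1 hn
    · intro hx
      have hlim2 : Tendsto (fun t : ℝ => x + t • (x - p)) (𝓝[>] 0)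
          (𝓝 (x + (0 : ℝ) • (x - p))) :=
        tendsto_const_nhds.add ((tendsto_nhdsWithin_of_tendsto_nhds tendsto_id).smul_const _)
      rw [zero_smul, add_zero] at hlim2
      obtain ⟨t, ht, ht0⟩ := ((hlim2.eventually (hD.mem_nhds hx)).and self_mem_nhdsWithin).exists
      have ht0 : 0 < t := ht0
      have h1 := hcl _ ht
      have h2 := add_smul_mem_of_closure hD hDc (t := 1) (s := 1 + t) (u := L (x - p)) hq
        (by convert h1 using 2
            rw [← map_smul]; congr 1; module) zero_le_one (by linarith)
      simpa using h2
  choose ℓ hℓ using fun n => (hg n).exists_affine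
  have hf : ∀ x ∈ D, Tendsto (fun n => ℓ (φ n) x) atTop (𝓝 (f (q + L (x - p)))) := by
    intro x hx
    have h1 : Tendsto (fun n => f (g (φ n) x)) atTop (𝓝 (f (q + L (x - p)))) :=
      (hcont.continuousAt (hD.mem_nhds ((hmem x).2 hx))).tendsto.comp (hglim x)
    have h2 := h1.sub ((hc0.comp hφ.tendsto_atTop).mul_const (f x))
    rw [zero_mul, sub_zero] at h2
    refine h2.congr fun n => ?_
    rw [hℓ _ x hx]
    simp
  obtain ⟨m, hm⟩ := exists_tendsto_linear hD (hCD hp) hf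
  exact ⟨{
    g := fun n => g (φ n)
    c := fun n => c (φ n)
    q' := fun n => q' (φ n)
    p := p
    L := L
    m := m
    prop := fun n => hPg _
    symm := fun n => hg _
    p_mem := hCD hp
    q'_lim := hlp
    map := fun n => hgq _
    L_lim := hlL
    mem_iff := hmem
    f_eq := fun x hx => by
      rw [hm x hx, sub_self, map_zero, add_zero] }⟩

lemma exists_generalized_inverse (L : F →ₗ[ℝ] F) : ∃ s : F →ₗ[ℝ] F, ∀ x, L (s (L x)) = L x := by
  obtain ⟨s, hs⟩ := L.rangeRestrict.exists_rightInverse_of_surjective L.range_rangeRestrict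
  obtain ⟨t, ht⟩ := (LinearMap.range L).subtype.exists_leftInverse_of_injective
    (Submodule.ker_subtype _)
  refine ⟨s ∘ₗ t, fun x => ?_⟩
  have h1 : t (L x) = ⟨L x, LinearMap.mem_range_self L x⟩ :=
    LinearMap.congr_fun ht ⟨L x, LinearMap.mem_range_self L x⟩
  have h2 := LinearMap.congr_fun hs ⟨L x, LinearMap.mem_range_self L x⟩
  rw [LinearMap.comp_apply, h1]
  exact congrArg Subtype.val h2

namespace DegenerateLimit

variable {P : (F ≃ᵃ[ℝ] F) → Prop} {q : F} (l : DegenerateLimit P D f q)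

/-- The image of `D` under the limiting degenerate affine map. -/
def image : Set F := (fun x => q + l.L (x - l.p)) '' D

lemma exists_recCone_of_unbounded (h : ProperDomain (strictEpi D f))
    (hb : ¬ Bornology.IsBounded l.image) :
    ∃ (w : F) (x : F), w ≠ 0 ∧ w = l.L x ∧ (w, l.m x) ∈ recCone (strictEpi D f) := by
  obtain ⟨s, hs⟩ := exists_generalized_inverse (l.L : F →ₗ[ℝ] F)
  have : ∀ n : ℕ, ∃ x ∈ D, (n : ℝ) ≤ ‖l.L (x - l.p)‖ := by
    intro n
    by_contra! hn
    refine hb (isBounded_iff_forall_norm_le.2 ⟨‖q‖ + n, ?_⟩)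
    rintro _ ⟨x, hx, rfl⟩
    exact (norm_add_le _ _).trans (by linarith [hn x hx])
  choose x hx hn using this
  obtain ⟨w, hw, φ, hφ, hlim⟩ := exists_subseq_normalized (v := fun n => l.L (x n - l.p))
    (tendsto_atTop_mono hn tendsto_natCast_atTop_atTop)
  have hN : Tendsto (fun n => ‖l.L (x (φ n) - l.p)‖) atTop atTop :=
    (tendsto_atTop_mono hn tendsto_natCast_atTop_atTop).comp hφ.tendsto_atTop
  have hwr : w ∈ LinearMap.range (l.L : F →ₗ[ℝ] F) := by
    refine (Submodule.closed_of_finiteDimensional _).mem_of_tendsto hlim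
      (Eventually.of_forall fun n => ?_)
    exact Submodule.smul_mem _ _ (LinearMap.mem_range_self _ _)
  obtain ⟨x₀, hx₀⟩ := hwr
  have hLs : l.L (s w) = w := by rw [← hx₀]; exact hs x₀
  refine ⟨w, s w, fun h0 => by simp [h0] at hw, hLs.symm, ?_⟩
  have hval : ∀ n, f (q + l.L (x n - l.p)) = f q + l.m (s (l.L (x n - l.p))) := by
    intro n
    have e : l.L (l.p + s (l.L (x n - l.p)) - l.p) = l.L (x n - l.p) := by
      rw [add_sub_cancel_left]; exact hs _
    have h1 := l.f_eq (l.p + s (l.L (x n - l.p))) ((l.mem_iff _).1 (by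
      rw [e]; exact (l.mem_iff _).2 (hx n)))
    rw [e, add_sub_cancel_left] at h1
    exact h1
  refine recCone_of_tendsto h.isOpen h.convex
    (p := fun n => (q + l.L (x (φ n) - l.p), f q + l.m (s (l.L (x (φ n) - l.p))) + 1)) ?_ hN ?_
  · intro n
    exact ⟨(l.mem_iff _).2 (hx _), by simp only [hval]; linarith⟩
  · have hcm : Continuous fun v => l.m (s v) :=
      (l.m ∘ₗ s).continuous_of_finiteDimensional
    have h1 : Tendsto (fun n => (‖l.L (x (φ n) - l.p)‖⁻¹ • q + ‖l.L (x (φ n) - l.p)‖⁻¹ •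
        l.L (x (φ n) - l.p), ‖l.L (x (φ n) - l.p)‖⁻¹ * (f q + 1) +
        l.m (s (‖l.L (x (φ n) - l.p)‖⁻¹ • l.L (x (φ n) - l.p))))) atTop
        (𝓝 ((0 : ℝ) • q + w, 0 * (f q + 1) + l.m (s w))) :=
      ((hN.inv_tendsto_atTop.smul_const q).add hlim).prodMk_nhds
        ((hN.inv_tendsto_atTop.mul_const _).add ((hcm.tendsto _).comp hlim))
    rw [zero_smul, zero_add, zero_mul, zero_add] at h1
    refine h1.congr fun n => ?_
    rw [Prod.smul_mk, smul_add, map_smul, map_smul, smul_eq_mul, smul_eq_mul]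
    congr 1
    ring

lemma eq_univ_of_bounded (h : ProperDomain (strictEpi D f)) {Q : (F ≃ᵃ[ℝ] F) → Prop}
    (hQ : ContractsBy Q D f) (hb : Bornology.IsBounded l.image) : D = univ := by
  by_contra hD
  obtain ⟨s, hs⟩ := exists_generalized_inverse (l.L : F →ₗ[ℝ] F)
  obtain ⟨C, hC, hCD, hcov⟩ := hQ
  have hco : CocompactBy (fun _ => True) D := by
    refine ⟨C, hC, hCD, fun x hx => ?_⟩
    obtain ⟨g, c, -, -, hg, y, hy, e⟩ := hcov x hx 1 one_pos
    exact ⟨g, trivial, hg.preserves, y, hy, e⟩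
  have hS : Bornology.IsBounded ((fun y => l.p + s (y - q)) '' l.image) := by
    have hcs : Continuous fun y => l.p + s (y - q) :=
      continuous_const.add (s.continuous_of_finiteDimensional.comp
        (continuous_id.sub continuous_const))
    have := FiniteDimensional.proper ℝ F
    exact ((hb.isCompact_closure.image hcs).isBounded).subset (image_mono subset_closure)
  refine hco.false_of_bounded_mod_lines (isOpen_of_strictEpi h) (convexOn_of_strictEpi h).1
    (nonempty_of_strictEpi h) hD hS fun x hx => ?_
  refine ⟨_, ⟨_, ⟨x, hx, rfl⟩, rfl⟩, fun y hy t => ?_⟩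
  rw [← l.mem_iff]
  have e : l.L (x - (l.p + s (l.L (x - l.p)))) = 0 := by
    have h1 : l.L (s (l.L (x - l.p))) = l.L (x - l.p) := hs _
    rw [← sub_sub, map_sub, h1, sub_self]
  have e2 : l.L (y + t • (x - (l.p + s (l.L (x - l.p)))) - l.p) = l.L (y - l.p) := by
    rw [add_sub_right_comm, map_add, map_smul, e, smul_zero, add_zero]
  simp only [add_sub_cancel_left]
  rw [e2, l.mem_iff]
  exact hy

lemma L_eq_zero_of_bounded (hD : D = univ) (hb : Bornology.IsBounded l.image) : l.L = 0 := by
  obtain ⟨R, hR⟩ := hb.exists_norm_le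
  ext x
  by_contra hx
  have hx' : 0 < ‖l.L x‖ := norm_pos_iff.2 hx
  have := hR _ ⟨l.p + ((R + ‖q‖ + 1) / ‖l.L x‖) • x, eq_univ_iff_forall.1 hD _, rfl⟩
  simp only [add_sub_cancel_left, map_smul] at this
  have hR0 : 0 ≤ R := (norm_nonneg _).trans this
  have h2 := norm_sub_le (q + ((R + ‖q‖ + 1) / ‖l.L x‖) • l.L x) q
  rw [add_sub_cancel_left, norm_smul, Real.norm_of_nonneg (by positivity),
    div_mul_cancel₀ _ hx'.ne'] at h2
  linarith

lemma tendsto_apply (x : F) : Tendsto (fun n => l.g n x) atTop (𝓝 (q + l.L (x - l.p))) := by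
  have : ∀ n, l.g n x = q + linCLM (l.g n) (x - l.q' n) := by
    intro n
    have := affine_apply_add (l.g n) (l.q' n) (x - l.q' n)
    rwa [l.map, add_sub_cancel] at this
  simp only [this]
  exact tendsto_const_nhds.add (tendsto_clm_apply l.L_lim (tendsto_const_nhds.sub l.q'_lim))

end DegenerateLimit

/-- For a vertical recession cone the function is defined everywhere and has symmetries that
contract towards any given point. -/
lemma exists_contractions {P : (F ≃ᵃ[ℝ] F) → Prop} (h : ProperDomain (strictEpi D f))
    (hP : ContractsBy P D f) (hrec : ∀ w c, (w, c) ∈ recCone (strictEpi D f) → w = 0) :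
    D = univ ∧ ∀ q : F, ∀ ε > 0, ∃ g c, ScalingSymm D f g c ∧ ‖linCLM g‖ < ε ∧
      ‖g 0 - q‖ < ε := by
  have hbdd : ∀ q ∈ D, ∀ l : DegenerateLimit P D f q, Bornology.IsBounded l.image := by
    intro q _ l
    by_contra hb
    obtain ⟨w, x, hw, -, hr⟩ := l.exists_recCone_of_unbounded h hb
    exact hw (hrec _ _ hr)
  have hDu : D = univ := by
    obtain ⟨q, hq⟩ := nonempty_of_strictEpi h
    obtain ⟨l⟩ := hP.nonempty_degenerateLimit h hq
    exact l.eq_univ_of_bounded h hP (hbdd q hq l)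
  refine ⟨hDu, fun q ε hε => ?_⟩
  have hq : q ∈ D := by rw [hDu]; trivial
  obtain ⟨l⟩ := hP.nonempty_degenerateLimit h hq
  have hL := l.L_eq_zero_of_bounded hDu (hbdd q hq l)
  have h1 := l.L_lim
  have h2 := l.tendsto_apply 0
  rw [hL] at h1 h2
  simp only [FunLike.coe_zero, Pi.zero_apply, add_zero] at h2
  have h1' := (tendsto_zero_iff_norm_tendsto_zero.1 h1).eventually_lt_const hε
  have h2' := (tendsto_iff_norm_sub_tendsto_zero.1 h2).eventually_lt_const hε
  obtain ⟨n, hn1, hn2⟩ := (h1'.and h2').exists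
  exact ⟨l.g n, l.c n, l.symm n, hn1, hn2⟩

end DegenerateLimit

section Planar

variable {F : Type*} [AddCommGroup F] [Module ℝ F]

lemma exists_planar_coordinates (hF : Module.finrank ℝ F = 2) :
    ∃ e : Module.End ℝ F ≃ₐ[ℝ] Matrix (Fin 2) (Fin 2) ℝ,
      ∀ A, LinearMap.trace ℝ F A = (e A).trace ∧ LinearMap.det A = (e A).det := by
  have : Module.Finite ℝ F := Module.finite_of_finrank_pos (by omega)
  let b := Module.finBasisOfFinrankEq ℝ F hF
  exact ⟨LinearMap.toMatrixAlgEquiv b, fun A =>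
    ⟨LinearMap.trace_eq_matrix_trace ℝ b A, (LinearMap.det_toMatrix b A).symm⟩⟩

lemma planar_mul_self (hF : Module.finrank ℝ F = 2) (A : Module.End ℝ F) :
    A * A = LinearMap.trace ℝ F A • A - LinearMap.det A • (1 : Module.End ℝ F) := by
  obtain ⟨e, he⟩ := exists_planar_coordinates hF
  apply e.injective
  rw [map_mul, map_sub, map_smul, map_smul, map_one, (he A).1, (he A).2]
  ext i j
  fin_cases i <;> fin_cases j <;>
    simp [Matrix.mul_apply, Matrix.trace_fin_two, Matrix.det_fin_two, Fin.sum_univ_two] <;> ring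

lemma planar_trace_mul_self (hF : Module.finrank ℝ F = 2) (A : Module.End ℝ F) :
    LinearMap.trace ℝ F (A * A) = LinearMap.trace ℝ F A ^ 2 - 2 * LinearMap.det A := by
  obtain ⟨e, he⟩ := exists_planar_coordinates hF
  rw [(he _).1, (he A).1, (he A).2, map_mul]
  simp [Matrix.mul_apply, Matrix.trace_fin_two, Matrix.det_fin_two, Fin.sum_univ_two]
  ring

lemma planar_det_sub_one (hF : Module.finrank ℝ F = 2) (A : Module.End ℝ F) :
    LinearMap.det (A - 1) = LinearMap.det A - LinearMap.trace ℝ F A + 1 := by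
  obtain ⟨e, he⟩ := exists_planar_coordinates hF
  rw [(he _).2, (he A).1, (he A).2, map_sub, map_one]
  simp [Matrix.trace_fin_two, Matrix.det_fin_two]
  ring

lemma planar_commute (hF : Module.finrank ℝ F = 2) {A B : Module.End ℝ F}
    (hA : LinearMap.det A = 1) (htr : LinearMap.trace ℝ F A ^ 2 < 4)
    (hd : 0 ≤ LinearMap.det (B * A - A * B)) : B * A = A * B := by
  obtain ⟨e, he⟩ := exists_planar_coordinates hF
  rw [(he _).2, map_sub, map_mul, map_mul] at hd
  rw [(he _).2, Matrix.det_fin_two] at hA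
  rw [(he _).1, Matrix.trace_fin_two] at htr
  apply e.injective
  rw [map_mul, map_mul]
  set M := e A
  set N := e B
  set a := M 0 0
  set b := M 0 1
  set c := M 1 0
  set d := M 1 1
  set x := (N * M - M * N) 0 0 with hx
  set y := (N * M - M * N) 0 1 with hy
  set z := (N * M - M * N) 1 0 with hz
  have hx' : (N * M - M * N) 1 1 = -x := by
    simp [hx, Matrix.mul_apply, Fin.sum_univ_two]; ring
  rw [Matrix.det_fin_two, ← hx, ← hy, ← hz, hx'] at hd
  have htr' : (a - d) * x + b * z + c * y = 0 := by
    simp [hx, hy, hz, a, b, c, d, Matrix.mul_apply, Fin.sum_univ_two]; ring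
  have hdisc : (a - d) ^ 2 + 4 * (b * c) < 0 := by nlinarith
  have hbc : b * c < 0 := by nlinarith [sq_nonneg (a - d)]
  have hyz : y * z ≤ 0 := by nlinarith [sq_nonneg x]
  have h1 : (a - d) ^ 2 * x ^ 2 = (b * z + c * y) ^ 2 := by
    have : (a - d) * x = -(b * z + c * y) := by linarith
    rw [← mul_pow, this]; ring
  have hyz0 : y * z = 0 := by
    by_contra hne
    have hneg : y * z < 0 := lt_of_le_of_ne hyz hne
    have h2 : (a - d) ^ 2 * x ^ 2 ≤ (a - d) ^ 2 * (-(y * z)) := by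
      apply mul_le_mul_of_nonneg_left _ (sq_nonneg _); nlinarith
    have h3 : 0 < ((a - d) ^ 2 + 4 * (b * c)) * (y * z) := mul_pos_of_neg_of_neg hdisc hneg
    nlinarith [sq_nonneg (b * z - c * y)]
  have hx0 : x = 0 := by
    have : x ^ 2 ≤ 0 := by nlinarith
    exact pow_eq_zero_iff (two_ne_zero) |>.1 (le_antisymm this (sq_nonneg x))
  have hb : b ≠ 0 := by rintro h; simp [h] at hbc
  have hc : c ≠ 0 := by rintro h; simp [h] at hbc
  have hbz : b * z + c * y = 0 := by rw [hx0] at htr'; linarith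
  have hyz' : y = 0 ∧ z = 0 := by
    rcases mul_eq_zero.1 hyz0 with h | h
    · refine ⟨h, ?_⟩
      rw [h, mul_zero, add_zero] at hbz
      exact (mul_eq_zero.1 hbz).resolve_left hb
    · refine ⟨?_, h⟩
      rw [h, mul_zero, zero_add] at hbz
      exact (mul_eq_zero.1 hbz).resolve_left hc
  rw [← sub_eq_zero]
  ext i j
  fin_cases i <;> fin_cases j
  · exact hx0
  · exact hyz'.1
  · exact hyz'.2
  · simpa [hx0] using hx'

lemma planar_span (hF : Module.finrank ℝ F = 2) {v w : F}
    (hli : ∀ a b : ℝ, a • v + b • w = 0 → a = 0 ∧ b = 0) (x : F) :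
    ∃ a b : ℝ, x = a • v + b • w := by
  have : Module.Finite ℝ F := Module.finite_of_finrank_pos (by omega)
  have h1 : LinearIndependent ℝ ![v, w] := LinearIndependent.pair_iff.2 hli
  have h2 := h1.span_eq_top_of_card_eq_finrank (by simp [hF])
  have h3 : x ∈ Submodule.span ℝ (Set.range ![v, w]) := by rw [h2]; trivial
  simp only [Matrix.range_cons, Matrix.range_empty, union_empty, singleton_union] at h3
  obtain ⟨a, b, h⟩ := Submodule.mem_span_pair.1 h3
  exact ⟨a, b, h.symm⟩

lemma independent_of_not_smul {v w : F} (hv : v ≠ 0) (hw : ∀ a : ℝ, w ≠ a • v) :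
    ∀ a b : ℝ, a • v + b • w = 0 → a = 0 ∧ b = 0 := by
  intro a b h
  have hb : b = 0 := by
    by_contra hb
    refine hw (-(b⁻¹ * a)) ?_
    have h2 : b • w = -(a • v) := by rw [eq_neg_iff_add_eq_zero, add_comm]; exact h
    have h3 : w = b⁻¹ • b • w := by rw [smul_smul, inv_mul_cancel₀ hb, one_smul]
    rw [h3, h2]; module
  subst hb
  rw [zero_smul, add_zero, smul_eq_zero] at h
  exact ⟨h.resolve_right hv, rfl⟩

end Planar

section Contracting

variable {F : Type*} [NormedAddCommGroup F] [NormedSpace ℝ F] [FiniteDimensional ℝ F]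
  {f : F → ℝ}

/-- Functions on a vector space with a vertical recession cone and with symmetries that
contract towards any given point. -/
structure Contracting (f : F → ℝ) : Prop where
  proper : ProperDomain (strictEpi univ f)
  vertical : ∀ w c, (w, c) ∈ recCone (strictEpi univ f) → w = 0
  contract : ∀ q : F, ∀ ε > 0, ∃ g c, ScalingSymm univ f g c ∧ ‖linCLM g‖ < ε ∧ ‖g 0 - q‖ < ε

/-- The linear part of an affine equivalence as an endomorphism. -/
def linEnd : (F ≃ᵃ[ℝ] F) →* Module.End ℝ F :=
  (LinearEquiv.automorphismGroup.toLinearMapMonoidHom).comp AffineEquiv.linearHom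

omit [FiniteDimensional ℝ F] in
lemma linEnd_apply (g : F ≃ᵃ[ℝ] F) (v : F) : linEnd g v = g.linear v := rfl

/-- The mixed second difference of `f` at `x`. -/
def mixedDiff (f : F → ℝ) (x u v : F) : ℝ := f (x + u + v) - f (x + u) - f (x + v) + f x

omit [FiniteDimensional ℝ F] in
lemma affineMap_apply_eq (ℓ : F →ᵃ[ℝ] ℝ) (x : F) : ℓ x = ℓ 0 + ℓ.linear x := by
  have := ℓ.map_vadd 0 x
  simp only [vadd_eq_add, add_zero] at this
  rw [this, add_comm]

omit [FiniteDimensional ℝ F] in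
lemma ScalingSymm.mixedDiff_eq {g : F ≃ᵃ[ℝ] F} {c : ℝ} (hg : ScalingSymm univ f g c) (x u v : F) :
    mixedDiff f (g x) (g.linear u) (g.linear v) = c * mixedDiff f x u v := by
  obtain ⟨ℓ, hℓ⟩ := hg.exists_affine
  rw [mixedDiff, ← affine_apply_add, ← affine_apply_add, ← affine_apply_add,
    hℓ _ trivial, hℓ _ trivial, hℓ _ trivial, hℓ _ trivial, affineMap_apply_eq ℓ (x + u + v),
    affineMap_apply_eq ℓ (x + u), affineMap_apply_eq ℓ (x + v), affineMap_apply_eq ℓ x, mixedDiff]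
  simp only [map_add]
  ring

/-- The periods of the mixed second differences of `f`. -/
def periods (f : F → ℝ) : AddSubgroup F where
  carrier := {τ | ∀ x u v, mixedDiff f (x + τ) u v = mixedDiff f x u v}
  zero_mem' := by intro x u v; rw [add_zero]
  add_mem' := by
    intro a b ha hb x u v
    rw [← add_assoc, hb, ha]
  neg_mem' := by
    intro a ha x u v
    rw [← ha, neg_add_cancel_right]

omit [FiniteDimensional ℝ F] in
lemma ScalingSymm.map_periods {g : F ≃ᵃ[ℝ] F} {c : ℝ} (hg : ScalingSymm univ f g c) {τ : F}
    (hτ : τ ∈ periods f) : g.linear τ ∈ periods f := by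
  intro x u v
  obtain ⟨x, rfl⟩ := g.surjective x
  obtain ⟨u, rfl⟩ := g.linear.surjective u
  obtain ⟨v, rfl⟩ := g.linear.surjective v
  rw [← affine_apply_add, hg.mixedDiff_eq, hg.mixedDiff_eq, hτ]

omit [FiniteDimensional ℝ F] in
lemma ScalingSymm.translation_mem_periods {g : F ≃ᵃ[ℝ] F} (hg : ScalingSymm univ f g 1)
    (hlin : linEnd g = 1) : g 0 ∈ periods f ∧ ∀ x, g x = x + g 0 := by
  have hl : ∀ v, g.linear v = v := fun v => by rw [← linEnd_apply, hlin]; rfl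
  have h2 : ∀ x, g x = x + g 0 := fun x => by rw [affine_apply_eq, hl, add_comm]
  refine ⟨fun x u v => ?_, h2⟩
  have := hg.mixedDiff_eq x u v
  rwa [hl, hl, one_mul, h2] at this

namespace Contracting

variable (hf : Contracting f)
include hf

lemma continuous : Continuous f :=
  continuousOn_univ.1 (continuousOn_of_strictEpi hf.proper)

lemma convexOn : ConvexOn ℝ univ f := convexOn_of_strictEpi hf.proper

lemma isClosed_periods : IsClosed (periods f : Set F) := by
  have : (periods f : Set F) =
      ⋂ x, ⋂ u, ⋂ v, {τ | mixedDiff f (x + τ) u v = mixedDiff f x u v} := by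
    ext τ
    simp only [mem_iInter]
    rfl
  rw [this]
  have hc := hf.continuous
  refine isClosed_iInter fun x => isClosed_iInter fun u => isClosed_iInter fun v =>
    isClosed_eq ?_ continuous_const
  unfold mixedDiff
  fun_prop

lemma exists_approx (p q : F) {ε : ℝ} (hε : 0 < ε) :
    ∃ g c, ScalingSymm univ f g c ∧ ‖linCLM g‖ < ε ∧ ‖g p - q‖ < ε := by
  have hp : 0 < ‖p‖ + 1 := by positivity
  set δ := min ε (ε / 2 / (‖p‖ + 1)) with hδ
  have hδ0 : 0 < δ := by positivity
  have hδ1 : δ ≤ ε := min_le_left _ _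
  have hδ2 : δ * (‖p‖ + 1) ≤ ε / 2 := by
    rw [← le_div_iff₀ hp]; exact min_le_right _ _
  obtain ⟨g, c, hg, h1, h2⟩ := hf.contract q δ hδ0
  refine ⟨g, c, hg, h1.trans_le hδ1, ?_⟩
  have h3 : ‖g.linear p‖ ≤ δ * ‖p‖ :=
    ((linCLM g).le_opNorm p).trans (mul_le_mul_of_nonneg_right h1.le (norm_nonneg _))
  have e : g p - q = (g 0 - q) + g.linear p := by rw [affine_apply_eq]; abel
  rw [e]
  refine (norm_add_le _ _).trans_lt ?_
  nlinarith [norm_nonneg p]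

omit hf in
lemma _root_.linear_ne_self {g : F ≃ᵃ[ℝ] F} (hg : ‖linCLM g‖ < 1) {v : F} (hv : g.linear v = v) :
    v = 0 := by
  by_contra h0
  have h1 := (linCLM g).le_opNorm v
  rw [linCLM_apply, hv] at h1
  have : 0 < ‖v‖ := norm_pos_iff.2 h0
  nlinarith

omit hf in
lemma _root_.exists_fixed_of_injective {g : F ≃ᵃ[ℝ] F} (hg : ∀ v, g.linear v = v → v = 0) :
    ∃ p, g p = p ∧ ∀ q, g q = q → q = p := by
  have hinj : Function.Injective ((LinearMap.id : F →ₗ[ℝ] F) - g.linear.toLinearMap) := by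
    rw [← LinearMap.ker_eq_bot, LinearMap.ker_eq_bot']
    intro v hv
    refine hg v ?_
    rw [LinearMap.sub_apply, sub_eq_zero] at hv
    exact hv.symm
  obtain ⟨p, hp⟩ := LinearMap.injective_iff_surjective.1 hinj (g 0)
  have hp' : p - g.linear p = g 0 := hp
  have hfix : g p = p := by rw [affine_apply_eq, ← hp']; abel
  refine ⟨p, hfix, fun q hq => ?_⟩
  rw [← sub_eq_zero]
  refine hg _ ?_
  have := affine_apply_add g p (q - p)
  rw [add_sub_cancel, hq, hfix] at this
  rw [eq_sub_iff_add_eq, add_comm, ← this]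

lemma exists_contraction : ∃ g c p, ScalingSymm univ f g c ∧ ‖linCLM g‖ < 1 ∧ g p = p ∧
    ∀ q, g q = q → q = p := by
  obtain ⟨g, c, hg, h1, -⟩ := hf.contract 0 1 one_pos
  obtain ⟨p, hp, hp'⟩ := exists_fixed_of_injective (g := g) fun v hv => linear_ne_self h1 hv
  exact ⟨g, c, p, hg, h1, hp, hp'⟩

lemma not_fixed [Nontrivial F] (p : F) : ∃ g c, ScalingSymm univ f g c ∧ g p ≠ p := by
  obtain ⟨q, hq⟩ := exists_ne p
  obtain ⟨g, c, hg, -, h⟩ := hf.exists_approx p q (norm_pos_iff.2 (sub_ne_zero.2 hq.symm))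
  refine ⟨g, c, hg, fun e => ?_⟩
  rw [e] at h
  exact lt_irrefl _ h

lemma not_commute [Nontrivial F]
    (hcomm : ∀ g c h d, ScalingSymm univ f g c → ScalingSymm univ f h d → g * h = h * g) :
    False := by
  obtain ⟨g, c, p, hg, -, hp, hp'⟩ := hf.exists_contraction
  obtain ⟨h, d, hh, hne⟩ := hf.not_fixed p
  refine hne (hp' _ ?_)
  have := congrArg (fun k : F ≃ᵃ[ℝ] F => k p) (hcomm g c h d hg hh)
  change g (h p) = h (g p) at this
  rw [this, hp]

lemma exists_line_of_mem_periods {τ : F} (hτ : τ ∈ periods f) (h0 : τ ≠ 0) :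
    ∃ w ≠ 0, ∀ s : ℝ, s • w ∈ periods f := by
  choose g c hg hn _ using fun n : ℕ => hf.contract 0 (1 / ((n : ℝ) + 1)) (by positivity)
  set v := fun n => (g n).linear τ with hv
  have hv0 : ∀ n, v n ≠ 0 := fun n h => h0 ((map_eq_zero_iff _ (g n).linear.injective).1 h)
  have hvT : ∀ n, v n ∈ periods f := fun n => (hg n).map_periods hτ
  have hlim : Tendsto (fun n => ‖v n‖) atTop (𝓝 0) := by
    have h1 : Tendsto (fun n : ℕ => 1 / ((n : ℝ) + 1) * ‖τ‖) atTop (𝓝 (0 * ‖τ‖)) :=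
      tendsto_one_div_add_atTop_nhds_zero_nat.mul_const _
    rw [zero_mul] at h1
    exact squeeze_zero (fun n => norm_nonneg _) (fun n => ((linCLM (g n)).le_opNorm τ).trans
      (mul_le_mul_of_nonneg_right (hn n).le (norm_nonneg _))) h1
  have := FiniteDimensional.proper ℝ F
  obtain ⟨w, hw, φ, hφ, hwlim⟩ := (isCompact_sphere (0 : F) 1).tendsto_subseq
    (x := fun n => ‖v n‖⁻¹ • v n) (fun n => by
      rw [mem_sphere_zero_iff_norm, norm_smul, norm_inv, norm_norm,
        inv_mul_cancel₀ (norm_ne_zero_iff.2 (hv0 n))])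
  refine ⟨w, fun h => by simp [h] at hw, fun s => ?_⟩
  refine hf.isClosed_periods.mem_of_tendsto (b := atTop)
    (f := fun n => ⌊s / ‖v (φ n)‖⌋ • v (φ n)) ?_
    (Eventually.of_forall fun n => (periods f).zsmul_mem (hvT _) _)
  have h2 : Tendsto (fun n => (⌊s / ‖v (φ n)‖⌋ : ℝ) * ‖v (φ n)‖) atTop (𝓝 s) := by
    have h3 : Tendsto (fun n => s - ‖v (φ n)‖) atTop (𝓝 (s - 0)) :=
      tendsto_const_nhds.sub (hlim.comp hφ.tendsto_atTop)
    rw [sub_zero] at h3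
    refine tendsto_of_tendsto_of_tendsto_of_le_of_le h3 tendsto_const_nhds (fun n => ?_)
      fun n => ?_
    · have hp : 0 < ‖v (φ n)‖ := norm_pos_iff.2 (hv0 _)
      have h4 := (Int.sub_one_lt_floor (s / ‖v (φ n)‖)).le
      have h5 := mul_le_mul_of_nonneg_right h4 hp.le
      rwa [sub_mul, div_mul_cancel₀ _ hp.ne', one_mul] at h5
    · have hp : 0 < ‖v (φ n)‖ := norm_pos_iff.2 (hv0 _)
      have h5 := mul_le_mul_of_nonneg_right (Int.floor_le (s / ‖v (φ n)‖)) hp.le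
      rwa [div_mul_cancel₀ _ hp.ne'] at h5
  refine (h2.smul hwlim).congr fun n => ?_
  have hp : ‖v (φ n)‖ ≠ 0 := norm_ne_zero_iff.2 (hv0 _)
  simp only [Function.comp, smul_smul]
  rw [mul_assoc, mul_inv_cancel₀ hp, mul_one, Int.cast_smul_eq_zsmul]

omit [FiniteDimensional ℝ F] hf in
lemma _root_.eq_one_of_periods_eq_bot (hT : periods f = ⊥) {g : F ≃ᵃ[ℝ] F}
    (hg : ScalingSymm univ f g 1) (hlin : linEnd g = 1) : g = 1 := by
  obtain ⟨h1, h2⟩ := hg.translation_mem_periods hlin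
  rw [hT, AddSubgroup.mem_bot] at h1
  ext x
  rw [h2, h1, add_zero]; rfl

omit [FiniteDimensional ℝ F] hf in
lemma _root_.ScalingSymm.commutator {g h : F ≃ᵃ[ℝ] F} {c d : ℝ} (hg : ScalingSymm univ f g c)
    (hh : ScalingSymm univ f h d) : ScalingSymm univ f (g * h * g⁻¹ * h⁻¹) 1 := by
  have := ((hg.mul hh).mul hg.inv).mul hh.inv
  have e : c * d * c⁻¹ * d⁻¹ = 1 := by
    have := hg.pos.ne'
    have := hh.pos.ne'
    field_simp
  rwa [e] at this

omit [FiniteDimensional ℝ F] hf in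
lemma _root_.linEnd_mul_inv (g : F ≃ᵃ[ℝ] F) : linEnd g * linEnd g⁻¹ = 1 := by
  rw [← map_mul, mul_inv_cancel, map_one]

omit [FiniteDimensional ℝ F] hf in
lemma _root_.linEnd_commutator {g h : F ≃ᵃ[ℝ] F} (hc : linEnd g * linEnd h = linEnd h * linEnd g) :
    linEnd (g * h * g⁻¹ * h⁻¹) = 1 := by
  rw [map_mul, map_mul, map_mul, hc, mul_assoc (linEnd h), linEnd_mul_inv, mul_one,
    linEnd_mul_inv]

omit [FiniteDimensional ℝ F] hf in
lemma _root_.commute_of_commutator {G : Type*} [Group G] {g h : G}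
    (hc : g * h * g⁻¹ * h⁻¹ = 1) : g * h = h * g := by
  have := mul_inv_eq_one.1 hc
  exact mul_inv_eq_iff_eq_mul.1 this

/-- Commutators translate by periods, and there are enough of them when linear parts commute. -/
lemma periods_eq_top_of_commute (hc : ∀ g c h d, ScalingSymm univ f g c →
    ScalingSymm univ f h d → linEnd g * linEnd h = linEnd h * linEnd g) : periods f = ⊤ := by
  rw [eq_top_iff]
  intro y _
  obtain ⟨g, c, p, hg, hg1, hp, -⟩ := hf.exists_contraction
  have hmem : ∀ h d, ScalingSymm univ f h d → linCLM g (h p - p) - (h p - p) ∈ periods f := by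
    intro h d hh
    obtain ⟨h1, h2⟩ := (hg.commutator hh).translation_mem_periods
      (linEnd_commutator (hc g c h d hg hh))
    have h3 := h2 (h p)
    have h4 : (g * h * g⁻¹ * h⁻¹) (h p) = g (h p) := by
      change g (h (g.symm (h.symm (h p)))) = _
      rw [h.symm_apply_apply, (AffineEquiv.symm_apply_eq g).2 hp.symm]
    have h5 := affine_apply_add g p (h p - p)
    rw [add_sub_cancel, hp] at h5
    rw [h4, h5] at h3
    convert h1 using 1
    rw [linCLM_apply, eq_sub_of_add_eq' h3.symm]
    abel
  have hinj : Function.Injective ((linCLM g : F →ₗ[ℝ] F) - (LinearMap.id : F →ₗ[ℝ] F)) := by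
    rw [← LinearMap.ker_eq_bot, LinearMap.ker_eq_bot']
    intro v hv
    exact linear_ne_self hg1 (sub_eq_zero.1 hv)
  obtain ⟨z, hz⟩ := LinearMap.injective_iff_surjective.1 hinj y
  have hz' : linCLM g z - z = y := hz
  choose h d hh _ hn using fun n : ℕ => hf.exists_approx p (p + z)
    (ε := 1 / ((n : ℝ) + 1)) (by positivity)
  have hlim : Tendsto (fun n => h n p) atTop (𝓝 (p + z)) := by
    rw [tendsto_iff_norm_sub_tendsto_zero]
    exact squeeze_zero (fun n => norm_nonneg _) (fun n => (hn n).le)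
      tendsto_one_div_add_atTop_nhds_zero_nat
  have hlim2 : Tendsto (fun n => h n p - p) atTop (𝓝 z) := by
    simpa using hlim.sub_const p
  refine hf.isClosed_periods.mem_of_tendsto (b := atTop)
    ?_ (Eventually.of_forall fun n => hmem _ _ (hh n))
  have := (((linCLM g).continuous.tendsto _).comp hlim2).sub hlim2
  rwa [hz'] at this

lemma periods_eq_top_of_finrank_one (hF : Module.finrank ℝ F = 1) : periods f = ⊤ := by
  have : Nontrivial F := Module.nontrivial_of_finrank_pos (R := ℝ) (by omega)
  refine hf.periods_eq_top_of_commute fun g c h d _ _ => ?_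
  ext v
  obtain ⟨e, he⟩ := exists_ne (0 : F)
  have hs := (finrank_eq_one_iff_of_nonzero' e he).1 hF
  obtain ⟨a, ha⟩ := hs (linEnd g e)
  obtain ⟨b, hb⟩ := hs (linEnd h e)
  obtain ⟨s, rfl⟩ := hs v
  simp only [Module.End.mul_apply, map_smul, ← ha, ← hb]
  module

end Contracting

end Contracting

section Unimodular

variable {F : Type*} [NormedAddCommGroup F] [NormedSpace ℝ F] {f : F → ℝ}

/-- The symmetries of `f` with factor one and determinant one. -/
structure Unimodular (f : F → ℝ) (h : F ≃ᵃ[ℝ] F) : Prop where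
  symm : ScalingSymm univ f h 1
  det : LinearMap.det (linEnd h) = 1

lemma Unimodular.mul {h k : F ≃ᵃ[ℝ] F} (hh : Unimodular f h) (hk : Unimodular f k) :
    Unimodular f (h * k) := by
  refine ⟨by simpa using hh.symm.mul hk.symm, ?_⟩
  rw [map_mul, map_mul, hh.det, hk.det, one_mul]

lemma det_linEnd_mul_inv (h : F ≃ᵃ[ℝ] F) :
    LinearMap.det (linEnd h) * LinearMap.det (linEnd h⁻¹) = 1 := by
  rw [← map_mul, linEnd_mul_inv, map_one]

lemma Unimodular.conj {h g : F ≃ᵃ[ℝ] F} {c : ℝ} (hh : Unimodular f h)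
    (hg : ScalingSymm univ f g c) : Unimodular f (g * h * g⁻¹) := by
  refine ⟨?_, ?_⟩
  · have := (hg.mul hh.symm).mul hg.inv
    rwa [mul_one, mul_inv_cancel₀ hg.pos.ne'] at this
  · rw [map_mul, map_mul, map_mul, map_mul, hh.det, mul_one, det_linEnd_mul_inv]

lemma trace_linEnd_conj (h g : F ≃ᵃ[ℝ] F) :
    LinearMap.trace ℝ F (linEnd (g * h * g⁻¹)) = LinearMap.trace ℝ F (linEnd h) := by
  rw [map_mul linEnd, LinearMap.trace_mul_comm, ← map_mul linEnd, inv_mul_cancel_left]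

lemma ScalingSymm.unimodular_commutator {g h : F ≃ᵃ[ℝ] F} {c d : ℝ}
    (hg : ScalingSymm univ f g c) (hh : ScalingSymm univ f h d) :
    Unimodular f (g * h * g⁻¹ * h⁻¹) := by
  refine ⟨hg.commutator hh, ?_⟩
  simp only [map_mul]
  linear_combination LinearMap.det (linEnd g) * LinearMap.det (linEnd g⁻¹) * det_linEnd_mul_inv h +
    det_linEnd_mul_inv g

variable [FiniteDimensional ℝ F]

lemma exists_trace_bound :
    ∃ K, 0 ≤ K ∧ ∀ A : F →L[ℝ] F, |LinearMap.trace ℝ F (A : F →ₗ[ℝ] F)| ≤ K * ‖A‖ := by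
  set T := LinearMap.toContinuousLinearMap
    (LinearMap.trace ℝ F ∘ₗ (ContinuousLinearMap.coeLM ℝ : (F →L[ℝ] F) →ₗ[ℝ] F →ₗ[ℝ] F))
  exact ⟨‖T‖, T.opNorm_nonneg, fun A => T.le_opNorm A⟩

lemma tendsto_iterate_contraction {g : F ≃ᵃ[ℝ] F} (hg : ‖linCLM g‖ < 1) {p : F} (hp : g p = p)
    (x : F) : Tendsto (fun m : ℕ => (g ^ m) x) atTop (𝓝 p) := by
  have hb : ∀ m : ℕ, ‖(g ^ m) x - p‖ ≤ ‖linCLM g‖ ^ m * ‖x - p‖ := by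
    intro m
    induction m with
    | zero => simp
    | succ m ih =>
      have e : (g ^ (m + 1)) x - p = linCLM g ((g ^ m) x - p) := by
        rw [pow_succ']
        change g ((g ^ m) x) - p = _
        have := affine_apply_add g p ((g ^ m) x - p)
        rw [add_sub_cancel, hp] at this
        rw [this, linCLM_apply, add_sub_cancel_left]
      rw [e, pow_succ', mul_assoc]
      exact ((linCLM g).le_opNorm _).trans (mul_le_mul_of_nonneg_left ih (norm_nonneg _))
  rw [tendsto_iff_norm_sub_tendsto_zero]
  have h0 := (tendsto_pow_atTop_nhds_zero_of_lt_one (norm_nonneg (linCLM g)) hg).mul_const ‖x - p‖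
  rw [zero_mul] at h0
  exact squeeze_zero (fun _ => norm_nonneg _) hb h0

namespace Contracting

variable (hf : Contracting f)
include hf

lemma exists_unimodular_trace_bound :
    ∃ R, ∀ h, Unimodular f h → |LinearMap.trace ℝ F (linEnd h)| ≤ R := by
  obtain ⟨g, c, p, hg, hg1, hp, -⟩ := hf.exists_contraction
  obtain ⟨K, hK0, hK⟩ := exists_trace_bound (F := F)
  have := FiniteDimensional.proper ℝ F
  obtain ⟨R, hR⟩ := ContractsBy.linear_bound hf.proper (isCompact_closedBall p 1)
    (subset_univ _) (mem_univ p)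
  refine ⟨K * R, fun h hh => ?_⟩
  obtain ⟨m, hm⟩ := ((tendsto_iterate_contraction hg1 hp (h⁻¹ p)).eventually
    (Metric.closedBall_mem_nhds p one_pos)).exists
  have hgm : ∃ d, ScalingSymm univ f (g ^ m) d := by
    clear hm
    induction m with
    | zero => exact ⟨1, fun _ => by simp, one_pos, 0, fun x _ => by simp⟩
    | succ m ih =>
      obtain ⟨d, hd⟩ := ih
      exact ⟨_, by rw [pow_succ]; exact hd.mul hg⟩
  obtain ⟨d, hd⟩ := hgm
  have hpm : (g ^ m)⁻¹ p = p := by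
    have h1 : ∀ m : ℕ, (g ^ m) p = p := by
      intro m
      induction m with
      | zero => simp
      | succ m ih => rw [pow_succ]; change (g ^ m) (g p) = p; rw [hp, ih]
    change (g ^ m).symm p = p
    rw [AffineEquiv.symm_apply_eq, h1]
  have h2 := hR _ _ le_rfl (hh.conj hd).symm ((g ^ m) (h⁻¹ p)) hm (by
    change (g ^ m) (h ((g ^ m).symm ((g ^ m) (h.symm p)))) = p
    rw [AffineEquiv.symm_apply_apply, AffineEquiv.apply_symm_apply,
      ← AffineEquiv.eq_symm_apply]
    exact hpm.symm)
  have h3 := hK (linCLM (g ^ m * h * (g ^ m)⁻¹))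
  have e : LinearMap.trace ℝ F (linCLM (g ^ m * h * (g ^ m)⁻¹) : F →ₗ[ℝ] F) =
    LinearMap.trace ℝ F (linEnd h) := trace_linEnd_conj h (g ^ m)
  rw [e] at h3
  exact h3.trans (mul_le_mul_of_nonneg_left h2 hK0)

lemma abs_trace_le_two (hF : Module.finrank ℝ F = 2) {h : F ≃ᵃ[ℝ] F} (hh : Unimodular f h) :
    |LinearMap.trace ℝ F (linEnd h)| ≤ 2 := by
  obtain ⟨R, hR⟩ := hf.exists_unimodular_trace_bound
  have key : ∀ n : ℕ, ∀ h, Unimodular f h → |LinearMap.trace ℝ F (linEnd h)| ≤ 2 + |R| / 4 ^ n := by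
    intro n
    induction n with
    | zero =>
      intro h hh
      have := hR h hh
      have := le_abs_self R
      rw [pow_zero, div_one]; linarith
    | succ n ih =>
      intro h hh
      have h1 := ih _ (hh.mul hh)
      rw [map_mul, planar_trace_mul_self hF, hh.det] at h1
      have h2 := (le_abs_self _).trans h1
      have h3 : 0 ≤ |R| / 4 ^ n := by positivity
      have h4 : |R| / 4 ^ (n + 1) = (|R| / 4 ^ n) / 4 := by rw [pow_succ, div_div]
      rw [h4]
      refine abs_le_of_sq_le_sq ?_ (by linarith)
      nlinarith
  have hlim : Tendsto (fun n : ℕ => 2 + |R| / 4 ^ n) atTop (𝓝 (2 + 0)) :=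
    tendsto_const_nhds.add (tendsto_const_nhds.div_atTop
      (tendsto_pow_atTop_atTop_of_one_lt (by norm_num)))
  rw [add_zero] at hlim
  exact ge_of_tendsto' hlim fun n => key n h hh

lemma eq_zero_of_le {q e : F} {a : ℝ} (h : ∀ n : ℕ, ∃ r : ℝ, n ≤ r ∧ f (q + r • e) ≤ f q + r * a) :
    e = 0 := by
  refine hf.vertical e a (recCone_of_line hf.proper.isOpen hf.proper.convex
    (x := (q, f q + 1)) fun t ht => ?_)
  rw [Prod.smul_mk, Prod.mk_add_mk, mem_strictEpi]
  refine ⟨trivial, ?_⟩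
  obtain ⟨n, hn⟩ := exists_nat_gt t
  obtain ⟨r, hr, hfr⟩ := h n
  have hr0 : 0 < r := by linarith
  have htr : t / r ≤ 1 := by rw [div_le_one hr0]; linarith
  have h1 := hf.convexOn.2 (mem_univ q) (mem_univ (q + r • e))
    (sub_nonneg.2 htr) (div_nonneg ht hr0.le) (sub_add_cancel 1 (t / r))
  have e1 : (1 - t / r) • q + (t / r) • (q + r • e) = q + t • e := by
    rw [smul_add, smul_smul, div_mul_cancel₀ _ hr0.ne']; module
  rw [e1, smul_eq_mul, smul_eq_mul] at h1
  have h2 : (t / r) * f (q + r • e) ≤ (t / r) * (f q + r * a) :=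
    mul_le_mul_of_nonneg_left hfr (by positivity)
  have h3 : (t / r) * (f q + r * a) = t / r * f q + t * a := by field_simp
  rw [smul_eq_mul]
  linarith

omit [FiniteDimensional ℝ F] hf in
/-- The values of `f` along an orbit of an affine map that is unipotent of order two. -/
lemma _root_.orbit_eq {h : F ≃ᵃ[ℝ] F} {ℓ : F →ᵃ[ℝ] ℝ} (hℓ : ∀ x, f (h x) = f x + ℓ x) {q δ e : F}
    (hδ : h q = q + δ) (he : h.linear δ = δ + e) (he' : h.linear e = e) (k : ℤ) :
    f (q + (k : ℝ) • δ + ((k : ℝ) * (k - 1) / 2) • e) = f q + k * ℓ q +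
      k * (k - 1) / 2 * ℓ.linear δ + k * (k - 1) * (k - 2) / 6 * ℓ.linear e := by
  have hstep : ∀ k : ℝ, f (q + (k + 1) • δ + ((k + 1) * (k + 1 - 1) / 2) • e) =
      f (q + k • δ + (k * (k - 1) / 2) • e) + (ℓ q + k * ℓ.linear δ +
        k * (k - 1) / 2 * ℓ.linear e) := by
    intro k
    have e1 : h (q + k • δ + (k * (k - 1) / 2) • e) =
        q + (k + 1) • δ + ((k + 1) * (k + 1 - 1) / 2) • e := by
      rw [affine_apply_add, affine_apply_add, hδ, map_smul, map_smul, he, he']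
      module
    rw [← e1, hℓ, affineMap_apply_eq ℓ (q + k • δ + _), affineMap_apply_eq ℓ q]
    simp only [map_add, map_smul, smul_eq_mul]
    ring
  induction k using Int.induction_on with
  | zero => simp
  | succ n ih =>
    push_cast at ih ⊢
    rw [hstep, ih]; ring
  | pred n ih =>
    have h1 := hstep ((-(n : ℤ) - 1 : ℤ) : ℝ)
    push_cast at h1 ih ⊢
    rw [sub_add_cancel, ih] at h1
    linear_combination -h1

end Contracting

end Unimodular

section Discrete

variable {F : Type*} [NormedAddCommGroup F] [NormedSpace ℝ F] [FiniteDimensional ℝ F] {f : F → ℝ}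

namespace Contracting

variable (hf : Contracting f)
include hf

lemma unipotent_defect_eq_zero {h : F ≃ᵃ[ℝ] F} (hh : ScalingSymm univ f h 1) {q δ e : F}
    (hδ : h q = q + δ) (he : h.linear δ = δ + e) (he' : h.linear e = e) : e = 0 := by
  obtain ⟨ℓ, hℓ⟩ := hh.exists_affine
  have hℓ' : ∀ x, f (h x) = f x + ℓ x := fun x => by rw [hℓ x trivial, one_mul]
  refine hf.eq_zero_of_le (q := q) (a := ℓ.linear δ - ℓ.linear e) fun n => ?_
  refine ⟨((n : ℝ) + 2) ^ 2 / 2, by nlinarith [Nat.cast_nonneg (α := ℝ) n], ?_⟩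
  have h1 := orbit_eq hℓ' hδ he he' ((n : ℤ) + 2)
  have h2 := orbit_eq hℓ' hδ he he' (-((n : ℤ) + 2))
  have h3 := hf.convexOn.2 (mem_univ (q + (((n : ℤ) + 2 : ℤ) : ℝ) • δ +
    ((((n : ℤ) + 2 : ℤ) : ℝ) * ((((n : ℤ) + 2 : ℤ) : ℝ) - 1) / 2) • e))
    (mem_univ (q + ((-((n : ℤ) + 2) : ℤ) : ℝ) • δ +
    (((-((n : ℤ) + 2) : ℤ) : ℝ) * (((-((n : ℤ) + 2) : ℤ) : ℝ) - 1) / 2) • e))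
    (show (0 : ℝ) ≤ 1 / 2 by norm_num) (show (0 : ℝ) ≤ 1 / 2 by norm_num) (by norm_num)
  rw [h1, h2] at h3
  push_cast at h3
  have e1 : q + (((n : ℝ) + 2) ^ 2 / 2) • e = (1 / 2 : ℝ) • (q + ((n : ℝ) + 2) • δ +
      (((n : ℝ) + 2) * ((n : ℝ) + 2 - 1) / 2) • e) + (1 / 2 : ℝ) • (q + (-((n : ℝ) + 2)) • δ +
      (-((n : ℝ) + 2) * (-((n : ℝ) + 2) - 1) / 2) • e) := by module
  rw [e1]
  refine h3.trans (le_of_eq ?_)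
  rw [smul_eq_mul, smul_eq_mul]
  ring

lemma displacement_eq_zero {h : F ≃ᵃ[ℝ] F} {ℓ : F →ᵃ[ℝ] ℝ} (hℓ : ∀ x, f (h x) = f x + ℓ x)
    {q δ : F} (hδ : h q = q + δ) (he : h.linear δ = δ) (hneg : ℓ.linear δ ≤ 0) : δ = 0 := by
  refine hf.eq_zero_of_le (q := q) (a := ℓ q) fun n => ⟨(n : ℝ) + 1, by linarith, ?_⟩
  have h1 := orbit_eq hℓ hδ (e := 0) (by rw [he, add_zero]) (map_zero _) ((n : ℤ) + 1)
  push_cast at h1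
  rw [smul_zero, add_zero, map_zero, mul_zero, add_zero] at h1
  rw [h1]
  have : ((n : ℝ) + 1) * ((n : ℝ) + 1 - 1) / 2 * ℓ.linear δ ≤ 0 :=
    mul_nonpos_of_nonneg_of_nonpos (by
      rw [add_sub_cancel_right]; positivity) hneg
  linarith

variable (hF : Module.finrank ℝ F = 2) (hT : periods f = ⊥)
include hF hT

lemma unimodular_eq_one_of_trace_eq_two {h : F ≃ᵃ[ℝ] F} (hh : Unimodular f h)
    (htr : LinearMap.trace ℝ F (linEnd h) = 2) : h = 1 := by
  have hCH := planar_mul_self hF (linEnd h)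
  rw [htr, hh.det, one_smul] at hCH
  have hN : ∀ v, h.linear (h.linear v - v) = h.linear v - v := by
    intro v
    have h1 := LinearMap.congr_fun hCH v
    have h2 : h.linear (h.linear v) = (2 : ℝ) • h.linear v - v := h1
    rw [map_sub, h2]; module
  refine eq_one_of_periods_eq_bot hT hh.symm ?_
  by_contra hne
  obtain ⟨v, hv⟩ : ∃ v, h.linear v - v ≠ 0 := by
    by_contra! hall
    exact hne (LinearMap.ext fun v => sub_eq_zero.1 (hall v))
  obtain ⟨ℓ, hℓ⟩ := hh.symm.exists_affine
  have hℓ' : ∀ x, f (h x) = f x + ℓ x := fun x => by rw [hℓ x trivial, one_mul]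
  set N := h.linear v - v with hNv
  have hNN : h.linear N = N := hN v
  have hfix : h.linear (h 0) - h 0 = 0 :=
    hf.unipotent_defect_eq_zero hh.symm (q := 0) (δ := h 0) (by rw [zero_add])
      (by rw [add_sub_cancel]) (hN _)
  have hind := independent_of_not_smul (w := v) hv (by
    intro a ha
    apply hv
    rw [hNv, ha, map_smul, hNN, sub_self])
  obtain ⟨b, a, hab⟩ := planar_span hF hind (h 0)
  have ha : a = 0 := by
    rw [hab, map_add, map_smul, map_smul, hNN] at hfix
    have : a • N = 0 := by rw [hNv, smul_sub, ← hfix]; abel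
    exact (smul_eq_zero.1 this).resolve_right hv
  rw [ha, zero_smul, add_zero] at hab
  have hhv : h.linear v = v + N := by rw [hNv]; abel
  have hq₀ : h (-b • v) = -b • v := by
    rw [affine_apply_eq, hab, map_smul, hhv]; module
  rcases le_total (ℓ.linear N) 0 with hs | hs
  · refine hv (hf.displacement_eq_zero hℓ' (q := -b • v + v) ?_ hNN hs)
    rw [affine_apply_add, hq₀, hhv]; abel
  · refine hv (neg_eq_zero.1 (hf.displacement_eq_zero hℓ' (q := -b • v + -v) (δ := -N) ?_ ?_ ?_))
    · rw [affine_apply_add, hq₀, map_neg, hhv]; abel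
    · rw [map_neg, hNN]
    · rw [map_neg]; linarith

lemma unimodular_eq_one {h : F ≃ᵃ[ℝ] F} (hh : Unimodular f h) : h = 1 := by
  by_contra hne
  have : Nontrivial F := Module.nontrivial_of_finrank_pos (R := ℝ) (by omega)
  have h2 := abs_le.1 (hf.abs_trace_le_two hF hh)
  have htr : LinearMap.trace ℝ F (linEnd h) < 2 :=
    lt_of_le_of_ne h2.2 fun e => hne (hf.unimodular_eq_one_of_trace_eq_two hF hT hh e)
  have hfix : ∀ v, h.linear v = v → v = 0 := by
    intro v hv
    have hdet : LinearMap.det (linEnd h - 1) ≠ 0 := by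
      rw [planar_det_sub_one hF, hh.det]
      intro e; linarith
    have hinj := (LinearMap.equivOfDetNeZero _ hdet).injective
    refine hinj ?_
    rw [map_zero]
    change h.linear v - v = 0
    rw [hv, sub_self]
  obtain ⟨p, hp, hp'⟩ := exists_fixed_of_injective hfix
  have hcomm : ∀ k, Unimodular f k → k * h = h * k := by
    intro k hk
    refine commute_of_commutator (eq_one_of_periods_eq_bot hT (hk.symm.commutator hh.symm)
      (linEnd_commutator ?_))
    rcases h2.1.eq_or_lt with e | hlt
    · have hsq : h * h = 1 := by
        refine hf.unimodular_eq_one_of_trace_eq_two hF hT (hh.mul hh) ?_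
        rw [map_mul, planar_trace_mul_self hF, hh.det, ← e]; norm_num
      have h3 := planar_mul_self hF (linEnd h)
      rw [← map_mul, hsq, map_one, hh.det, ← e] at h3
      have h4 : linEnd h = -1 := by
        have h5 : linEnd h = (-(1 / 2) : ℝ) • ((-2 : ℝ) • linEnd h - (1 : ℝ) • 1) +
            (-(1 / 2) : ℝ) • (1 : Module.End ℝ F) := by module
        rw [← h3] at h5
        rw [h5]; module
      rw [h4, mul_neg, neg_mul, one_mul, mul_one]
    · refine planar_commute hF hh.det (by nlinarith) ?_
      have h3 := hk.symm.unimodular_commutator hh.symm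
      have e : linEnd k * linEnd h - linEnd h * linEnd k =
          (linEnd (k * h * k⁻¹ * h⁻¹) - 1) * (linEnd h * linEnd k) := by
        rw [sub_mul, one_mul, ← map_mul, ← map_mul, ← map_mul]
        congr 2
        group
      rw [e, map_mul LinearMap.det, map_mul LinearMap.det, hh.det, hk.det, mul_one, mul_one,
        planar_det_sub_one hF, h3.det]
      have := (abs_le.1 (hf.abs_trace_le_two hF h3)).2
      linarith
  obtain ⟨g, c, hg, hgp⟩ := hf.not_fixed p
  have h3 := congrArg (fun k : F ≃ᵃ[ℝ] F => k p) (hcomm _ (hh.conj hg))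
  have h4 : g (h (g.symm (h p))) = h (g (h (g.symm p))) := h3
  rw [hp] at h4
  have h5 : h (g.symm p) = g.symm p := by
    rw [← AffineEquiv.apply_eq_iff_eq g, g.apply_symm_apply]
    exact hp' _ h4.symm
  have h6 := hp' _ h5
  exact hgp (by rw [← h6, g.apply_symm_apply, h6])

omit hT in
lemma periods_ne_bot : periods f ≠ ⊥ := by
  intro hT
  have : Nontrivial F := Module.nontrivial_of_finrank_pos (R := ℝ) (by omega)
  exact hf.not_commute fun g c h d hg hh => commute_of_commutator
    (hf.unimodular_eq_one hF hT (hg.unimodular_commutator hh))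

end Contracting

end Discrete

section Quadratic

variable {F : Type*} [NormedAddCommGroup F] [NormedSpace ℝ F] [FiniteDimensional ℝ F] {f : F → ℝ}

omit [NormedSpace ℝ F] [FiniteDimensional ℝ F] in
lemma mixedDiff_add_left (x u u' v : F) :
    mixedDiff f x (u + u') v = mixedDiff f x u v + mixedDiff f (x + u) u' v := by
  unfold mixedDiff
  rw [← add_assoc]; ring

omit [NormedSpace ℝ F] [FiniteDimensional ℝ F] in
lemma mixedDiff_comm (x u v : F) : mixedDiff f x u v = mixedDiff f x v u := by
  unfold mixedDiff
  rw [add_right_comm]; ring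

omit [NormedSpace ℝ F] [FiniteDimensional ℝ F] in
lemma mixedDiff_base {τ : F} (hτ : τ ∈ periods f) (x y u : F) :
    mixedDiff f x τ u = mixedDiff f y τ u := by
  have h := hτ x u (y - x)
  unfold mixedDiff at h ⊢
  have e1 : x + τ + u + (y - x) = y + τ + u := by abel
  have e2 : x + τ + (y - x) = y + τ := by abel
  have e3 : x + u + (y - x) = y + u := by abel
  rw [e1, e2, e3, add_sub_cancel] at h
  linarith

namespace Contracting

variable (hf : Contracting f)
include hf

lemma exists_linear_mixedDiff {w : F} (hw : ∀ s : ℝ, s • w ∈ periods f) :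
    ∃ β : F →ₗ[ℝ] ℝ, ∀ x (s : ℝ) u, mixedDiff f x (s • w) u = s * β u := by
  have hc := hf.continuous
  have hadd : ∀ (s : ℝ) u v, mixedDiff f 0 (s • w) (u + v) =
      mixedDiff f 0 (s • w) u + mixedDiff f 0 (s • w) v := by
    intro s u v
    rw [mixedDiff_comm, mixedDiff_add_left, mixedDiff_comm 0 u, mixedDiff_comm (0 + u) v,
      mixedDiff_base (hw s) (0 + u) 0]
  let β : F →+ ℝ :=
    { toFun := fun u => mixedDiff f 0 ((1 : ℝ) • w) u
      map_zero' := by unfold mixedDiff; simp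
      map_add' := hadd 1 }
  have hβ : Continuous β := by
    change Continuous fun u => mixedDiff f 0 ((1 : ℝ) • w) u
    unfold mixedDiff
    fun_prop
  refine ⟨β.toRealLinearMap hβ, fun x s u => ?_⟩
  let γ : ℝ →+ ℝ :=
    { toFun := fun s => mixedDiff f 0 (s • w) u
      map_zero' := by unfold mixedDiff; simp
      map_add' := fun s t => by
        rw [add_smul, mixedDiff_add_left, mixedDiff_base (hw t) (0 + s • w) 0] }
  have hγ : Continuous γ := by
    change Continuous fun s : ℝ => mixedDiff f 0 (s • w) u
    unfold mixedDiff
    fun_prop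
  have h1 := (γ.toRealLinearMap hγ).map_smul s 1
  rw [smul_eq_mul, mul_one] at h1
  rw [mixedDiff_base (hw s) x 0]
  exact h1

lemma mixedDiff_self_ne_zero {w : F} (hw : w ≠ 0) (hline : ∀ s : ℝ, s • w ∈ periods f)
    (h0 : mixedDiff f 0 w w = 0) : False := by
  obtain ⟨β, hβ⟩ := hf.exists_linear_mixedDiff hline
  have h1 : β w = 0 := by
    have := hβ 0 1 w
    rwa [one_smul, one_mul, h0, eq_comm] at this
  have h2 : ∀ n : ℕ, f ((n : ℝ) • w) = f 0 + n * (f w - f 0) := by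
    intro n
    induction n with
    | zero => simp
    | succ n ih =>
      have := hβ 0 n w
      rw [h1, mul_zero, mixedDiff, zero_add, zero_add, ih] at this
      push_cast
      rw [add_smul, one_smul]
      linarith
  exact hw (hf.eq_zero_of_le (q := 0) (a := f w - f 0) fun n =>
    ⟨n, le_rfl, by rw [zero_add, h2]⟩)

lemma commute_of_line (hF : Module.finrank ℝ F = 2) {w : F} (hw : w ≠ 0)
    (hline : ∀ s : ℝ, s • w ∈ periods f)
    (heig : ∀ g c, ScalingSymm univ f g c → ∃ μ : ℝ, g.linear w = μ • w) :
    ∀ g c h d, ScalingSymm univ f g c → ScalingSymm univ f h d →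
      linEnd g * linEnd h = linEnd h * linEnd g := by
  obtain ⟨β, hβ⟩ := hf.exists_linear_mixedDiff hline
  have hβw : β w ≠ 0 := by
    intro h
    refine hf.mixedDiff_self_ne_zero hw hline ?_
    have := hβ 0 1 w
    rwa [one_smul, one_mul, h] at this
  obtain ⟨v, hv⟩ : ∃ v : F, ∀ a : ℝ, v ≠ a • w := by
    by_contra! hall
    have := (finrank_eq_one_iff_of_nonzero' w hw).2 fun v => (hall v).imp fun a ha => ha.symm
    omega
  set k := v - (β v / β w) • w with hk
  have hβk : β k = 0 := by
    rw [hk, map_sub, map_smul, smul_eq_mul, div_mul_cancel₀ _ hβw, sub_self]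
  have hspan := planar_span hF (independent_of_not_smul (w := k) hw (by
    intro a ha
    refine hv (a + β v / β w) ?_
    rw [add_smul, ← ha, hk, sub_add_cancel]))
  have heig2 : ∀ g c, ScalingSymm univ f g c → ∃ ν : ℝ, g.linear k = ν • k := by
    intro g c hg
    obtain ⟨μ, hμ⟩ := heig g c hg
    have h1 : ∀ u, μ * β (g.linear u) = c * β u := by
      intro u
      have := hg.mixedDiff_eq 0 w u
      rw [hμ, hβ] at this
      have h2 := hβ 0 1 u
      rw [one_smul, one_mul] at h2
      rw [this, h2]
    have hμ0 : μ ≠ 0 := by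
      rintro rfl
      have := h1 w
      rw [zero_mul] at this
      exact (mul_ne_zero hg.pos.ne' hβw) this.symm
    obtain ⟨a, b, hab⟩ := hspan (g.linear k)
    have h3 := h1 k
    rw [hβk, mul_zero, hab, map_add, map_smul, map_smul, hβk, smul_zero, add_zero,
      smul_eq_mul] at h3
    have ha : a = 0 := by
      simpa [hμ0, hβw] using h3
    exact ⟨b, by rw [hab, ha, zero_smul, zero_add]⟩
  intro g c h d hg hh
  obtain ⟨μ, hμ⟩ := heig g c hg
  obtain ⟨ν, hν⟩ := heig2 g c hg
  obtain ⟨μ', hμ'⟩ := heig h d hh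
  obtain ⟨ν', hν'⟩ := heig2 h d hh
  ext x
  obtain ⟨a, b, rfl⟩ := hspan x
  simp only [Module.End.mul_apply, linEnd_apply, map_add, map_smul, hμ, hν, hμ', hν']
  module

lemma periods_eq_top_of_finrank_two (hF : Module.finrank ℝ F = 2) : periods f = ⊤ := by
  obtain ⟨⟨τ, hτ⟩, h0⟩ := AddSubgroup.ne_bot_iff_exists_ne_zero.1 (hf.periods_ne_bot hF)
  obtain ⟨w, hw, hline⟩ := hf.exists_line_of_mem_periods hτ fun e => h0 (Subtype.ext e)
  by_cases heig : ∀ g c, ScalingSymm univ f g c → ∃ μ : ℝ, g.linear w = μ • w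
  · exact hf.periods_eq_top_of_commute (hf.commute_of_line hF hw hline heig)
  · push Not at heig
    obtain ⟨g, c, hg, hne⟩ := heig
    rw [eq_top_iff]
    intro x _
    obtain ⟨a, b, rfl⟩ := planar_span hF (independent_of_not_smul hw hne) x
    refine add_mem (hline a) ?_
    rw [← map_smul]
    exact hg.map_periods (hline b)

lemma exists_quadratic (hT : periods f = ⊤) : ∃ (B : LinearMap.BilinForm ℝ F) (l : F →ₗ[ℝ] ℝ),
    (∀ u v, B u v = B v u) ∧ (∀ u, u ≠ 0 → 0 < B u u) ∧ ∀ u, f u = f 0 + l u + B u u / 2 := by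
  have hmem : ∀ τ, τ ∈ periods f := fun τ => by rw [hT]; trivial
  choose β hβ using fun w => hf.exists_linear_mixedDiff (w := w) fun s => hmem _
  have hβ' : ∀ w u, β w u = mixedDiff f 0 w u := by
    intro w u
    have := hβ w 0 1 u
    rw [one_smul, one_mul] at this
    exact this.symm
  let B : LinearMap.BilinForm ℝ F := LinearMap.mk₂ ℝ (fun w u => β w u)
    (fun w w' u => by
      rw [hβ', hβ', hβ', mixedDiff_add_left, mixedDiff_base (hmem w') (0 + w) 0])
    (fun s w u => by rw [hβ', hβ w 0 s u, smul_eq_mul])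
    (fun w u v => map_add _ _ _) (fun s w u => map_smul _ _ _)
  have hB : ∀ w u, B w u = mixedDiff f 0 w u := hβ'
  have hc := hf.continuous
  let l : F →+ ℝ :=
    { toFun := fun u => f u - f 0 - B u u / 2
      map_zero' := by simp
      map_add' := fun u v => by
        have h1 : B (u + v) (u + v) = B u u + 2 * B u v + B v v := by
          simp only [map_add, LinearMap.add_apply]
          rw [hB v u, mixedDiff_comm, ← hB]; ring
        have h2 := hB u v
        unfold mixedDiff at h2
        simp only [zero_add] at h2
        rw [h1, h2]; ring }
  have hl : Continuous l := by
    change Continuous fun u => f u - f 0 - B u u / 2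
    simp only [hB, mixedDiff]
    fun_prop
  have hfl : ∀ u, f u = f 0 + l.toRealLinearMap hl u + B u u / 2 := by
    intro u
    change f u = f 0 + (f u - f 0 - B u u / 2) + B u u / 2
    ring
  refine ⟨B, l.toRealLinearMap hl, fun u v => by rw [hB, mixedDiff_comm, ← hB], fun u hu => ?_, hfl⟩
  by_contra! hneg
  refine hu (hf.eq_zero_of_le (q := 0) (a := l.toRealLinearMap hl u) fun n => ⟨n, le_rfl, ?_⟩)
  rw [zero_add, hfl]
  simp only [map_smul, LinearMap.smul_apply, smul_eq_mul]
  nlinarith [mul_nonneg (sq_nonneg (n : ℝ)) (neg_nonneg.2 hneg)]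

lemma exists_basis (hF : Module.finrank ℝ F = 1 ∨ Module.finrank ℝ F = 2) :
    ∃ (b : Module.Basis (Fin (Module.finrank ℝ F)) ℝ F) (l : F →ₗ[ℝ] ℝ),
      ∀ u, f u = f 0 + l u + ∑ i, b.repr u i ^ 2 := by
  obtain ⟨B, l, hsymm, hpos, hfl⟩ := hf.exists_quadratic
    (hF.elim hf.periods_eq_top_of_finrank_one hf.periods_eq_top_of_finrank_two)
  obtain ⟨v, hv⟩ := LinearMap.BilinForm.exists_orthogonal_basis (B := B) ⟨hsymm⟩
  have hv0 : ∀ i, 0 < B (v i) (v i) := fun i => hpos _ (v.ne_zero i)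
  have hw : ∀ i, IsUnit (√(2 / B (v i) (v i))) := fun i => by
    have := hv0 i
    exact isUnit_iff_ne_zero.2 (by positivity)
  refine ⟨v.isUnitSMul hw, l, fun u => ?_⟩
  rw [hfl]
  congr 1
  have h1 : B u u = ∑ i, v.repr u i ^ 2 * B (v i) (v i) := by
    conv_lhs => rw [← v.sum_repr u]
    simp only [map_sum, LinearMap.sum_apply, map_smul, LinearMap.smul_apply, smul_eq_mul]
    refine Finset.sum_congr rfl fun i _ => ?_
    rw [Finset.sum_eq_single i]
    · ring
    · intro j _ hj
      have : B (v j) (v i) = 0 := hv hj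
      rw [this, mul_zero]
    · simp
  rw [h1, Finset.sum_div]
  refine Finset.sum_congr rfl fun i _ => ?_
  rw [Module.Basis.repr_isUnitSMul, Units.smul_def, smul_eq_mul, Units.val_inv_eq_inv_val,
    IsUnit.unit_spec, mul_pow, inv_pow, Real.sq_sqrt (by have := hv0 i; positivity)]
  have := (hv0 i).ne'
  field_simp

end Contracting

end Quadratic

section RayCase

variable {E : Type*} [NormedAddCommGroup E] [NormedSpace ℝ E]
  {E' : Type*} [NormedAddCommGroup E'] [NormedSpace ℝ E']

lemma mem_recCone_preimage (e : E' ≃L[ℝ] E) {Ω : Set E} {u : E'} :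
    u ∈ recCone (e ⁻¹' Ω) ↔ e u ∈ recCone Ω := by
  constructor
  · intro h x hx t ht
    have := h (e.symm x) (by simpa using hx) t ht
    simpa using this
  · intro h x hx t ht
    have := h (e x) hx t ht
    simpa using this

lemma ProperDomain.preimage {Ω : Set E} (hΩ : ProperDomain Ω) (e : E' ≃L[ℝ] E) :
    ProperDomain (e ⁻¹' Ω) where
  nonempty := by
    obtain ⟨x, hx⟩ := hΩ.nonempty
    exact ⟨e.symm x, by simpa using hx⟩
  isOpen := hΩ.isOpen.preimage e.continuous
  convex := hΩ.convex.linear_preimage e.toLinearEquiv.toLinearMap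
  salient u h1 h2 := by
    rw [mem_recCone_preimage] at h1 h2
    have := hΩ.salient _ h1 (by simpa using h2)
    simpa using this

/-- Conjugation of an affine equivalence by a linear one. -/
def conjAffine (e : E' ≃L[ℝ] E) (g : E' ≃ᵃ[ℝ] E') : E ≃ᵃ[ℝ] E :=
  e.toLinearEquiv.toAffineEquiv.symm.trans (g.trans e.toLinearEquiv.toAffineEquiv)

lemma conjAffine_apply (e : E' ≃L[ℝ] E) (g : E' ≃ᵃ[ℝ] E') (x : E) :
    conjAffine e g x = e (g (e.symm x)) := rfl

lemma scalesRay_of_conjAffine {e : E' ≃L[ℝ] E} {g : E' ≃ᵃ[ℝ] E'} {u : E'}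
    (h : ScalesRay (e u) (conjAffine e g)) : ScalesRay u g := by
  obtain ⟨μ, hμ, h⟩ := h
  refine ⟨μ, hμ, e.injective ?_⟩
  rw [map_smul, ← h]
  change _ = e (g.linear (e.symm (e u)))
  rw [e.symm_apply_apply]

lemma CocompactBy.preimage {P : (E ≃ᵃ[ℝ] E) → Prop} {Ω : Set E} (h : CocompactBy P Ω)
    (e : E' ≃L[ℝ] E) : CocompactBy (fun g => P (conjAffine e g)) (e ⁻¹' Ω) := by
  obtain ⟨K, hK, hKΩ, hcov⟩ := h
  refine ⟨e.symm '' K, hK.image e.symm.continuous, ?_, fun x hx => ?_⟩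
  · rintro _ ⟨y, hy, rfl⟩
    simpa using hKΩ hy
  · obtain ⟨g, hP, hg, y, hy, hgy⟩ := hcov (e x) hx
    have hc : conjAffine e (conjAffine e.symm g) = g := by
      ext z
      simp [conjAffine_apply]
    refine ⟨conjAffine e.symm g, by simpa only [hc] using hP, fun z => ?_, e.symm y,
      ⟨y, hy, rfl⟩, ?_⟩
    · simpa [conjAffine_apply] using hg (e z)
    · simp [conjAffine_apply, hgy]

lemma Contracting.exists_affineEquiv {F : Type*} [NormedAddCommGroup F] [NormedSpace ℝ F]
    [FiniteDimensional ℝ F] {f : F → ℝ} (hf : Contracting f) {n : ℕ}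
    (hF : Module.finrank ℝ F = n) (hn : n = 1 ∨ n = 2) :
    ∃ e : (F × ℝ) ≃ᵃ[ℝ] ((Fin n → ℝ) × ℝ),
      ∀ p, p ∈ strictEpi univ f ↔ ∑ i, (e p).1 i ^ 2 < (e p).2 := by
  subst hF
  obtain ⟨b, l, h⟩ := hf.exists_basis hn
  let A : (F × ℝ) ≃ₗ[ℝ] ((Fin (Module.finrank ℝ F) → ℝ) × ℝ) :=
    LinearEquiv.ofLinearMap
      ((b.equivFun.toLinearMap ∘ₗ LinearMap.fst ℝ F ℝ).prod
        (LinearMap.snd ℝ F ℝ - l ∘ₗ LinearMap.fst ℝ F ℝ))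
      ((b.equivFun.symm.toLinearMap ∘ₗ LinearMap.fst ℝ _ ℝ).prod
        (LinearMap.snd ℝ _ ℝ + l ∘ₗ b.equivFun.symm.toLinearMap ∘ₗ LinearMap.fst ℝ _ ℝ))
      (by
        refine LinearMap.ext fun p => Prod.ext ?_ ?_
        · exact b.equivFun.apply_symm_apply p.1
        · simp)
      (by
        refine LinearMap.ext fun p => Prod.ext ?_ ?_
        · simp
        · simp)
  refine ⟨A.toAffineEquiv.trans (AffineEquiv.constVAdd ℝ _ (0, -f 0)), fun ⟨u, z⟩ => ?_⟩
  have e1 : (A.toAffineEquiv.trans (AffineEquiv.constVAdd ℝ _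
      ((0, -f 0) : (Fin (Module.finrank ℝ F) → ℝ) × ℝ))) (u, z) =
      (b.equivFun u, -f 0 + (z - l u)) := by
    simp [A]
  rw [e1, mem_strictEpi, h u]
  simp only [mem_univ, true_and, Module.Basis.equivFun_apply]
  constructor <;> intro h <;> linarith

/-- A quasi-homogeneous domain whose recession cone is a ray is a paraboloid. -/
theorem ProperDomain.exists_affineEquiv_of_ray {n : ℕ} (hE : Module.finrank ℝ E = n + 1)
    (hn : n = 1 ∨ n = 2) {Ω : Set E} (hΩ : ProperDomain Ω) {P : (E ≃ᵃ[ℝ] E) → Prop}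
    (hP : CocompactBy P Ω) {u : E} (hu : u ≠ 0) (hu' : u ∈ recCone Ω)
    (hrec : ∀ v ∈ recCone Ω, ∃ a : ℝ, 0 ≤ a ∧ v = a • u) :
    ∃ e : E ≃ᵃ[ℝ] ((Fin n → ℝ) × ℝ), ∀ x, x ∈ Ω ↔ ∑ i, (e x).1 i ^ 2 < (e x).2 := by
  have : FiniteDimensional ℝ E := Module.finite_of_finrank_pos (by omega)
  have hfr : Module.finrank ℝ ((Fin n → ℝ) × ℝ) = Module.finrank ℝ E := by
    rw [hE, Module.finrank_prod]; simp
  obtain ⟨B⟩ : Nonempty (((Fin n → ℝ) × ℝ) ≃L[ℝ] E) :=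
    ⟨ContinuousLinearEquiv.ofFinrankEq hfr⟩
  obtain ⟨A, hA⟩ := SeparatingDual.exists_continuousLinearEquiv_apply_eq (R := ℝ)
    (x := B (0, 1)) (y := u) (by simp) hu
  set e := B.trans A
  have he : e (0, 1) = u := hA
  have hΩ' := hΩ.preimage e
  have hP' := hP.preimage e
  have hrec' : ∀ v ∈ recCone (e ⁻¹' Ω), ∃ a : ℝ, 0 ≤ a ∧ v = a • ((0, 1) : (Fin n → ℝ) × ℝ) := by
    intro v hv
    obtain ⟨a, ha, h⟩ := hrec _ ((mem_recCone_preimage e).1 hv)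
    refine ⟨a, ha, e.injective ?_⟩
    rw [h, map_smul, he]
  have hv : ((0, 1) : (Fin n → ℝ) × ℝ) ∈ recCone (e ⁻¹' Ω) := by
    rwa [mem_recCone_preimage, he]
  obtain ⟨D, f, hDf⟩ := hΩ'.exists_strictEpi hv
  rw [hDf] at hΩ' hP' hrec' hv
  have hC : ContractsBy (fun _ => True) D f := ContractsBy.of_cocompactBy hΩ' hP'
    (fun g hg _ => scalesRay_of_recCone_eq_ray (by simp) hrec' hv hg) fun _ _ _ _ => trivial
  have hvert : ∀ w c, (w, c) ∈ recCone (strictEpi D f) → w = 0 := by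
    intro w c h
    obtain ⟨a, -, h'⟩ := hrec' _ h
    simpa using congrArg Prod.fst h'
  obtain ⟨rfl, hcon⟩ := exists_contractions hΩ' hC hvert
  obtain ⟨a, ha⟩ := Contracting.exists_affineEquiv ⟨hΩ', hvert, hcon⟩ (n := n) (by simp) hn
  refine ⟨e.symm.toLinearEquiv.toAffineEquiv.trans a, fun x => ?_⟩
  have h := ha (e.symm x)
  rw [← hDf, mem_preimage, e.apply_symm_apply] at h
  exact h

lemma ProperDomain.exists_recCone [FiniteDimensional ℝ E] [Nontrivial E] {Ω : Set E}
    (hΩ : ProperDomain Ω) {P : (E ≃ᵃ[ℝ] E) → Prop} (hP : CocompactBy P Ω) :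
    ∃ u : E, u ≠ 0 ∧ u ∈ recCone Ω := by
  refine exists_recCone_of_cocompactBy hΩ.isOpen hΩ.convex hΩ.nonempty ?_ hP
  rintro rfl
  obtain ⟨u, hu⟩ := exists_ne (0 : E)
  exact hu (hΩ.salient u (fun _ _ _ _ => trivial) fun _ _ _ _ => trivial)

lemma ProperDomain.span_recCone_ne_top [FiniteDimensional ℝ E] {Ω : Set E}
    (hΩ : ProperDomain Ω) {P : (E ≃ᵃ[ℝ] E) → Prop} (hP : CocompactBy P Ω)
    (hnc : ¬ ∃ v : E, ∀ x ∈ Ω, ∀ t : ℝ, 0 < t → v + t • (x - v) ∈ Ω) :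
    Submodule.span ℝ (recCone Ω) ≠ ⊤ := by
  intro h
  have hconv : Convex ℝ (recCone Ω) := fun x hx y hy a b ha hb _ =>
    add_mem_recCone (smul_mem_recCone hx ha) (smul_mem_recCone hy hb)
  have h0 : (0 : E) ∈ recCone Ω := zero_mem_recCone _
  have hinterior : (interior (recCone Ω)).Nonempty := by
    rw [hconv.interior_nonempty_iff_affineSpan_eq_top, ← insert_eq_of_mem h0,
      ← AffineSubspace.coe_eq_univ_iff, affineSpan_insert_zero, h]
    simp
  obtain ⟨u, hu⟩ := hinterior
  exact hnc (hΩ.cone_of_interior_recCone hP hu)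

lemma ProperDomain.nonneg_of_smul_mem {Ω : Set E} (hΩ : ProperDomain Ω) {u : E} (hu : u ≠ 0)
    (hu' : u ∈ recCone Ω) {a : ℝ} (ha : a • u ∈ recCone Ω) : 0 ≤ a := by
  by_contra! h
  refine hu (hΩ.salient u hu' ?_)
  have := smul_mem_recCone ha (a := -a⁻¹) (neg_nonneg.2 (inv_nonpos.2 h.le))
  rwa [smul_smul, neg_mul, inv_mul_cancel₀ h.ne, neg_one_smul] at this

lemma ProperDomain.exists_ray_of_finrank_two (hE : Module.finrank ℝ E = 2) {Ω : Set E}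
    (hΩ : ProperDomain Ω) {P : (E ≃ᵃ[ℝ] E) → Prop} (hP : CocompactBy P Ω)
    (hnc : ¬ ∃ v : E, ∀ x ∈ Ω, ∀ t : ℝ, 0 < t → v + t • (x - v) ∈ Ω) :
    ∃ u : E, u ≠ 0 ∧ u ∈ recCone Ω ∧ ∀ v ∈ recCone Ω, ∃ a : ℝ, 0 ≤ a ∧ v = a • u := by
  have : FiniteDimensional ℝ E := Module.finite_of_finrank_pos (by omega)
  have : Nontrivial E := Module.nontrivial_of_finrank_pos (R := ℝ) (by omega)
  obtain ⟨u, hu, hu'⟩ := hΩ.exists_recCone hP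
  refine ⟨u, hu, hu', fun v hv => ?_⟩
  by_cases h : ∃ a : ℝ, v = a • u
  · obtain ⟨a, rfl⟩ := h
    exact ⟨a, hΩ.nonneg_of_smul_mem hu hu' hv, rfl⟩
  · push Not at h
    refine (hΩ.span_recCone_ne_top hP hnc (eq_top_iff.2 fun x _ => ?_)).elim
    obtain ⟨a, b, rfl⟩ := planar_span hE (independent_of_not_smul hu h) x
    exact add_mem (Submodule.smul_mem _ _ (Submodule.subset_span hu'))
      (Submodule.smul_mem _ _ (Submodule.subset_span hv))

/-- A quasi-homogeneous planar domain that is not a cone is a parabola. -/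
theorem ProperDomain.exists_affineEquiv_of_finrank_two (hE : Module.finrank ℝ E = 2) {Ω : Set E}
    (hΩ : ProperDomain Ω) {P : (E ≃ᵃ[ℝ] E) → Prop} (hP : CocompactBy P Ω)
    (hnc : ¬ ∃ v : E, ∀ x ∈ Ω, ∀ t : ℝ, 0 < t → v + t • (x - v) ∈ Ω) :
    ∃ e : E ≃ᵃ[ℝ] ((Fin 1 → ℝ) × ℝ), ∀ x, x ∈ Ω ↔ ∑ i, (e x).1 i ^ 2 < (e x).2 := by
  obtain ⟨u, hu, hu', hrec⟩ := hΩ.exists_ray_of_finrank_two hE hP hnc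
  exact hΩ.exists_affineEquiv_of_ray hE (.inl rfl) hP hu hu' hrec

end RayCase

section HorizontalRay

variable {F : Type*} [NormedAddCommGroup F] [NormedSpace ℝ F] {D : Set F} {f : F → ℝ} {w : F}

/-- The recession cone of the epigraph is spanned by the vertical ray and a horizontal ray. -/
structure HorizontalRay (D : Set F) (f : F → ℝ) (w : F) : Prop where
  proper : ProperDomain (strictEpi D f)
  ne_zero : w ≠ 0
  mem : (w, (0 : ℝ)) ∈ recCone (strictEpi D f)
  recCone_le : ∀ v c, (v, c) ∈ recCone (strictEpi D f) → 0 ≤ c ∧ ∃ b : ℝ, 0 ≤ b ∧ v = b • w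

namespace HorizontalRay

variable (h : HorizontalRay D f w)
include h

lemma add_smul_mem {x : F} (hx : x ∈ D) {t : ℝ} (ht : 0 ≤ t) : x + t • w ∈ D := by
  have := h.mem (x, f x + 1) ⟨hx, by simp⟩ t ht
  exact this.1

lemma apply_add_smul_le {x : F} (hx : x ∈ D) {t : ℝ} (ht : 0 ≤ t) : f (x + t • w) ≤ f x := by
  refine le_of_forall_pos_lt_add fun ε hε => ?_
  have := h.mem (x, f x + ε) ⟨hx, by simpa using hε⟩ t ht
  simpa using this.2

lemma not_line (x : F) : ¬ ∀ t : ℝ, x + t • w ∈ D ∧ f (x + t • w) ≤ f x := by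
  intro hl
  have : (-w, (0 : ℝ)) ∈ recCone (strictEpi D f) := by
    refine recCone_of_line h.proper.isOpen h.proper.convex (x := (x, f x + 1)) fun t _ => ?_
    have := hl (-t)
    refine ⟨by simpa using this.1, ?_⟩
    have h2 := this.2
    simp only [neg_smul] at h2
    simp only [Prod.smul_mk, smul_neg, smul_zero, Prod.mk_add_mk, add_zero]
    linarith
  have h0 := h.proper.salient _ h.mem (by simpa using this)
  exact h.ne_zero (congrArg Prod.fst h0)

lemma not_slope {x : F} (hx : x ∈ D) {ε : ℝ} (hε : 0 < ε) :
    ¬ ∀ t : ℝ, 0 ≤ t → f (x + t • w) ≤ f x - ε * t := by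
  intro hl
  have : (w, -ε) ∈ recCone (strictEpi D f) := by
    refine recCone_of_line h.proper.isOpen h.proper.convex (x := (x, f x + 1)) fun t ht => ?_
    refine ⟨by simpa using h.add_smul_mem hx ht, ?_⟩
    have := hl t ht
    simp only [Prod.smul_mk, smul_eq_mul, Prod.mk_add_mk]
    linarith
  linarith [(h.recCone_le _ _ this).1]

variable [FiniteDimensional ℝ F]

lemma exists_preimage {P : (F ≃ᵃ[ℝ] F) → Prop} {q : F} (hq : q ∈ D)
    (l : DegenerateLimit P D f q) (hb : ¬ Bornology.IsBounded l.image) :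
    ∃ η, l.L η = w ∧ l.m η = 0 := by
  obtain ⟨w', x, hw', hx, hr⟩ := l.exists_recCone_of_unbounded h.proper hb
  obtain ⟨hm, b, hb0, e⟩ := h.recCone_le _ _ hr
  have hb : 0 < b := lt_of_le_of_ne hb0 (by rintro rfl; simp at e; exact hw' e)
  refine ⟨b⁻¹ • x, by rw [map_smul, ← hx, e, smul_smul, inv_mul_cancel₀ hb.ne', one_smul], ?_⟩
  have hm' : l.m x ≤ 0 := by
    have hc : Tendsto (fun t : ℝ => l.p + t • x) (𝓝[>] 0) (𝓝 (l.p + (0 : ℝ) • x)) :=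
      (Continuous.tendsto (by fun_prop) 0).mono_left nhdsWithin_le_nhds
    have hev := hc.eventually ((isOpen_of_strictEpi h.proper).mem_nhds
      (by simpa using l.p_mem : l.p + (0 : ℝ) • x ∈ D))
    obtain ⟨t, ht, ht0⟩ := (hev.and self_mem_nhdsWithin).exists
    have ht0 : 0 < t := ht0
    have h1 := l.f_eq _ ht
    rw [add_sub_cancel_left, map_smul, map_smul, ← hx, e, smul_smul] at h1
    have h2 := h.apply_add_smul_le hq (t := t * b) (by positivity)
    rw [h1, smul_eq_mul] at h2
    nlinarith
  rw [map_smul, le_antisymm hm' hm, smul_zero]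

lemma apply_eq {P : (F ≃ᵃ[ℝ] F) → Prop} {q : F} (hq : q ∈ D)
    (l : DegenerateLimit P D f q) (hb : ¬ Bornology.IsBounded l.image) {t : ℝ}
    (ht : q + t • w ∈ D) : f (q + t • w) = f q := by
  obtain ⟨η, h1, h2⟩ := h.exists_preimage hq l hb
  have e : q + l.L (l.p + t • η - l.p) = q + t • w := by
    rw [add_sub_cancel_left, map_smul, h1]
  have h3 := l.f_eq (l.p + t • η) (by rw [← l.mem_iff, e]; exact ht)
  rwa [e, add_sub_cancel_left, map_smul, h2, smul_zero, add_zero] at h3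

lemma ne_univ (hP : ContractsBy (ScalesRay w) D f) : D ≠ univ := by
  rintro rfl
  have hb : ∀ q (l : DegenerateLimit (ScalesRay w) univ f q), Bornology.IsBounded l.image := by
    intro q l
    by_contra hb
    exact h.not_line q fun t => ⟨trivial, (h.apply_eq trivial l hb trivial).le⟩
  obtain ⟨q, t₀, ht₀, hneg⟩ : ∃ q : F, ∃ t₀ : ℝ, 0 < t₀ ∧ f (q + t₀ • w) < f q := by
    by_contra! hn
    refine h.not_line 0 fun t => ⟨trivial, ?_⟩
    rcases le_or_gt 0 t with ht | ht
    · exact h.apply_add_smul_le trivial ht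
    · have := hn (0 + t • w) (-t) (by linarith)
      rwa [add_assoc, ← add_smul, add_neg_cancel, zero_smul, add_zero] at this
  obtain ⟨l⟩ := hP.nonempty_degenerateLimit h.proper (mem_univ q)
  have hL := l.L_eq_zero_of_bounded rfl (hb q l)
  choose μ hμ hμw using l.prop
  have hcont : Continuous f := continuousOn_univ.1 (continuousOn_of_strictEpi h.proper)
  have hconv := convexOn_of_strictEpi h.proper
  have hμ0 : Tendsto μ atTop (𝓝 0) := by
    have h1 := tendsto_clm_apply l.L_lim (tendsto_const_nhds (x := w))
    rw [hL] at h1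
    have h2 : Tendsto (fun n => ‖μ n • w‖ * ‖w‖⁻¹) atTop (𝓝 (‖(0 : F →L[ℝ] F) w‖ * ‖w‖⁻¹)) := by
      refine (h1.norm.mul_const _).congr fun n => ?_
      rw [linCLM_apply, hμw]
    simp only [FunLike.coe_zero, Pi.zero_apply, norm_zero, zero_mul] at h2
    refine h2.congr fun n => ?_
    rw [norm_smul, mul_assoc, mul_inv_cancel₀ (norm_ne_zero_iff.2 h.ne_zero), mul_one,
      Real.norm_of_nonneg (hμ n).le]
  set φ : ℝ → ℝ := fun t => f (q + t • w) - f q with hφ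
  have hφc : ConvexOn ℝ univ φ := by
    refine ⟨convex_univ, fun a _ b _ s t hs ht hst => ?_⟩
    have := hconv.2 (mem_univ (q + a • w)) (mem_univ (q + b • w)) hs ht hst
    have e : s • (q + a • w) + t • (q + b • w) = q + (s • a + t • b) • w := by
      have : q = (s + t) • q := by rw [hst, one_smul]
      conv_rhs => rw [this]
      simp only [smul_eq_mul]
      module
    rw [e] at this
    simp only [smul_eq_mul, hφ] at this ⊢
    have h3 : s * f q + t * f q = f q := by rw [← add_mul, hst, one_mul]
    nlinarith
  have hφ0 : φ 0 = 0 := by simp [hφ]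
  have hφn : ∀ t, 0 ≤ t → φ t ≤ 0 := fun t ht => sub_nonpos.2 (h.apply_add_smul_le trivial ht)
  have hfe : ∀ n t, φ (μ n * t) = l.c n * (f (l.q' n + t • w) - f (l.q' n)) := by
    intro n
    obtain ⟨ℓ, hℓ⟩ := (l.symm n).exists_affine
    have hc := (l.symm n).pos
    have key : ∀ t, φ (μ n * t) = l.c n * (f (l.q' n + t • w) - f (l.q' n)) + t * ℓ.linear w := by
      intro t
      have e1 : q + (μ n * t) • w = l.g n (l.q' n + t • w) := by
        rw [affine_apply_add, l.map, map_smul, hμw, smul_smul, mul_comm]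
      simp only [hφ]
      have e2 := hℓ (l.q' n) trivial
      rw [l.map] at e2
      rw [e1, hℓ _ trivial, e2, affineMap_apply_eq ℓ (l.q' n + t • w),
        affineMap_apply_eq ℓ (l.q' n), map_add, map_smul, smul_eq_mul]
      ring
    have ha : ℓ.linear w = 0 := by
      rcases lt_trichotomy (ℓ.linear w) 0 with ha | ha | ha
      · refine (h.not_slope (mem_univ q) (ε := -ℓ.linear w / μ n)
          (div_pos (neg_pos.2 ha) (hμ n)) fun t ht => ?_).elim
        have h1 := key (t / μ n)
        rw [mul_div_cancel₀ _ (hμ n).ne'] at h1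
        have h2 := h.apply_add_smul_le (mem_univ (l.q' n)) (div_nonneg ht (hμ n).le)
        have h3 : l.c n * (f (l.q' n + (t / μ n) • w) - f (l.q' n)) ≤ 0 :=
          mul_nonpos_of_nonneg_of_nonpos hc.le (by linarith)
        have h4 : -ℓ.linear w / μ n * t = -(t / μ n * ℓ.linear w) := by ring
        rw [h4]
        simp only [hφ] at h1
        linarith
      · exact ha
      · refine (h.not_slope (mem_univ (l.q' n)) (ε := ℓ.linear w / l.c n)
          (div_pos ha hc) fun t ht => ?_).elim
        have h1 := key t
        have h2 := hφn (μ n * t) (by have := hμ n; positivity)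
        have h3 : l.c n * (f (l.q' n + t • w) - f (l.q' n) + ℓ.linear w / l.c n * t) ≤ 0 := by
          have : l.c n * (ℓ.linear w / l.c n * t) = t * ℓ.linear w := by field_simp
          rw [mul_add, this]
          linarith
        have h4 := nonpos_of_mul_nonpos_right h3 hc
        linarith
    intro t
    rw [key, ha, mul_zero, add_zero]
  have hlim : ∀ t : ℝ, Tendsto (fun n => f (l.q' n + t • w) - f (l.q' n)) atTop
      (𝓝 (f (l.p + t • w) - f l.p)) := fun t =>
    ((hcont.tendsto _).comp (l.q'_lim.add_const _)).sub ((hcont.tendsto _).comp l.q'_lim)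
  have hval : ∀ n t, f (l.q' n + t • w) - f (l.q' n) = φ (μ n * t) / l.c n := by
    intro n t
    rw [hfe, mul_div_cancel_left₀ _ (l.symm n).pos.ne']
  by_cases hκ : Tendsto (fun n => μ n / l.c n) atTop (𝓝 0)
  · refine h.not_line l.p fun t => ⟨trivial, ?_⟩
    rcases le_or_gt 0 t with ht | ht
    · exact h.apply_add_smul_le trivial ht
    · have hsm : ∀ᶠ n in atTop, μ n * (-t) < 1 := by
        have := hμ0.mul_const (-t)
        rw [zero_mul] at this
        exact this.eventually_lt_const one_pos
      have hle := le_of_tendsto_of_tendsto (hlim t)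
        (hκ.mul_const (-t * φ (-1))) (hsm.mono fun n hn => ?_)
      · rw [zero_mul] at hle
        linarith
      · simp only
        rw [hval, div_mul_eq_mul_div]
        refine div_le_div_of_nonneg_right ?_ (l.symm n).pos.le
        have hs0 : 0 ≤ μ n * -t := mul_nonneg (hμ n).le (by linarith)
        have := hφc.2 (mem_univ (-1)) (mem_univ 0) hs0 (by linarith : 0 ≤ 1 - μ n * -t) (by ring)
        simp only [smul_eq_mul, hφ0, mul_zero, add_zero] at this
        have e : μ n * -t * -1 = μ n * t := by ring
        rw [e] at this
        linarith
  · obtain ⟨ε, hε, hfreq⟩ : ∃ ε > 0, ∃ᶠ n in atTop, ε ≤ μ n / l.c n := by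
      by_contra! hn
      refine hκ (tendsto_order.2 ⟨fun a ha => Eventually.of_forall fun n =>
        ha.trans (div_pos (hμ n) (l.symm n).pos), fun a ha => ?_⟩)
      exact (hn a ha).mono fun n hn => hn
    have hm : 0 < -φ t₀ / t₀ := div_pos (by simp only [hφ]; linarith) ht₀
    refine h.not_slope (mem_univ l.p) (mul_pos hm hε) fun t ht => ?_
    have hsm : ∀ᶠ n in atTop, μ n * t < t₀ := by
      have := hμ0.mul_const t
      rw [zero_mul] at this
      exact this.eventually_lt_const ht₀
    have := le_of_tendsto_of_frequently (hlim t) ((hfreq.and_eventually hsm).mono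
      (p := _) (q := fun n => f (l.q' n + t • w) - f (l.q' n) ≤ -(-φ t₀ / t₀ * ε * t)) ?_)
    · linarith
    · rintro n ⟨hn, hn'⟩
      rw [hval]
      have hs0 : 0 ≤ μ n * t := mul_nonneg (hμ n).le ht
      have hs1 : 0 ≤ 1 - μ n * t / t₀ := by
        rw [sub_nonneg, div_le_one ht₀]; exact hn'.le
      have := hφc.2 (mem_univ t₀) (mem_univ 0) (div_nonneg hs0 ht₀.le) hs1 (by ring)
      simp only [smul_eq_mul, hφ0, mul_zero, add_zero] at this
      rw [div_mul_cancel₀ _ ht₀.ne'] at this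
      calc φ (μ n * t) / l.c n ≤ (μ n * t / t₀ * φ t₀) / l.c n :=
            div_le_div_of_nonneg_right this (l.symm n).pos.le
        _ = -(-φ t₀ / t₀ * (μ n / l.c n) * t) := by ring
        _ ≤ _ := by
            have := mul_le_mul_of_nonneg_left hn hm.le
            have := mul_le_mul_of_nonneg_right this ht
            linarith

end HorizontalRay

end HorizontalRay

section Products

/-- Affine equivalence to the product of a parabola and a half-line. -/
def IsParabolaTimesRay {E : Type*} [AddCommGroup E] [Module ℝ E] (Ω : Set E) : Prop :=
  ∃ e : E ≃ᵃ[ℝ] (((Fin 1 → ℝ) × ℝ) × ℝ),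
    ∀ x, x ∈ Ω ↔ ∑ i, (e x).1.1 i ^ 2 < (e x).1.2 ∧ 0 < (e x).2

variable {F : Type*} [NormedAddCommGroup F] [NormedSpace ℝ F] {D : Set F} {f : F → ℝ}

lemma ContractsBy.cocompactBy {P : (F ≃ᵃ[ℝ] F) → Prop} (hP : ContractsBy P D f) :
    CocompactBy P D := by
  obtain ⟨C, hC, hCD, hcov⟩ := hP
  refine ⟨C, hC, hCD, fun x hx => ?_⟩
  obtain ⟨g, c, hPg, -, hg, y, hy, e⟩ := hcov x hx 1 one_pos
  exact ⟨g, hPg, hg.preserves, y, hy, e⟩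

lemma isParabolaTimesRay_of_affine (hF : Module.finrank ℝ F = 2)
    (h : ProperDomain (strictEpi D f)) {P : (F ≃ᵃ[ℝ] F) → Prop} (hP : ContractsBy P D f)
    (hnc : ¬ ∃ v, ∀ x ∈ strictEpi D f, ∀ t : ℝ, 0 < t → v + t • (x - v) ∈ strictEpi D f)
    (a : F →ᵃ[ℝ] ℝ) (ha : ∀ x ∈ D, f x = a x) : IsParabolaTimesRay (strictEpi D f) := by
  have hrec : ∀ v ∈ recCone D, (v, a.linear v) ∈ recCone (strictEpi D f) := by
    rintro v hv ⟨x, z⟩ ⟨hx, hz⟩ t ht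
    have hx' := hv x hx t ht
    refine ⟨hx', ?_⟩
    simp only [Prod.smul_mk, Prod.mk_add_mk, smul_eq_mul] at hz ⊢
    rw [ha _ hx', affineMap_apply_eq, map_add, map_smul, ← add_assoc, ← affineMap_apply_eq,
      ← ha x hx, smul_eq_mul]
    linarith
  have hD : ProperDomain D := by
    refine ⟨nonempty_of_strictEpi h, isOpen_of_strictEpi h, (convexOn_of_strictEpi h).1,
      fun v hv hv' => ?_⟩
    have := h.salient _ (hrec v hv) (by simpa using hrec _ hv')
    exact congrArg Prod.fst this
  have hDnc : ¬ ∃ v : F, ∀ x ∈ D, ∀ t : ℝ, 0 < t → v + t • (x - v) ∈ D := by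
    rintro ⟨v, hv⟩
    refine hnc ⟨(v, a v), ?_⟩
    rintro ⟨x, z⟩ ⟨hx, hz⟩ t ht
    have hx' := hv x hx t ht
    refine ⟨hx', ?_⟩
    simp only [Prod.mk_sub_mk, Prod.smul_mk, Prod.mk_add_mk, smul_eq_mul] at hz ⊢
    rw [ha _ hx', affineMap_apply_eq, map_add, map_smul, map_sub, ← add_assoc,
      ← affineMap_apply_eq, smul_eq_mul]
    rw [ha x hx] at hz
    have h1 := affineMap_apply_eq a x
    have h2 := affineMap_apply_eq a v
    have : a.linear x - a.linear v < z - a v := by linarith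
    have := mul_lt_mul_of_pos_left this ht
    linarith
  obtain ⟨e, he⟩ := hD.exists_affineEquiv_of_finrank_two hF hP.cocompactBy hDnc
  let S : (F × ℝ) ≃ᵃ[ℝ] (F × ℝ) :=
    ((LinearEquiv.refl ℝ F).skewProd (LinearEquiv.refl ℝ ℝ) (-a.linear)).toAffineEquiv.trans
      (AffineEquiv.constVAdd ℝ _ (0, -a 0))
  refine ⟨S.trans (e.prodCongr (AffineEquiv.refl ℝ ℝ)), fun ⟨x, z⟩ => ?_⟩
  have hS : S (x, z) = (x, z - a x) := by
    rw [affineMap_apply_eq a x]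
    simp [S]
    ring
  rw [AffineEquiv.trans_apply, hS]
  change x ∈ D ∧ f x < z ↔ _ ∧ 0 < z - a x
  rw [sub_pos]
  refine Iff.trans (and_congr_right fun hx => ?_) (and_congr_left fun _ => he x)
  rw [ha x hx]

lemma IsParabolaTimesRay.of_preimage {E E' : Type*} [AddCommGroup E] [Module ℝ E]
    [AddCommGroup E'] [Module ℝ E'] {Ω : Set E} (e : E' ≃ₗ[ℝ] E)
    (h : IsParabolaTimesRay (e ⁻¹' Ω)) : IsParabolaTimesRay Ω := by
  obtain ⟨a, ha⟩ := h
  refine ⟨e.symm.toAffineEquiv.trans a, fun x => ?_⟩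
  have := ha (e.symm x)
  rw [mem_preimage, e.apply_symm_apply] at this
  exact this

lemma cone_of_preimage {E E' : Type*} [AddCommGroup E] [Module ℝ E]
    [AddCommGroup E'] [Module ℝ E'] {Ω : Set E} (e : E' ≃ₗ[ℝ] E)
    (h : ∃ v, ∀ x ∈ e ⁻¹' Ω, ∀ t : ℝ, 0 < t → v + t • (x - v) ∈ e ⁻¹' Ω) :
    ∃ v, ∀ x ∈ Ω, ∀ t : ℝ, 0 < t → v + t • (x - v) ∈ Ω := by
  obtain ⟨v, hv⟩ := h
  refine ⟨e v, fun x hx t ht => ?_⟩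
  have := hv (e.symm x) (by simpa using hx) t ht
  simpa using this

variable {w : F}

/-- The linear coordinates on `F × ℝ` given by `n`, the vertical direction, and `w`. -/
lemma exists_coordinates (hF : Module.finrank ℝ F = 2) {n w : F}
    (hli : ∀ a b : ℝ, a • n + b • w = 0 → a = 0 ∧ b = 0) :
    ∃ σ : ((ℝ × ℝ) × ℝ) ≃ₗ[ℝ] (F × ℝ), ∀ a z b, σ ((a, z), b) = (a • n + b • w, z) := by
  let φ : ((ℝ × ℝ) × ℝ) →ₗ[ℝ] (F × ℝ) :=
    { toFun := fun p => (p.1.1 • n + p.2 • w, p.1.2)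
      map_add' := fun p p' => by
        refine Prod.ext ?_ rfl
        simp only [Prod.fst_add, Prod.snd_add]
        module
      map_smul' := fun c p => by
        refine Prod.ext ?_ rfl
        simp only [Prod.smul_fst, Prod.smul_snd, smul_eq_mul, RingHom.id_apply]
        module }
  refine ⟨LinearEquiv.ofBijective φ ⟨?_, ?_⟩, fun _ _ _ => rfl⟩
  · rw [← LinearMap.ker_eq_bot, LinearMap.ker_eq_bot']
    rintro ⟨⟨a, z⟩, b⟩ h
    obtain ⟨h1, rfl⟩ := Prod.ext_iff.1 h
    obtain ⟨rfl, rfl⟩ := hli a b h1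
    rfl
  · rintro ⟨x, z⟩
    obtain ⟨a, b, rfl⟩ := planar_span hF hli x
    exact ⟨((a, z), b), rfl⟩

/-- A quasi-homogeneous three-dimensional domain with a planar recession cone is the product of
a parabola and a half-line, unless it is a cone. -/
theorem HorizontalRay.isParabolaTimesRay (hF : Module.finrank ℝ F = 2) (h : HorizontalRay D f w)
    (hP : CocompactBy (fun g => ScalesRay (0, 1) g ∧ ScalesRay (w, 0) g) (strictEpi D f))
    (hnc : ¬ ∃ v, ∀ x ∈ strictEpi D f, ∀ t : ℝ, 0 < t → v + t • (x - v) ∈ strictEpi D f) :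
    IsParabolaTimesRay (strictEpi D f) := by
  have : FiniteDimensional ℝ F := Module.finite_of_finrank_pos (by omega)
  have hC : ContractsBy (ScalesRay w) D f := by
    refine .of_cocompactBy h.proper hP (fun g _ hg => hg.1) fun g g' hg hgg' => ?_
    obtain ⟨μ, hμ, e⟩ := hg.2
    refine ⟨μ, hμ, ?_⟩
    have := hgg' (w, 0)
    rw [e] at this
    exact this.symm
  have hDu := h.ne_univ hC
  have hunb : ∀ q (l : DegenerateLimit (ScalesRay w) D f q), ¬ Bornology.IsBounded l.image :=
    fun q l hb => hDu (l.eq_univ_of_bounded h.proper hC hb)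
  obtain ⟨q, hq⟩ := nonempty_of_strictEpi h.proper
  obtain ⟨l⟩ := hC.nonempty_degenerateLimit h.proper hq
  by_cases hs : Function.Surjective l.L
  · obtain ⟨s, hs'⟩ := exists_generalized_inverse (l.L : F →ₗ[ℝ] F)
    have hLs : ∀ x, l.L (s x) = x := by
      intro x
      obtain ⟨y, rfl⟩ := hs x
      exact hs' y
    refine isParabolaTimesRay_of_affine hF h.proper hC hnc
      ((l.m ∘ₗ s).toAffineMap + AffineMap.const ℝ F (f q - l.m (s q))) fun y hy => ?_
    have e : q + l.L (l.p + s (y - q) - l.p) = y := by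
      rw [add_sub_cancel_left, hLs, add_sub_cancel]
    have h1 := l.f_eq (l.p + s (y - q)) ((l.mem_iff _).1 (by rwa [e]))
    rw [e, add_sub_cancel_left, map_sub, map_sub] at h1
    change f y = l.m (s y) + (f q - l.m (s q))
    linarith
  · have hLw : l.L w ≠ 0 := by
      intro h0
      have hmem : ∀ t : ℝ, q + t • w ∈ D := by
        intro t
        rw [← l.mem_iff, add_sub_right_comm, map_add, map_smul, h0, smul_zero, add_zero, l.mem_iff]
        exact hq
      exact h.not_line q fun t => ⟨hmem t, (h.apply_eq hq l (hunb q l) (hmem t)).le⟩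
    obtain ⟨n, hn, hn0⟩ : ∃ n, l.L n = 0 ∧ n ≠ 0 := by
      by_contra! hinj
      have : Function.Injective (l.L : F →ₗ[ℝ] F) :=
        LinearMap.ker_eq_bot.1 (LinearMap.ker_eq_bot'.2 hinj)
      exact hs (LinearMap.injective_iff_surjective.1 this)
    have hli : ∀ a b : ℝ, a • n + b • w = 0 → a = 0 ∧ b = 0 := by
      refine independent_of_not_smul hn0 fun a ha => hLw ?_
      exact (congrArg l.L ha).trans (by rw [map_smul, hn, smul_zero])
    have hDn : ∀ x ∈ D, ∀ t : ℝ, x + t • n ∈ D := by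
      intro x hx t
      rw [← l.mem_iff, add_sub_right_comm, map_add, map_smul, hn, smul_zero, add_zero, l.mem_iff]
      exact hx
    have hfw : ∀ x ∈ D, ∀ t : ℝ, x + t • w ∈ D → f (x + t • w) = f x := by
      intro x hx t ht
      obtain ⟨l'⟩ := hC.nonempty_degenerateLimit h.proper hx
      exact h.apply_eq hx l' (hunb x l') ht
    obtain ⟨σ, hσ⟩ := exists_coordinates hF hli
    have hprod : ∀ a z b a' z' b', ((a, z), b) ∈ σ ⁻¹' strictEpi D f →
        ((a', z'), b') ∈ σ ⁻¹' strictEpi D f → ((a, z), b') ∈ σ ⁻¹' strictEpi D f := by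
      intro a z b a' z' b' h1 h2
      rw [mem_preimage, hσ] at h1 h2 ⊢
      have e1 : a • n + b' • w = a' • n + b' • w + (a - a') • n := by module
      have e2 : a • n + b' • w = a • n + b • w + (b' - b) • w := by module
      have hm : a • n + b' • w ∈ D := by
        rw [e1]
        exact hDn _ h2.1 _
      refine ⟨hm, ?_⟩
      rw [e2] at hm ⊢
      simp only
      rw [hfw _ h1.1 _ hm]
      exact h1.2
    have hpre := h.proper.preimage σ.toContinuousLinearEquiv
    have hcoc := hP.preimage σ.toContinuousLinearEquiv
    have hvert : (((0, 0), 1) : (ℝ × ℝ) × ℝ) ∈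
        recCone (σ.toContinuousLinearEquiv ⁻¹' strictEpi D f) := by
      rw [mem_recCone_preimage]
      have : σ ((0, 0), 1) = (w, 0) := by rw [hσ]; simp
      change σ ((0, 0), 1) ∈ _
      rw [this]
      exact h.mem
    obtain ⟨D', f', e⟩ := hpre.exists_strictEpi hvert
    have e' : σ ⁻¹' strictEpi D f = strictEpi D' f' := e
    rw [e] at hpre hcoc
    have hC' : ContractsBy (fun _ => True) D' f' := by
      refine .of_cocompactBy hpre hcoc (fun g _ hg => ?_) fun _ _ _ _ => trivial
      have hσw : σ.toContinuousLinearEquiv ((0 : ℝ × ℝ), (1 : ℝ)) = (w, 0) := by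
        change σ ((0, 0), 1) = _
        rw [hσ]; simp
      exact scalesRay_of_conjAffine (by rw [hσw]; exact hg.2)
    have hle : ∀ y ∈ D', ∀ y' ∈ D', f' y ≤ f' y' := by
      rintro ⟨a, z⟩ hy ⟨a', z'⟩ hy'
      refine le_of_forall_gt_imp_ge_of_dense fun b' hb' => ?_
      have := hprod a z (f' (a, z) + 1) a' z' b' (by rw [e']; exact ⟨hy, by simp⟩)
        (by rw [e']; exact ⟨hy', hb'⟩)
      rw [e'] at this
      exact this.2.le
    obtain ⟨y₀, hy₀⟩ := nonempty_of_strictEpi hpre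
    refine IsParabolaTimesRay.of_preimage σ ?_
    rw [e']
    refine isParabolaTimesRay_of_affine (by simp) hpre hC' (fun hc => hnc ?_)
      (AffineMap.const ℝ _ (f' y₀)) fun y hy => le_antisymm (hle y hy y₀ hy₀) (hle y₀ hy₀ y hy)
    rw [← e'] at hc
    exact cone_of_preimage σ hc

end Products

section ThreeDimensional

variable {E : Type*} [NormedAddCommGroup E] [NormedSpace ℝ E]

lemma ProperDomain.recCone_le_span_pair (hE : Module.finrank ℝ E = 3) {Ω : Set E}
    (hΩ : ProperDomain Ω) {P : (E ≃ᵃ[ℝ] E) → Prop} (hP : CocompactBy P Ω)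
    (hnc : ¬ ∃ v : E, ∀ x ∈ Ω, ∀ t : ℝ, 0 < t → v + t • (x - v) ∈ Ω) {u v : E}
    (hu : u ∈ recCone Ω) (hv : v ∈ recCone Ω)
    (hli : ∀ a b : ℝ, a • u + b • v = 0 → a = 0 ∧ b = 0) {x : E} (hx : x ∈ recCone Ω) :
    ∃ a b : ℝ, x = a • u + b • v := by
  have : FiniteDimensional ℝ E := Module.finite_of_finrank_pos (by omega)
  let S := Submodule.span ℝ (recCone Ω)
  have hlt : Module.finrank ℝ S < Module.finrank ℝ E :=
    Submodule.finrank_lt (hΩ.span_recCone_ne_top hP hnc)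
  have hli' : ∀ a b : ℝ, a • (⟨u, Submodule.subset_span hu⟩ : S) +
      b • (⟨v, Submodule.subset_span hv⟩ : S) = 0 → a = 0 ∧ b = 0 :=
    fun a b h => hli a b (congrArg Subtype.val h)
  have hge := (LinearIndependent.pair_iff.2 hli').fintype_card_le_finrank
  rw [Fintype.card_fin] at hge
  obtain ⟨a, b, h⟩ := planar_span (by omega : Module.finrank ℝ S = 2) hli'
    (⟨x, Submodule.subset_span hx⟩ : S)
  exact ⟨a, b, congrArg Subtype.val h⟩

lemma exists_coordinates_of_not_mem (hE : Module.finrank ℝ E = 3) {S : Submodule ℝ E}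
    {n u₁ u₂ : E} (hn : n ∉ S) (h₁ : u₁ ∈ S) (h₂ : u₂ ∈ S)
    (hli : LinearIndependent ℝ ![u₁, u₂]) :
    ∃ e : ((ℝ × ℝ) × ℝ) ≃ₗ[ℝ] E, e ((0, 0), 1) = u₁ ∧ e ((0, 1), 0) = u₂ := by
  let φ : ((ℝ × ℝ) × ℝ) →ₗ[ℝ] E :=
    ((LinearMap.toSpanSingleton ℝ E n).coprod (LinearMap.toSpanSingleton ℝ E u₂)).coprod
      (LinearMap.toSpanSingleton ℝ E u₁)
  have hφ : ∀ a b c, φ ((a, b), c) = a • n + b • u₂ + c • u₁ := fun _ _ _ => rfl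
  have hinj : Function.Injective φ := by
    rw [← LinearMap.ker_eq_bot, LinearMap.ker_eq_bot']
    rintro ⟨⟨a, b⟩, c⟩ h
    rw [hφ] at h
    have ha : a = 0 := by
      by_contra ha
      refine hn ?_
      have : n = -a⁻¹ • (b • u₂ + c • u₁) := by
        have : a • n = -(b • u₂ + c • u₁) := by
          rw [eq_neg_iff_add_eq_zero, ← add_assoc, h]
        rw [neg_smul, ← smul_neg, ← this, smul_smul, inv_mul_cancel₀ ha, one_smul]
      rw [this]
      exact S.smul_mem _ (S.add_mem (S.smul_mem _ h₂) (S.smul_mem _ h₁))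
    rw [ha, zero_smul, zero_add, add_comm] at h
    obtain ⟨rfl, rfl⟩ := LinearIndependent.pair_iff.1 hli c b h
    rw [ha]
    rfl
  have : FiniteDimensional ℝ E := Module.finite_of_finrank_pos (by omega)
  have hdim : Module.finrank ℝ ((ℝ × ℝ) × ℝ) = Module.finrank ℝ E := by
    rw [hE]; simp
  refine ⟨LinearEquiv.ofInjectiveOfFinrankEq φ hinj hdim, ?_, ?_⟩
  · change φ _ = _
    rw [hφ]; simp
  · change φ _ = _
    rw [hφ]; simp

/-- The classification of quasi-homogeneous domains in dimension three. -/
theorem ProperDomain.classification (hE : Module.finrank ℝ E = 3) {Ω : Set E}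
    (hΩ : ProperDomain Ω) {P : (E ≃ᵃ[ℝ] E) → Prop} (hP : CocompactBy P Ω)
    (hnc : ¬ ∃ v : E, ∀ x ∈ Ω, ∀ t : ℝ, 0 < t → v + t • (x - v) ∈ Ω) :
    (∃ e : E ≃ᵃ[ℝ] ((Fin 2 → ℝ) × ℝ), ∀ x, x ∈ Ω ↔ ∑ i, (e x).1 i ^ 2 < (e x).2) ∨
      IsParabolaTimesRay Ω := by
  have : FiniteDimensional ℝ E := Module.finite_of_finrank_pos (by omega)
  have : Nontrivial E := Module.nontrivial_of_finrank_pos (R := ℝ) (by omega)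
  obtain ⟨u, hu, hu'⟩ := hΩ.exists_recCone hP
  by_cases hray : ∀ v ∈ recCone Ω, ∃ a : ℝ, v = a • u
  · refine .inl (hΩ.exists_affineEquiv_of_ray hE (.inr rfl) hP hu hu' fun v hv => ?_)
    obtain ⟨a, rfl⟩ := hray v hv
    exact ⟨a, hΩ.nonneg_of_smul_mem hu hu' hv, rfl⟩
  · right
    push Not at hray
    obtain ⟨v, hv, hvu⟩ := hray
    have hli := independent_of_not_smul hu hvu
    obtain ⟨u₁, u₂, hli₁₂, h₁, h₂, hrec⟩ := hΩ.two_rays hli hu' hv fun x hx =>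
      hΩ.recCone_le_span_pair hE hP hnc hu' hv hli hx
    obtain ⟨n, hn⟩ : ∃ n, n ∉ Submodule.span ℝ (recCone Ω) := by
      by_contra! hall
      exact hΩ.span_recCone_ne_top hP hnc (eq_top_iff.2 fun x _ => hall x)
    obtain ⟨e, e₁, e₂⟩ := exists_coordinates_of_not_mem hE hn (Submodule.subset_span h₁)
      (Submodule.subset_span h₂) hli₁₂
    have hP₂ := hP.scalesRays (u₁ := u₁) (u₂ := u₂)
      (fun g => g.toAffineMap.continuous_of_finiteDimensional)
      fun g hg => scales_or_swaps hli₁₂ hrec h₁ h₂ hg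
    set A := e.toContinuousLinearEquiv
    have hA₁ : A ((0, 0), 1) = u₁ := e₁
    have hA₂ : A ((0, 1), 0) = u₂ := e₂
    have hΩ' := hΩ.preimage A
    have hvert : (((0, 0), 1) : (ℝ × ℝ) × ℝ) ∈ recCone (A ⁻¹' Ω) := by
      rwa [mem_recCone_preimage, hA₁]
    obtain ⟨D, f, hDf⟩ := hΩ'.exists_strictEpi hvert
    have hP' := (hP₂.preimage A).mono
      (Q := fun g => ScalesRay ((0, 0), 1) g ∧ ScalesRay ((0, 1), 0) g) fun g _ hg =>
        ⟨scalesRay_of_conjAffine (by rw [hA₁]; exact hg.1),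
          scalesRay_of_conjAffine (by rw [hA₂]; exact hg.2)⟩
    have hH : HorizontalRay D f (0, 1) := by
      refine ⟨by rwa [← hDf], by simp, ?_, fun x c hxc => ?_⟩
      · rw [← hDf, mem_recCone_preimage, hA₂]
        exact h₂
      · rw [← hDf, mem_recCone_preimage] at hxc
        obtain ⟨a, b, ha, hb, h⟩ := hrec _ hxc
        have h' : A (x, c) = A ((0, b), a) := by
          rw [h, ← hA₁, ← hA₂, ← map_smul, ← map_smul, ← map_add]
          simp
        obtain ⟨hx, hc⟩ := Prod.mk.inj (A.injective h')
        exact ⟨by rwa [hc], b, hb, by rw [hx]; simp⟩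
    rw [hDf] at hP'
    refine IsParabolaTimesRay.of_preimage e ?_
    have hDf' : e ⁻¹' Ω = strictEpi D f := hDf
    rw [hDf']
    refine hH.isParabolaTimesRay (by simp) hP' fun hc => hnc ?_
    rw [← hDf'] at hc
    exact cone_of_preimage e hc

end ThreeDimensional

section Matrices

lemma affAct_mulVec {n : ℕ} (g : GL (Fin (n + 1)) ℝ) (v : Fin n → ℝ) (i : Fin n) :
    (g.val *ᵥ Fin.snoc v 0) i.castSucc = ∑ j : Fin n, g.val i.castSucc j.castSucc * v j := by
  simp [Matrix.mulVec, dotProduct, Fin.sum_univ_castSucc]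

/-- The linear part of an affine-form matrix. -/
def linearPart (n : ℕ) (g : GL (Fin (n + 1)) ℝ) : (Fin n → ℝ) →ₗ[ℝ] (Fin n → ℝ) :=
  Matrix.mulVecLin (Matrix.of fun i j : Fin n => g.val i.castSucc j.castSucc)

lemma linearPart_apply {n : ℕ} (g : GL (Fin (n + 1)) ℝ) (v : Fin n → ℝ) (i : Fin n) :
    linearPart n g v i = ∑ j : Fin n, g.val i.castSucc j.castSucc * v j := rfl

lemma IsAffineForm.injective {n : ℕ} {g : GL (Fin (n + 1)) ℝ} (hg : IsAffineForm n g) :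
    Function.Injective (linearPart n g) := by
  rw [← LinearMap.ker_eq_bot, LinearMap.ker_eq_bot']
  intro v hv
  have h : g.val *ᵥ (Fin.snoc v 0 : Fin (n + 1) → ℝ) = 0 := by
    funext i
    refine Fin.lastCases ?_ (fun i => ?_) i
    · simp [Matrix.mulVec, dotProduct, Fin.sum_univ_castSucc, hg.1]
    · rw [affAct_mulVec, ← linearPart_apply, hv]
      rfl
  have h0 : (Fin.snoc v 0 : Fin (n + 1) → ℝ) = 0 := by
    have := congrArg (fun w => (g⁻¹).val *ᵥ w) h
    simpa [Matrix.mulVec_mulVec] using this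
  funext i
  simpa using congrFun h0 i.castSucc

lemma IsAffineForm.exists_affineEquiv {n : ℕ} {g : GL (Fin (n + 1)) ℝ}
    (hg : IsAffineForm n g) :
    ∃ e : (Fin n → ℝ) ≃ᵃ[ℝ] (Fin n → ℝ), ∀ x, e x = affAct n g x := by
  refine ⟨(LinearEquiv.ofInjectiveEndo _ hg.injective).toAffineEquiv.trans
    (AffineEquiv.constVAdd ℝ _ fun i => g.val i.castSucc (Fin.last n)), fun x => ?_⟩
  funext i
  change g.val i.castSucc (Fin.last n) + linearPart n g x i = _
  rw [linearPart_apply, add_comm]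
  rfl

lemma IsQuasiHomogeneous.cocompactBy {n : ℕ} {Ω : Set (Fin n → ℝ)}
    (h : IsQuasiHomogeneous n Ω) : CocompactBy (fun _ => True) Ω := by
  obtain ⟨K, hK, hKΩ, hcov⟩ := h
  refine ⟨K, hK, hKΩ, fun x hx => ?_⟩
  rw [← hcov] at hx
  obtain ⟨g, hg, y, hy, rfl⟩ := Set.mem_iUnion₂.1 hx
  obtain ⟨e, he⟩ := hg.1.exists_affineEquiv
  refine ⟨e, trivial, fun z => ?_, y, hy, he y⟩
  have himage : e '' Ω = Ω := (Set.image_congr fun z _ => he z).trans hg.2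
  constructor
  · intro hz
    rw [← himage] at hz
    obtain ⟨w, hw, hwz⟩ := hz
    rwa [← e.injective hwz]
  · intro hz
    rw [← himage]
    exact ⟨z, hz, rfl⟩

lemma IsProperlyConvexDomain.properDomain {n : ℕ} {Ω : Set (Fin n → ℝ)}
    (h : IsProperlyConvexDomain n Ω) : ProperDomain Ω := by
  obtain ⟨⟨hne, ho, hc⟩, hl⟩ := h
  refine ⟨hne, ho, hc, fun u hu hu' => ?_⟩
  by_contra hu0
  obtain ⟨x, hx⟩ := hne
  refine hl ⟨x, hx, u, hu0, fun t => ?_⟩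
  rcases le_total 0 t with ht | ht
  · exact hu x hx t ht
  · simpa using hu' x hx (-t) (neg_nonneg.2 ht)

lemma AffinelyEquivalent.of_forall_mem_iff {n : ℕ} {Ω Ω' : Set (Fin n → ℝ)}
    (e : (Fin n → ℝ) ≃ᵃ[ℝ] (Fin n → ℝ)) (h : ∀ x, x ∈ Ω ↔ e x ∈ Ω') :
    AffinelyEquivalent n Ω Ω' := by
  refine ⟨e, Set.ext fun y => ⟨?_, fun hy => ⟨e.symm y, ?_, e.apply_symm_apply y⟩⟩⟩
  · rintro ⟨x, hx, rfl⟩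
    exact (h x).1 hx
  · rwa [h, e.apply_symm_apply]

/-- The coordinates of `(Fin 2 → ℝ) × ℝ`. -/
def paraboloidCoordinates : ((Fin 2 → ℝ) × ℝ) ≃ₗ[ℝ] (Fin 3 → ℝ) where
  toFun p := ![p.1 0, p.1 1, p.2]
  invFun x := (![x 0, x 1], x 2)
  map_add' p q := by ext i; fin_cases i <;> rfl
  map_smul' c p := by ext i; fin_cases i <;> rfl
  left_inv p := by
    refine Prod.ext (funext fun i => ?_) rfl
    fin_cases i <;> rfl
  right_inv x := by ext i; fin_cases i <;> rfl

/-- The coordinates of `((Fin 1 → ℝ) × ℝ) × ℝ`. -/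
def parabolaRayCoordinates : (((Fin 1 → ℝ) × ℝ) × ℝ) ≃ₗ[ℝ] (Fin 3 → ℝ) where
  toFun p := ![p.1.1 0, p.1.2, p.2]
  invFun x := ((![x 0], x 1), x 2)
  map_add' p q := by ext i; fin_cases i <;> rfl
  map_smul' c p := by ext i; fin_cases i <;> rfl
  left_inv p := by
    refine Prod.ext (Prod.ext (funext fun i => ?_) rfl) rfl
    fin_cases i
    rfl
  right_inv x := by ext i; fin_cases i <;> rfl

end Matrices

/-- a properly convex quasi-homogeneous affine domain in ℝ³ which is
not a cone is affinely equivalent to the paraboloid or to (parabola) × (half-line). -/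
theorem dim3_classification (Ω : Set (Fin 3 → ℝ))
    (h1 : IsProperlyConvexDomain 3 Ω) (h2 : IsQuasiHomogeneous 3 Ω)
    (hnc : ¬ IsCone 3 Ω) :
    AffinelyEquivalent 3 Ω {x : Fin 3 → ℝ | x 0 ^ 2 + x 1 ^ 2 < x 2} ∨
      AffinelyEquivalent 3 Ω {x : Fin 3 → ℝ | x 0 ^ 2 < x 1 ∧ 0 < x 2} := by
  rcases h1.properDomain.classification (by simp) h2.cocompactBy hnc with ⟨e, he⟩ | ⟨e, he⟩
  · refine .inl (.of_forall_mem_iff (e.trans paraboloidCoordinates.toAffineEquiv) fun x => ?_)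
    rw [he, Fin.sum_univ_two]
    rfl
  · refine .inr (.of_forall_mem_iff (e.trans parabolaRayCoordinates.toAffineEquiv) fun x => ?_)
    rw [he, Fin.sum_univ_one]
    rfl
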